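/- Let g ≥ 2 and n ≥ 2. Then the Hitchin component HIT_n is Zariski-dense in Hom(Γ_g, SL_n(ℝ)): every polynomial P ∈ ℝ[x₁,…,x_{2g·n²}] that vanishes at every point of HIT_n vanishes at every point of Hom(Γ_g, SL_n(ℝ)). -/

import Mathlib

open Matrix MvPolynomial
open scoped commutatorElement

/-- `SL n K`: the special linear group of `n × n` matrices over `K`. -/
abbrev SL (n : ℕ) (K : Type) [CommRing K] := Matrix.SpecialLinearGroup (Fin n) K

/-- Topology on `SL n ℝ` induced from the space of matrices (the Euclidean topology). -/
instance (n : ℕ) (K : Type) [CommRing K] [TopologicalSpace K] :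
    TopologicalSpace (SL n K) :=
  TopologicalSpace.induced (fun A => (A : Matrix (Fin n) (Fin n) K)) inferInstance

/-- The relator `[a₁,b₁][a₂,b₂]⋯[a_g,b_g]` of the genus-`g` surface group;
`(i, false)` is the generator `aᵢ` and `(i, true)` is `bᵢ`. -/
def surfaceRelator (g : ℕ) : FreeGroup (Fin g × Bool) :=
  (List.ofFn fun i : Fin g =>
    ⁅FreeGroup.of (i, false), FreeGroup.of (i, true)⁆).prod

/-- The surface group `Γ_g` of genus `g`. -/
abbrev SurfaceGroup (g : ℕ) : Type :=
  PresentedGroup ({surfaceRelator g} : Set (FreeGroup (Fin g × Bool)))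

/-- The tuple `(ρ(a₁), ρ(b₁), …, ρ(a_g), ρ(b_g))` of matrices associated to a
representation `ρ : Γ_g → SL n ℝ`. -/
def repTuple {g n : ℕ} (ρ : SurfaceGroup g →* SL n ℝ) :
    (Fin g × Bool) → Matrix (Fin n) (Fin n) ℝ :=
  fun x => (ρ (PresentedGroup.of x) : Matrix (Fin n) (Fin n) ℝ)

/-- `Hom(Γ_g, SL_n(K))` as a subset of `K^{2g·n²}`: the `2g`-tuples of matrices of
determinant one whose product of commutators is the identity. -/
def RepVariety (g n : ℕ) (K : Type) [CommRing K] :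
    Set ((Fin g × Bool) → Matrix (Fin n) (Fin n) K) :=
  {A | (∀ x, (A x).det = 1) ∧
    (List.ofFn fun i : Fin g =>
      A (i, false) * A (i, true) * (A (i, false))⁻¹ * (A (i, true))⁻¹).prod = 1}

/-- `ρ₀ : Γ_g → SL₂(ℝ)` is discrete and faithful: injective with discrete image. -/
def IsDiscreteFaithful {g : ℕ} (ρ₀ : SurfaceGroup g →* SL 2 ℝ) : Prop :=
  Function.Injective ρ₀ ∧ DiscreteTopology (ρ₀.range : Subgroup (SL 2 ℝ))

/-- `j : SL₂(ℝ) → SL_n(ℝ)` is a continuous homomorphism acting irreducibly on `ℝⁿ`. -/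
def IsIrreducibleEmbedding (n : ℕ) (j : SL 2 ℝ →* SL n ℝ) : Prop :=
  Continuous j ∧
  ∀ W : Submodule ℝ (Fin n → ℝ),
    (∀ A : SL 2 ℝ, ∀ v ∈ W, (j A : Matrix (Fin n) (Fin n) ℝ).mulVec v ∈ W) →
    W = ⊥ ∨ W = ⊤

/-- A tuple in `ℝ^{2g·n²}` is a Teichmüller representation if it comes from `j ∘ ρ₀` with
`ρ₀` discrete and faithful and `j` continuous and irreducible. -/
def IsTeichmuller (g n : ℕ) (T : (Fin g × Bool) → Matrix (Fin n) (Fin n) ℝ) : Prop :=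
  ∃ (ρ₀ : SurfaceGroup g →* SL 2 ℝ) (j : SL 2 ℝ →* SL n ℝ),
    IsDiscreteFaithful ρ₀ ∧ IsIrreducibleEmbedding n j ∧
    T = repTuple (j.comp ρ₀)

/-- The Hitchin component: the connected component (Euclidean topology) of
`Hom(Γ_g, SL_n(ℝ))` containing the Teichmüller representation `T`. -/
def HIT (g n : ℕ) (T : (Fin g × Bool) → Matrix (Fin n) (Fin n) ℝ) :
    Set ((Fin g × Bool) → Matrix (Fin n) (Fin n) ℝ) :=
  connectedComponentIn (RepVariety g n ℝ) T

/-- A subgroup `H ≤ SL_n(ℝ)` is Zariski-dense in `SL_n(ℝ)`. -/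
def IsZariskiDense (n : ℕ) (H : Subgroup (SL n ℝ)) : Prop :=
  ∀ P : MvPolynomial (Fin n × Fin n) ℝ,
    (∀ h ∈ H, eval (fun p => (h : Matrix (Fin n) (Fin n) ℝ) p.1 p.2) P = 0) →
    ∀ A : SL n ℝ, eval (fun p => (A : Matrix (Fin n) (Fin n) ℝ) p.1 p.2) P = 0

/-- A subgroup `Γ ≤ SL_n(ℝ)` is strongly dense: every pair of noncommuting elements
generates a Zariski-dense subgroup. -/
def IsStronglyDense (n : ℕ) (Γ : Subgroup (SL n ℝ)) : Prop :=
  ∀ x ∈ Γ, ∀ y ∈ Γ, x * y ≠ y * x → IsZariskiDense n (Subgroup.closure {x, y})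

set_option linter.all false

section PartA

theorem exists_derivation_aux {K Ω : Type} [Field K] [Field Ω] [Algebra K Ω] [CharZero K]
    {ι : Type} {s : ι → Ω} (hs : IsTranscendenceBasis K s) (v : ι → Ω) :
    ∃ D : Derivation K Ω Ω, ∀ i, D (s i) = v i := by
  let S := MvPolynomial ι K
  letI : Algebra S Ω := (aeval (R := K) s).toAlgebra
  have hmap : ∀ p : S, algebraMap S Ω p = aeval s p := fun p => rfl
  haveI : IsScalarTower K S Ω := IsScalarTower.of_algebraMap_eq (fun x => by
    rw [hmap]; simp [S])
  haveI hinj : FaithfulSMul S Ω := (faithfulSMul_iff_algebraMap_injective S Ω).2 hs.1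
  letI : Algebra (FractionRing S) Ω := FractionRing.liftAlgebra S Ω
  haveI : IsScalarTower S (FractionRing S) Ω := FractionRing.isScalarTower_liftAlgebra S Ω
  haveI : CharZero S := inferInstance
  haveI : CharZero (FractionRing S) := inferInstance
  haveI halgS : Algebra.IsAlgebraic S Ω := by
    have h1 := hs.isAlgebraic
    have hr : Algebra.adjoin K (Set.range s) = (aeval (R := K) s).range :=
      Algebra.adjoin_range_eq_range_aeval K s
    constructor
    intro x
    obtain ⟨p, hp0, hp⟩ := h1.isAlgebraic x
    have hsurj : Function.Surjective (fun q : S => (⟨aeval s q, by rw [hr]; exact ⟨q, rfl⟩⟩ : Algebra.adjoin K (Set.range s))) := by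
      rintro ⟨y, hy⟩
      rw [hr] at hy
      obtain ⟨q, hq⟩ := hy
      exact ⟨q, Subtype.ext hq⟩
    let e : S →+* Algebra.adjoin K (Set.range s) :=
      ((aeval (R := K) s).codRestrict _ (fun q => by rw [hr]; exact ⟨q, rfl⟩)).toRingHom
    have he : Function.Surjective e := hsurj
    obtain ⟨q, hq⟩ := Polynomial.map_surjective e he p
    refine ⟨q, ?_, ?_⟩
    · rintro rfl; simp at hq; exact hp0 hq.symm
    · rw [← hq] at hp
      rw [Polynomial.aeval_def] at hp ⊢
      rw [Polynomial.eval₂_map] at hp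
      exact hp
  haveI : Algebra.IsAlgebraic (FractionRing S) Ω :=
    (IsFractionRing.comap_isAlgebraic_iff (A := S) (K := FractionRing S) (C := Ω)).1 halgS
  haveI : Algebra.FormallyEtale S (FractionRing S) :=
    Algebra.FormallyEtale.of_isLocalization (nonZeroDivisors S)
  haveI : Algebra.FormallyEtale (FractionRing S) Ω :=
    Algebra.FormallyEtale.of_isSeparable _ _
  haveI : Algebra.FormallyEtale S Ω := Algebra.FormallyEtale.comp S (FractionRing S) Ω
  let d : Derivation K S Ω := MvPolynomial.mkDerivation K v
  let l := d.liftKaehlerDifferential.liftBaseChange Ω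
  let e := (KaehlerDifferential.tensorKaehlerEquivOfFormallyEtale K S Ω).symm
  refine ⟨(l ∘ₗ e.toLinearMap).compDer (KaehlerDifferential.D K Ω), fun i => ?_⟩
  have h1 : s i = algebraMap S Ω (X i) := by rw [hmap]; simp
  have h2 := KaehlerDifferential.tensorKaehlerEquivOfFormallyEtale_symm_D_algebraMap K S Ω (X i)
  change l (e (KaehlerDifferential.D K Ω (s i))) = v i
  rw [h1]
  erw [h2]
  simp only [l, LinearMap.liftBaseChange_one_tmul, Derivation.liftKaehlerDifferential_comp_D]
  exact MvPolynomial.mkDerivation_X K v i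

theorem exists_derivation {K Ω : Type} [Field K] [Field Ω] [Algebra K Ω] [CharZero K]
    {ι : Type} {s : ι → Ω} (hs : AlgebraicIndependent K s) (v : ι → Ω) :
    ∃ D : Derivation K Ω Ω, ∀ i, D (s i) = v i := by
  classical
  obtain ⟨B, hB, hB2⟩ := exists_isTranscendenceBasis_superset (AlgebraicIndependent.coe_range hs)
  have hinj := hs.injective
  obtain ⟨D, hD⟩ := exists_derivation_aux hB2
    (fun b => if h : ∃ i, s i = b then v h.choose else 0)
  refine ⟨D, fun i => ?_⟩
  have := hD ⟨s i, hB ⟨i, rfl⟩⟩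
  have hex : ∃ j, s j = s i := ⟨i, rfl⟩
  simp only [hex, dif_pos] at this
  rw [this, hinj hex.choose_spec]

/-- The map `D ↦ (D (x i))_i`. -/
noncomputable def tanMap (k : Type) {Ω : Type} [Field k] [Field Ω] [Algebra k Ω] {ι : Type}
    (x : ι → Ω) : Derivation k Ω Ω →ₗ[Ω] (ι → Ω) where
  toFun D i := D (x i)
  map_add' D E := by ext; simp
  map_smul' c D := by ext; simp

@[simp] theorem tanMap_apply (k : Type) {Ω : Type} [Field k] [Field Ω] [Algebra k Ω] {ι : Type}
    (x : ι → Ω) (D : Derivation k Ω Ω) (i : ι) : tanMap k x D i = D (x i) := rfl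

/-- Dimension of the space of values of derivations: equals the transcendence degree. -/
noncomputable def rk (k : Type) {Ω : Type} [Field k] [Field Ω] [Algebra k Ω] {ι : Type}
    (x : ι → Ω) : ℕ := Module.finrank Ω (LinearMap.range (tanMap k x))

variable {k Ω : Type} [Field k] [Field Ω] [Algebra k Ω]

theorem rk_le_card {ι : Type} [Fintype ι] (x : ι → Ω) : rk k x ≤ Fintype.card ι := by
  have := Submodule.finrank_le (LinearMap.range (tanMap k x))
  simpa [rk] using this

theorem deriv_aeval {ι : Type} [Fintype ι] (x : ι → Ω) (D : Derivation k Ω Ω)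
    (f : MvPolynomial ι k) : D (aeval x f) = ∑ i, aeval x (pderiv i f) * D (x i) := by
  classical
  induction f using MvPolynomial.induction_on with
  | C a => simp
  | add p q hp hq => simp [hp, hq, add_mul, Finset.sum_add_distrib]
  | mul_X p i hp =>
    simp only [map_mul, aeval_X, Derivation.leibniz, smul_eq_mul, hp, map_add, pderiv_X,
      add_mul, Finset.sum_add_distrib, Finset.mul_sum]
    congr 1
    · rw [Finset.sum_eq_single i]
      · simp
      · intro b _ hb; simp [Pi.single_apply, hb.symm]
      · simp
    · refine Finset.sum_congr rfl fun j _ => by ring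

theorem deriv_aeval_eq_zero {ι : Type} [Fintype ι] (x : ι → Ω) (D : Derivation k Ω Ω)
    (hD : ∀ i, D (x i) = 0) (f : MvPolynomial ι k) : D (aeval x f) = 0 := by
  rw [deriv_aeval]; simp [hD]

/-- full rank implies algebraic independence -/
theorem algebraicIndependent_of_rk [CharZero k] {ι : Type} [Fintype ι] (x : ι → Ω)
    (h : Fintype.card ι ≤ rk k x) : AlgebraicIndependent k x := by
  classical
  have htop : LinearMap.range (tanMap k x) = ⊤ := by
    apply Submodule.eq_top_of_finrank_eq
    refine le_antisymm (Submodule.finrank_le _) ?_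
    simpa [rk] using h
  rw [algebraicIndependent_iff]
  intro p
  induction hN : p.totalDegree using Nat.strong_induction_on generalizing p with
  | _ N ih =>
    intro hp
    by_contra hne
    have key : ∀ i, aeval x (pderiv i p) = 0 := by
      intro i
      obtain ⟨D, hD⟩ : Pi.single i 1 ∈ LinearMap.range (tanMap k x) := by rw [htop]; trivial
      have h1 := deriv_aeval x D p
      rw [hp, map_zero] at h1
      have h2 : ∀ j, D (x j) = (Pi.single i 1 : ι → Ω) j := fun j => by rw [← hD]; rfl
      simp only [h2] at h1
      rw [Finset.sum_eq_single i] at h1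
      · simpa using h1.symm
      · intro b _ hb; simp [hb]
      · simp
    have hz : ∀ i, pderiv i p = 0 := by
      intro i
      by_contra hi
      have hlt : (pderiv i p).totalDegree < N := by
        rw [← hN]
        obtain ⟨m, hm, hm2⟩ := Finset.exists_mem_eq_sup (pderiv i p).support
          (by rwa [MvPolynomial.support_nonempty]) (fun m => m.sum fun _ e => e)
        have hd : (pderiv i p).totalDegree = m.sum fun _ e => e := hm2
        rw [hd]
        rw [mem_support_iff, coeff_pderiv] at hm
        have h3 : m + Finsupp.single i 1 ∈ p.support := by
          rw [mem_support_iff]; exact left_ne_zero_of_mul hm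
        have h4 := MvPolynomial.le_totalDegree h3
        rw [Finsupp.sum_add_index' (by simp) (by simp), Finsupp.sum_single_index (by simp)] at h4
        omega
      exact hi (ih _ hlt _ rfl (key i))
    -- p is constant
    have hc : p = C (coeff 0 p) := by
      ext m
      rw [coeff_C]
      split_ifs with h0
      · rw [h0]
      · obtain ⟨i, hi⟩ : ∃ i, m i ≠ 0 := by
          by_contra hcon; push Not at hcon; exact h0 (by ext i; simp [hcon i])
        have := congrArg (coeff (m - Finsupp.single i 1)) (hz i)
        rw [coeff_pderiv, coeff_zero] at this
        have hm : m - Finsupp.single i 1 + Finsupp.single i 1 = m :=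
          tsub_add_cancel_of_le (by simpa [Finsupp.single_le_iff] using Nat.one_le_iff_ne_zero.2 hi)
        rw [hm] at this
        rcases mul_eq_zero.1 this with h5 | h5
        · exact h5
        · exfalso; norm_cast at h5
    rw [hc] at hp
    simp at hp
    rw [hc, hp] at hne
    simp at hne

theorem rk_le_add {ι κ : Type} [Fintype ι] [Fintype κ] (x : ι → Ω) (z : κ → Ω)
    (V : Submodule Ω (κ → Ω))
    (h : ∀ D : Derivation k Ω Ω, (∀ i, D (x i) = 0) → (fun j => D (z j)) ∈ V) :
    rk k z ≤ rk k x + Module.finrank Ω V := by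
  let F := (tanMap k x).prod (tanMap k z)
  let W := LinearMap.range F
  let p1 : W →ₗ[Ω] (ι → Ω) := (LinearMap.fst Ω _ _).comp W.subtype
  let p2 : W →ₗ[Ω] (κ → Ω) := (LinearMap.snd Ω _ _).comp W.subtype
  have e1 : LinearMap.range p1 = LinearMap.range (tanMap k x) := by
    ext v; constructor
    · rintro ⟨⟨_, ⟨D, rfl⟩⟩, rfl⟩; exact ⟨D, rfl⟩
    · rintro ⟨D, rfl⟩; exact ⟨⟨_, ⟨D, rfl⟩⟩, rfl⟩
  have e2 : LinearMap.range p2 = LinearMap.range (tanMap k z) := by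
    ext v; constructor
    · rintro ⟨⟨_, ⟨D, rfl⟩⟩, rfl⟩; exact ⟨D, rfl⟩
    · rintro ⟨D, rfl⟩; exact ⟨⟨_, ⟨D, rfl⟩⟩, rfl⟩
  have h1 := LinearMap.finrank_range_add_finrank_ker p1
  have h2 := LinearMap.finrank_range_le p2
  have h3 : Module.finrank Ω (LinearMap.ker p1) ≤ Module.finrank Ω V := by
    let q : LinearMap.ker p1 →ₗ[Ω] V := LinearMap.codRestrict V (p2.comp (LinearMap.ker p1).subtype) (by
      rintro ⟨⟨_, ⟨D, rfl⟩⟩, hD⟩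
      exact h D (fun i => congrFun hD i))
    refine LinearMap.finrank_le_finrank_of_injective (f := q) ?_
    rintro ⟨⟨_, ⟨D, rfl⟩⟩, hD⟩ ⟨⟨_, ⟨D', rfl⟩⟩, hD'⟩ hq
    have hq' : tanMap k z D = tanMap k z D' := congrArg Subtype.val hq
    have hE : tanMap k x D = 0 := hD
    have hE' : tanMap k x D' = 0 := hD'
    apply Subtype.ext; apply Subtype.ext
    exact Prod.ext (hE.trans hE'.symm) hq'
  rw [rk, rk, ← e1, ← e2]
  omega

theorem rk_le_of {ι κ : Type} [Fintype ι] [Fintype κ] (x : ι → Ω) (z : κ → Ω)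
    (h : ∀ D : Derivation k Ω Ω, (∀ i, D (x i) = 0) → ∀ j, D (z j) = 0) :
    rk k z ≤ rk k x := by
  have := rk_le_add (k := k) x z ⊥ (fun D hD => by
    rw [Submodule.mem_bot]; ext j; exact h D hD j)
  simpa using this

theorem rk_eq_card [CharZero k] {ι : Type} [Fintype ι] (a : ι → Ω) (ha : AlgebraicIndependent k a) :
    rk k a = Fintype.card ι := by
  have : LinearMap.range (tanMap k a) = ⊤ := by
    rw [LinearMap.range_eq_top]
    intro v
    obtain ⟨D, hD⟩ := exists_derivation ha v
    exact ⟨D, funext hD⟩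
  rw [rk, this]; simp

theorem card_le_rk [CharZero k] {ι α : Type} [Fintype ι] [Fintype α] (x : ι → Ω) (a : α → Ω)
    (ha : AlgebraicIndependent k a)
    (h : ∀ D : Derivation k Ω Ω, (∀ i, D (x i) = 0) → ∀ j, D (a j) = 0) :
    Fintype.card α ≤ rk k x := by
  rw [← rk_eq_card a ha]; exact rk_le_of x a h

theorem rk_add_card_le {ι α κ : Type} [Fintype ι] [Fintype α] [Fintype κ] (x : ι → Ω) (s : α → Ω)
    (z : κ → Ω)
    (hx : ∀ D : Derivation k Ω Ω, (∀ i, D (z i) = 0) → ∀ j, D (x j) = 0)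
    (hs : ∀ D : Derivation k Ω Ω, (∀ i, D (z i) = 0) → ∀ j, D (s j) = 0)
    (hv : ∀ v : α → Ω, ∃ D : Derivation k Ω Ω, (∀ i, D (x i) = 0) ∧ ∀ j, D (s j) = v j) :
    rk k x + Fintype.card α ≤ rk k z := by
  refine le_trans ?_ (rk_le_of (k := k) z (Sum.elim x s) (fun D hD => by
    rintro (i | j)
    · exact hx D hD i
    · exact hs D hD j))
  let F := tanMap k (Sum.elim x s)
  let W := LinearMap.range F
  let p1 : W →ₗ[Ω] (ι → Ω) := (LinearMap.funLeft Ω Ω (Sum.inl : ι → ι ⊕ α)).comp W.subtype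
  have e1 : LinearMap.range p1 = LinearMap.range (tanMap k x) := by
    ext v; constructor
    · rintro ⟨⟨_, ⟨D, rfl⟩⟩, rfl⟩; exact ⟨D, rfl⟩
    · rintro ⟨D, rfl⟩; exact ⟨⟨_, ⟨D, rfl⟩⟩, rfl⟩
  have h1 := LinearMap.finrank_range_add_finrank_ker p1
  have h3 : Fintype.card α ≤ Module.finrank Ω (LinearMap.ker p1) := by
    let q : LinearMap.ker p1 →ₗ[Ω] (α → Ω) :=
      (LinearMap.funLeft Ω Ω (Sum.inr : α → ι ⊕ α)).comp (W.subtype.comp (LinearMap.ker p1).subtype)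
    have hq : Function.Surjective q := by
      intro v
      obtain ⟨D, hD1, hD2⟩ := hv v
      exact ⟨⟨⟨_, ⟨D, rfl⟩⟩, funext hD1⟩, funext hD2⟩
    have := LinearMap.finrank_le_finrank_of_surjective hq
    simpa using this
  rw [rk, rk, ← e1]
  change _ ≤ Module.finrank Ω W
  omega

theorem isAlgebraic_of_deriv [CharZero k] {ι : Type} (x : ι → Ω) (t : Ω)
    (h : ∀ D : Derivation k Ω Ω, (∀ i, D (x i) = 0) → D t = 0) :
    IsAlgebraic (IntermediateField.adjoin k (Set.range x)) t := by
  by_contra hcon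
  have htr : Transcendental (IntermediateField.adjoin k (Set.range x)) t := hcon
  haveI : CharZero (IntermediateField.adjoin k (Set.range x)) := inferInstance
  have hai : AlgebraicIndependent (IntermediateField.adjoin k (Set.range x)) (fun _ : Unit => t) := by
    rw [algebraicIndependent_unique_type_iff]; exact htr
  obtain ⟨D, hD⟩ := exists_derivation hai (fun _ => 1)
  have h1 := h (D.restrictScalars k) (fun i => by
    have : x i = algebraMap (IntermediateField.adjoin k (Set.range x)) Ω
        ⟨x i, IntermediateField.subset_adjoin k _ ⟨i, rfl⟩⟩ := rfl
    rw [this]; exact D.map_algebraMap _)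
  have h2 : D t = 0 := h1
  rw [hD ()] at h2
  exact one_ne_zero h2

end PartA

section PartB

variable {k Ω : Type} [Field k] [Field Ω] [Algebra k Ω]
variable {m : Type} [Fintype m] [DecidableEq m]

/-- entries of a tuple of matrices -/
def ent {ι R : Type} (A : ι → Matrix m m R) : ι × m × m → R := fun p => A p.1 p.2.1 p.2.2

theorem map_mul_deriv (D : Derivation k Ω Ω) (A B : Matrix m m Ω) :
    (A * B).map D = A * B.map D + A.map D * B := by
  ext i j
  simp only [Matrix.map_apply, Matrix.mul_apply, map_sum, Derivation.leibniz, smul_eq_mul,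
    Matrix.add_apply, Finset.sum_add_distrib]
  congr 1
  exact Finset.sum_congr rfl fun x _ => mul_comm _ _

theorem map_one_deriv (D : Derivation k Ω Ω) : (1 : Matrix m m Ω).map D = 0 := by
  ext i j
  rw [Matrix.map_apply, Matrix.one_apply]; split_ifs <;> simp

theorem map_smul_deriv (D : Derivation k Ω Ω) (c : Ω) (A : Matrix m m Ω) :
    (c • A).map D = c • A.map D + D c • A := by
  ext i j
  simp [mul_comm]

theorem map_inv_deriv (D : Derivation k Ω Ω) (A : Matrix m m Ω) (hA : A.det ≠ 0)
    (h : A.map D = 0) : A⁻¹.map D = 0 := by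
  have h1 : A * A⁻¹ = 1 := Matrix.mul_nonsing_inv A (isUnit_iff_ne_zero.2 hA)
  have h2 := congrArg (fun M : Matrix m m Ω => M.map D) h1
  simp only [map_mul_deriv, map_one_deriv, h, zero_mul, add_zero] at h2
  have h3 := congrArg (fun M => A⁻¹ * M) h2
  simpa [← mul_assoc, Matrix.nonsing_inv_mul A (isUnit_iff_ne_zero.2 hA)] using h3

theorem rk_le_addM {ι κ : Type} [Fintype ι] [Fintype κ] (x : ι → Ω) (z : κ → Matrix m m Ω)
    (V : Submodule Ω (κ → Matrix m m Ω))
    (h : ∀ D : Derivation k Ω Ω, (∀ i, D (x i) = 0) → (fun j => (z j).map D) ∈ V) :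
    rk k (ent z) ≤ rk k x + Module.finrank Ω V := by
  let e : (κ × m × m → Ω) →ₗ[Ω] (κ → Matrix m m Ω) :=
    { toFun := fun f j => Matrix.of fun a b => f (j, a, b)
      map_add' := fun _ _ => rfl
      map_smul' := fun _ _ => rfl }
  have he : Function.Injective e := by
    intro f f' hf
    ext ⟨j, a, b⟩
    exact congrFun (congrFun (congrFun hf j) a) b
  refine (rk_le_add (k := k) x (ent z) (V.comap e) (fun D hD => h D hD)).trans ?_
  gcongr
  let q : V.comap e →ₗ[Ω] V := e.restrict (fun x hx => hx)
  refine LinearMap.finrank_le_finrank_of_injective (f := q) ?_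
  intro a b hab
  exact Subtype.ext (he (congrArg Subtype.val hab))

/-- commutant of a pair -/
def Zc (A B : Matrix m m Ω) : Submodule Ω (Matrix m m Ω) where
  carrier := {w | w * A = A * w ∧ w * B = B * w}
  add_mem' := by
    rintro a b ⟨h1, h2⟩ ⟨h3, h4⟩
    exact ⟨by rw [add_mul, mul_add, h1, h3], by rw [add_mul, mul_add, h2, h4]⟩
  zero_mem' := by simp
  smul_mem' := by
    rintro c x ⟨h1, h2⟩
    exact ⟨by rw [smul_mul_assoc, h1, mul_smul_comm], by rw [smul_mul_assoc, h2, mul_smul_comm]⟩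

theorem mem_Zc {A B w : Matrix m m Ω} : w ∈ Zc A B ↔ w * A = A * w ∧ w * B = B * w := Iff.rfl

/-- linearised commutator equation -/
def ell (A B C : Matrix m m Ω) : (Bool → Matrix m m Ω) →ₗ[Ω] Matrix m m Ω where
  toFun h := h false * B + A * h true - C * (h true * A + B * h false)
  map_add' x y := by simp only [Pi.add_apply]; noncomm_ring
  map_smul' c x := by
    simp only [Pi.smul_apply, smul_mul_assoc, mul_smul_comm, RingHom.id_apply, ← smul_add, ← smul_sub]

/-- the matrix representing a functional through the trace form -/
def tz (φ : Module.Dual Ω (Matrix m m Ω)) : Matrix m m Ω :=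
  Matrix.of fun i j => φ (Matrix.single j i 1)

theorem tz_spec (φ : Module.Dual Ω (Matrix m m Ω)) (u : Matrix m m Ω) :
    φ u = (tz φ * u).trace := by
  conv_lhs => rw [Matrix.matrix_eq_sum_single u]
  simp only [map_sum, Matrix.trace, Matrix.diag, Matrix.mul_apply, tz, Matrix.of_apply]
  rw [Finset.sum_comm]
  refine Finset.sum_congr rfl fun i _ => Finset.sum_congr rfl fun j _ => ?_
  have : Matrix.single j i (u j i) = (u j i) • Matrix.single j i (1 : Ω) := by simp [Matrix.smul_single]
  rw [this, map_smul, smul_eq_mul, mul_comm]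

theorem eq_zero_of_trace (z : Matrix m m Ω) (h : ∀ u, (z * u).trace = 0) : z = 0 := by
  ext i j
  have := h (Matrix.single j i 1)
  rw [Matrix.trace_mul_single] at this
  simpa using this

theorem tz_mem {A B C : Matrix m m Ω} (hC : A * B = C * (B * A))
    (φ : Module.Dual Ω (Matrix m m Ω)) (h : ∀ x, φ (ell A B C x) = 0) :
    tz φ * A * B ∈ Zc A B := by
  set z := tz φ with hz
  have h1 : B * z = z * C * B := by
    rw [← sub_eq_zero]
    apply eq_zero_of_trace
    intro u
    have := h (fun b => if b then 0 else u)
    rw [tz_spec] at this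
    simp only [ell, LinearMap.coe_mk, AddHom.coe_mk] at this
    simp only [Bool.false_eq_true, if_false, if_true, mul_zero, add_zero, zero_mul, zero_add] at this
    rw [← hz, mul_sub, Matrix.trace_sub, Matrix.trace_mul_comm, mul_assoc, Matrix.trace_mul_comm] at this
    rw [sub_mul, Matrix.trace_sub]
    simpa [mul_assoc] using this
  have h2 : z * A = A * z * C := by
    rw [← sub_eq_zero]
    apply eq_zero_of_trace
    intro u
    have := h (fun b => if b then u else 0)
    rw [tz_spec] at this
    simp only [ell, LinearMap.coe_mk, AddHom.coe_mk] at this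
    simp only [Bool.false_eq_true, if_false, if_true, mul_zero, add_zero, zero_mul, zero_add] at this
    rw [← hz, mul_sub, Matrix.trace_sub, ← mul_assoc z C, ← mul_assoc (z * C),
      Matrix.trace_mul_comm (z * C * u)] at this
    rw [sub_mul, Matrix.trace_sub]
    simpa [mul_assoc] using this
  have e1 : B * z * A = z * A * B := by
    rw [h1, mul_assoc, mul_assoc, mul_assoc, ← hC]
  have e2 : A * B * z = z * A * B := by
    rw [h2, mul_assoc, mul_assoc, mul_assoc, h1, mul_assoc]
  constructor
  · calc z * A * B * A = A * B * z * A := by rw [e2]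
      _ = A * (B * z * A) := by simp only [mul_assoc]
      _ = A * (z * A * B) := by rw [e1]
  · calc z * A * B * B = B * z * A * B := by rw [e1]
      _ = B * (z * A * B) := by simp only [mul_assoc]

theorem mul_right_cancel_det {A X Y : Matrix m m Ω} (hA : A.det ≠ 0) (h : X * A = Y * A) : X = Y := by
  have := congrArg (fun M => M * A⁻¹) h
  simpa [mul_assoc, Matrix.mul_nonsing_inv A (isUnit_iff_ne_zero.2 hA)] using this

theorem mul_left_cancel_det {A X Y : Matrix m m Ω} (hA : A.det ≠ 0) (h : A * X = A * Y) : X = Y := by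
  have := congrArg (fun M => A⁻¹ * M) h
  simpa [← mul_assoc, Matrix.nonsing_inv_mul A (isUnit_iff_ne_zero.2 hA)] using this

theorem finrank_ker_ell {A B C : Matrix m m Ω} (hA : A.det ≠ 0) (hB : B.det ≠ 0)
    (hC : A * B = C * (B * A)) :
    Module.finrank Ω (LinearMap.ker (ell A B C)) ≤ Fintype.card m ^ 2 + Module.finrank Ω (Zc A B) := by
  have h1 := LinearMap.finrank_range_add_finrank_ker (ell A B C)
  have h2 := LinearMap.finrank_range_add_finrank_ker (ell A B C).dualMap
  have h3 := LinearMap.finrank_range_dualMap_eq_finrank_range (ell A B C)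
  have h4 : Module.finrank Ω (LinearMap.ker (ell A B C).dualMap) ≤ Module.finrank Ω (Zc A B) := by
    let q : LinearMap.ker (ell A B C).dualMap →ₗ[Ω] Zc A B :=
      { toFun := fun φ => ⟨tz φ.1 * A * B, tz_mem hC φ.1 (fun x => by
          exact LinearMap.congr_fun φ.2 x)⟩
        map_add' := fun φ ψ => by
          apply Subtype.ext
          change tz (φ.1 + ψ.1) * A * B = tz φ.1 * A * B + tz ψ.1 * A * B
          rw [← add_mul, ← add_mul]; rfl
        map_smul' := fun c φ => by
          apply Subtype.ext
          change tz (c • φ.1) * A * B = c • (tz φ.1 * A * B)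
          rw [← smul_mul_assoc, ← smul_mul_assoc]; rfl }
    refine LinearMap.finrank_le_finrank_of_injective (f := q) ?_
    intro φ ψ h
    have h' : tz φ.1 * A * B = tz ψ.1 * A * B := congrArg Subtype.val h
    have h5 := mul_right_cancel_det hA (mul_right_cancel_det hB h')
    apply Subtype.ext
    ext1 u
    rw [tz_spec, tz_spec, h5]
  have h6 : Module.finrank Ω (Module.Dual Ω (Matrix m m Ω)) = Fintype.card m ^ 2 := by
    rw [Subspace.dual_finrank_eq, Module.finrank_matrix]; simp [sq]
  have h7 : Module.finrank Ω (Bool → Matrix m m Ω) = 2 * Fintype.card m ^ 2 := by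
    rw [Module.finrank_pi_fintype]; simp [Module.finrank_matrix, sq]
  rw [h6] at h2
  rw [h7] at h1
  omega

end PartB

section PartB2

variable {k Ω : Type} [Field k] [Field Ω] [Algebra k Ω]
variable {m : Type} [Fintype m] [DecidableEq m]

theorem exists_pivots {κ : Type} [Fintype κ] (Z : Submodule Ω (κ → Ω)) (N : ℕ)
    (hNN : Module.finrank Ω Z = N) :
    ∃ p : Fin N → κ, ∀ s : Fin N → Ω, ∃ y ∈ Z, ∀ i, y (p i) = s i := by
  classical
  subst hNN
  let c : κ → Module.Dual Ω Z := fun i => (LinearMap.proj i).comp Z.subtype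
  have hspan : Submodule.span Ω (Set.range c) = ⊤ := by
    have h0 : (Submodule.span Ω (Set.range c)).dualCoannihilator = ⊥ := by
      rw [eq_bot_iff]
      intro y hy
      rw [Submodule.mem_dualCoannihilator] at hy
      rw [Submodule.mem_bot]
      apply Subtype.ext; funext i
      exact hy (c i) (Submodule.subset_span ⟨i, rfl⟩)
    have h1 := Subspace.dualCoannihilator_dualAnnihilator_eq (W := Submodule.span Ω (Set.range c))
    rw [h0] at h1
    rw [← h1]; simp
  obtain ⟨f, hf1, hf2, hf3⟩ := Submodule.exists_fun_fin_finrank_span_eq Ω (Set.range c)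
  have hN : Module.finrank Ω (Submodule.span Ω (Set.range c)) = Module.finrank Ω Z := by
    rw [hspan, finrank_top, Subspace.dual_finrank_eq]
  have hc : ∀ i, ∃ j, c j = f i := fun i => by
    have := hf1 i; simpa using this
  choose p0 hp0 using hc
  have hsurj : Function.Surjective (LinearMap.pi f : Z →ₗ[Ω] _) := by
    rw [← LinearMap.range_eq_top]
    by_contra hne
    obtain ⟨ψ, hψ, hle⟩ := Submodule.exists_le_ker_of_lt_top _ (lt_top_iff_ne_top.2 hne)
    apply hψ
    have hsum : ∑ i, ψ (Pi.single i 1) • f i = 0 := by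
      ext1 z
      have := hle ⟨z, rfl⟩
      rw [LinearMap.mem_ker, LinearMap.pi_apply_eq_sum_univ ψ] at this
      simp only [LinearMap.sum_apply, LinearMap.smul_apply, smul_eq_mul, LinearMap.zero_apply]
      rw [← this]
      refine Finset.sum_congr rfl fun i _ => ?_
      rw [mul_comm]
      simp only [LinearMap.pi_apply, smul_eq_mul]
      congr 2
      ext j
      simp [Pi.single_apply, eq_comm]
    have h0 := Fintype.linearIndependent_iff.1 hf3 _ hsum
    apply LinearMap.pi_ext'
    intro i; ext; simpa using h0 i
  refine ⟨fun i => p0 (Fin.cast hN.symm i), fun s => ?_⟩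
  obtain ⟨y, hy⟩ := hsurj (fun i => s (Fin.cast hN i))
  refine ⟨y.1, y.2, fun i => ?_⟩
  have := congrFun hy (Fin.cast hN.symm i)
  simp only [LinearMap.pi_apply] at this
  rw [← hp0] at this
  exact this

theorem finrank_intertwine [IsAlgClosed Ω] {V : Type} [AddCommGroup V] [Module Ω V]
    [FiniteDimensional Ω V] (y : V →ₗ[Ω] V) (r : ℕ)
    (hr : ∀ μ : Ω, Module.finrank Ω (LinearMap.ker (y - μ • LinearMap.id)) ≤ r)
    (d : ℕ) : ∀ (W : Type) [AddCommGroup W] [Module Ω W] [FiniteDimensional Ω W] (f : W →ₗ[Ω] W),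
    Module.finrank Ω W = d → ∀ S : Submodule Ω (W →ₗ[Ω] V), (∀ x ∈ S, y ∘ₗ x = x ∘ₗ f) →
    Module.finrank Ω S ≤ r * d := by
  induction d with
  | zero =>
    intro W _ _ _ f hW S hS
    have : Module.finrank Ω (W →ₗ[Ω] V) = 0 := by rw [Module.finrank_linearMap, hW]; simp
    have := Submodule.finrank_le S
    omega
  | succ d ih =>
    intro W _ _ _ f hW S hS
    haveI : Nontrivial W := Module.nontrivial_of_finrank_pos (R := Ω) (by omega)
    obtain ⟨μ, hμ⟩ := Module.End.exists_eigenvalue f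
    obtain ⟨w, hw⟩ := hμ.exists_hasEigenvector
    have hw1 : f w = μ • w := hw.apply_eq_smul
    have hw0 : w ≠ 0 := hw.2
    let L := Submodule.span Ω {w}
    let ev : S →ₗ[Ω] LinearMap.ker (y - μ • LinearMap.id) :=
      LinearMap.codRestrict _ ((LinearMap.applyₗ w).comp S.subtype) (by
        intro x
        have := LinearMap.congr_fun (hS x.1 x.2) w
        simp only [LinearMap.comp_apply, hw1, map_smul] at this
        simp [this])
    have h1 := LinearMap.finrank_range_add_finrank_ker ev
    have h2 : Module.finrank Ω (LinearMap.range ev) ≤ r := (Submodule.finrank_le _).trans (hr μ)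
    have hfL : L ≤ L.comap f := by
      rw [Submodule.span_le]
      intro w' hw'
      rw [Set.mem_singleton_iff] at hw'
      rw [hw']
      simp only [Submodule.comap_coe, Set.mem_preimage, SetLike.mem_coe, hw1]
      exact L.smul_mem _ (Submodule.mem_span_singleton_self w)
    let f' := L.mapQ L f hfL
    have hL : Module.finrank Ω (W ⧸ L) = d := by
      have := Submodule.finrank_quotient_add_finrank L
      rw [finrank_span_singleton hw0] at this
      omega
    let S' : Submodule Ω ((W ⧸ L) →ₗ[Ω] V) := S.comap (LinearMap.lcomp Ω V L.mkQ)
    have h3 : Module.finrank Ω S' ≤ r * d := ih (W ⧸ L) f' hL S' (by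
      intro x hx
      have := hS _ hx
      apply LinearMap.ext
      intro a
      obtain ⟨a, rfl⟩ := L.mkQ_surjective a
      exact LinearMap.congr_fun this a)
    have h4 : Module.finrank Ω (LinearMap.ker ev) ≤ Module.finrank Ω S' := by
      have hk : ∀ x : LinearMap.ker ev, L ≤ LinearMap.ker x.1.1 := by
        intro x
        rw [Submodule.span_le]
        rintro _ rfl
        exact congrArg Subtype.val x.2
      let q : LinearMap.ker ev →ₗ[Ω] S' :=
        { toFun := fun x => ⟨L.liftQ x.1.1 (hk x), by
            change (L.liftQ x.1.1 (hk x)).comp L.mkQ ∈ S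
            rw [Submodule.liftQ_mkQ]; exact x.1.2⟩
          map_add' := fun a b => by
            apply Subtype.ext; apply Submodule.linearMap_qext; ext; simp
          map_smul' := fun a b => by
            apply Subtype.ext; apply Submodule.linearMap_qext; ext; simp }
      refine LinearMap.finrank_le_finrank_of_injective (f := q) ?_
      intro a b hab
      have h5 : L.liftQ a.1.1 (hk a) = L.liftQ b.1.1 (hk b) := congrArg Subtype.val hab
      apply Subtype.ext; apply Subtype.ext
      rw [← Submodule.liftQ_mkQ L a.1.1 (hk a), h5, Submodule.liftQ_mkQ]
    rw [mul_add, mul_one]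
    omega

theorem finrank_kercoker {V : Type} [AddCommGroup V] [Module Ω V]
    [FiniteDimensional Ω V] (y : V →ₗ[Ω] V) (S : Submodule Ω (V →ₗ[Ω] V))
    (hS : ∀ a ∈ S, ∀ v ∈ LinearMap.ker y, a v ∈ LinearMap.range y) :
    Module.finrank Ω S + Module.finrank Ω (LinearMap.ker y) ^ 2 ≤ Module.finrank Ω V ^ 2 := by
  let F : (V →ₗ[Ω] V) →ₗ[Ω] (LinearMap.ker y →ₗ[Ω] (V ⧸ LinearMap.range y)) :=
    (LinearMap.lcomp Ω _ (LinearMap.ker y).subtype).comp (LinearMap.compRight Ω (LinearMap.range y).mkQ)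
  have hF : ∀ a v, F a v = (LinearMap.range y).mkQ (a v) := fun a v => rfl
  have hsurj : Function.Surjective F := by
    intro g
    obtain ⟨g1, hg1⟩ := LinearMap.exists_extend g
    obtain ⟨σ, hσ⟩ := (LinearMap.range y).mkQ.exists_rightInverse_of_surjective (Submodule.range_mkQ _)
    refine ⟨σ.comp g1, ?_⟩
    ext v
    rw [hF]
    have := LinearMap.congr_fun hσ (g1 v)
    simp only [LinearMap.comp_apply, LinearMap.id_apply] at this ⊢
    rw [this, ← hg1]; rfl
  have h1 := LinearMap.finrank_range_add_finrank_ker F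
  rw [LinearMap.range_eq_top.2 hsurj, finrank_top, Module.finrank_linearMap, Module.finrank_linearMap] at h1
  have h2 := Submodule.finrank_quotient_add_finrank (LinearMap.range y)
  have h3 := LinearMap.finrank_range_add_finrank_ker y
  have h4 : Module.finrank Ω (V ⧸ LinearMap.range y) = Module.finrank Ω (LinearMap.ker y) := by omega
  rw [h4] at h1
  have h5 : S ≤ LinearMap.ker F := by
    intro a ha
    rw [LinearMap.mem_ker]
    ext v
    rw [hF]
    simpa using hS a ha v.1 v.2
  have h6 := Submodule.finrank_mono h5
  nlinarith

theorem D3 [IsAlgClosed Ω] (h : Bool → Matrix m m Ω)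
    (hgen : ∃ s : ℕ → Ω, ∀ v : ℕ → Ω, ∃ D : Derivation k Ω Ω, (∀ b, (h b).map D = 0) ∧ ∀ i, D (s i) = v i)
    (hk : 2 ≤ Module.finrank Ω (Zc (h false) (h true))) :
    rk k (ent h) + Module.finrank Ω (Zc (h false) (h true)) ≤ 2 * Fintype.card m ^ 2 := by
  classical
  set n := Fintype.card m with hn
  set N := Module.finrank Ω (Zc (h false) (h true)) with hN
  obtain ⟨s, hs⟩ := hgen
  -- the generic commuting element
  let cu : (Matrix m m Ω) ≃ₗ[Ω] (m × m → Ω) :=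
    { toFun := fun M p => M p.1 p.2
      invFun := fun f => Matrix.of fun i j => f (i, j)
      left_inv := fun _ => rfl
      right_inv := fun _ => rfl
      map_add' := fun _ _ => rfl
      map_smul' := fun _ _ => rfl }
  have hNN : Module.finrank Ω ((Zc (h false) (h true)).map cu.toLinearMap) = N :=
    LinearEquiv.finrank_map_eq cu _
  obtain ⟨p, hp⟩ := exists_pivots ((Zc (h false) (h true)).map cu.toLinearMap) N hNN
  obtain ⟨y', hy', hyp⟩ := hp (fun i => s i)
  obtain ⟨y, hyZ, rfl⟩ := hy'
  have hyp : ∀ i, y (p i).1 (p i).2 = s i := hyp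
  clear hp hNN
  have hns : ∀ c : Ω, y ≠ c • (1 : Matrix m m Ω) := by
    intro c hc
    obtain ⟨D, hD1, hD2⟩ := hs (fun i => if i = 0 then 1 else 0)
    have e0 := hyp ⟨0, by omega⟩
    have e1 := hyp ⟨1, by omega⟩
    have d0 := hD2 0
    have d1 := hD2 1
    have t0 := hs (fun i => if i = 1 then 1 else 0)
    obtain ⟨D', hD1', hD2'⟩ := t0
    have d0' := hD2' 1
    simp only [if_true] at d0 d0'
    simp only [one_ne_zero, if_false] at d1
    simp only at e0 e1
    rw [← e0, hc] at d0
    rw [← e1, hc] at d1 d0'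
    simp only [Matrix.smul_apply, Matrix.one_apply, smul_eq_mul] at d0 d1 d0'
    have g0 : (p ⟨0, by omega⟩).1 = (p ⟨0, by omega⟩).2 := by
      by_contra hne
      rw [if_neg hne, mul_zero, map_zero] at d0
      exact zero_ne_one d0
    have g1 : (p ⟨1, by omega⟩).1 = (p ⟨1, by omega⟩).2 := by
      by_contra hne
      rw [if_neg hne, mul_zero, map_zero] at d0'
      exact zero_ne_one d0'
    rw [if_pos g0] at d0
    rw [if_pos g1, d0] at d1
    exact one_ne_zero d1
  -- the maximal eigenspace
  let yl : (m → Ω) →ₗ[Ω] (m → Ω) := Matrix.toLin' y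
  obtain ⟨lam, hlam⟩ : ∃ lam : Ω, ∀ μ : Ω, Module.finrank Ω (LinearMap.ker (yl - μ • LinearMap.id)) ≤
      Module.finrank Ω (LinearMap.ker (yl - lam • LinearMap.id)) := by
    have hb : ∀ μ : Ω, Module.finrank Ω (LinearMap.ker (yl - μ • LinearMap.id)) ≤ n := fun μ => by
      have := Submodule.finrank_le (LinearMap.ker (yl - μ • LinearMap.id))
      rwa [Module.finrank_fintype_fun_eq_card] at this
    let f : Ω → ℕ := fun μ => n - Module.finrank Ω (LinearMap.ker (yl - μ • LinearMap.id))
    refine ⟨Function.argmin f, fun μ => ?_⟩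
    have h1 : f (Function.argmin f) ≤ f μ := Function.argmin_le f μ
    have h2 := hb μ
    have h3 := hb (Function.argmin f)
    simp only [f] at h1
    simp only [f]
    omega
  set r0 := Module.finrank Ω (LinearMap.ker (yl - lam • LinearMap.id)) with hr0
  have hr0n : r0 < n := by
    have h1 := Submodule.finrank_le (LinearMap.ker (yl - lam • LinearMap.id))
    rw [Module.finrank_fintype_fun_eq_card] at h1
    refine lt_of_le_of_ne h1 fun heq => ?_
    have h2 : LinearMap.ker (yl - lam • LinearMap.id) = ⊤ := by
      apply Submodule.eq_top_of_finrank_eq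
      rw [Module.finrank_fintype_fun_eq_card]; exact heq
    rw [LinearMap.ker_eq_top, sub_eq_zero] at h2
    apply hns lam
    apply (Matrix.toLin').injective
    rw [map_smul, Matrix.toLin'_one]
    exact h2
  -- bound on the commutant
  have hc : Module.finrank Ω (Zc y y) ≤ r0 * n := by
    have h1 := finrank_intertwine yl r0 hlam n (m → Ω) yl (by rw [Module.finrank_fintype_fun_eq_card])
      ((Zc y y).map (Matrix.toLin' : Matrix m m Ω ≃ₗ[Ω] _).toLinearMap) (by
        rintro _ ⟨w, hw, rfl⟩
        change Matrix.toLin' y ∘ₗ Matrix.toLin' w = Matrix.toLin' w ∘ₗ Matrix.toLin' y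
        rw [← Matrix.toLin'_mul, ← Matrix.toLin'_mul, hw.1])
    rwa [LinearEquiv.finrank_map_eq] at h1
  -- rank of y
  have hy : rk k (ent (fun _ : Unit => y)) + r0 ^ 2 ≤ 1 + n ^ 2 := by
    let V : Submodule Ω (Unit → Matrix m m Ω) :=
      { carrier := {w | ∀ v ∈ LinearMap.ker (yl - lam • LinearMap.id),
          Matrix.toLin' (w ()) v ∈ LinearMap.range (yl - lam • LinearMap.id)}
        add_mem' := fun {a b} ha hb v hv => by
          rw [Pi.add_apply, map_add, LinearMap.add_apply]; exact Submodule.add_mem _ (ha v hv) (hb v hv)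
        zero_mem' := fun v hv => by simp
        smul_mem' := fun c x hx v hv => by
          rw [Pi.smul_apply, map_smul, LinearMap.smul_apply]; exact Submodule.smul_mem _ _ (hx v hv) }
    have h1 := rk_le_addM (k := k) (fun _ : Unit => lam) (fun _ : Unit => y) V (by
      intro D hD v hv
      have hv0 : y *ᵥ v = lam • v := by
        simpa [yl, sub_eq_zero] using hv
      refine ⟨-(fun i => D (v i)), ?_⟩
      have hd : y *ᵥ (fun i => D (v i)) + y.map D *ᵥ v = lam • (fun i => D (v i)) := by
        ext i
        have := congrArg D (congrFun hv0 i)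
        simp only [Matrix.mulVec, dotProduct, map_sum, Derivation.leibniz, smul_eq_mul, Pi.smul_apply,
          hD (), mul_zero, add_zero, Finset.sum_add_distrib] at this
        simp only [Pi.add_apply, Matrix.mulVec, dotProduct, Pi.smul_apply, smul_eq_mul, Matrix.map_apply]
        rw [← this]
        congr 1
        exact Finset.sum_congr rfl fun j _ => mul_comm _ _
      have : y.map D *ᵥ v = lam • (fun i => D (v i)) - y *ᵥ (fun i => D (v i)) := by
        rw [← hd]; abel
      simp only [yl, map_neg, LinearMap.sub_apply, Matrix.toLin'_apply, LinearMap.smul_apply,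
        LinearMap.id_apply]
      rw [this]; abel)
    have h2 := rk_le_card (k := k) (fun _ : Unit => lam)
    let S : Submodule Ω ((m → Ω) →ₗ[Ω] (m → Ω)) :=
      V.map ((Matrix.toLin' : Matrix m m Ω ≃ₗ[Ω] _).toLinearMap.comp (LinearMap.proj ()))
    have h3 := finrank_kercoker (yl - lam • LinearMap.id) S (by
      rintro _ ⟨w, hw, rfl⟩ v hv
      exact hw v hv)
    have h4 : Module.finrank Ω S = Module.finrank Ω V := by
      refine (Submodule.equivMapOfInjective _ ?_ V).finrank_eq.symm
      intro a b hab
      funext u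
      exact (Matrix.toLin').injective hab
    have h3' : Module.finrank Ω V + r0 ^ 2 ≤ n ^ 2 := by
      rw [Module.finrank_fintype_fun_eq_card, h4] at h3
      exact h3
    simp only [Fintype.card_unit] at h2
    omega
  -- rank of the triple
  let z : Option Bool → Matrix m m Ω := fun o => o.elim y h
  have hz1 : rk k (ent z) ≤ rk k (ent (fun _ : Unit => y)) + 2 * Module.finrank Ω (Zc y y) := by
    let V : Submodule Ω (Option Bool → Matrix m m Ω) :=
      { carrier := {w | w none = 0 ∧ ∀ b, w (some b) ∈ Zc y y}
        add_mem' := fun {a b} ha hb => ⟨by simp [ha.1, hb.1], fun i => Submodule.add_mem _ (ha.2 i) (hb.2 i)⟩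
        zero_mem' := ⟨rfl, fun _ => Submodule.zero_mem _⟩
        smul_mem' := fun c x hx => ⟨by simp [hx.1], fun i => Submodule.smul_mem _ _ (hx.2 i)⟩ }
    have h1 := rk_le_addM (k := k) (ent (fun _ : Unit => y)) z V (by
      intro D hD
      have hy0 : y.map D = 0 := by ext i j; exact hD ((), i, j)
      refine ⟨hy0, fun b => ?_⟩
      have hcm : h b * y = y * h b := by
        cases b
        · exact hyZ.1.symm
        · exact hyZ.2.symm
      have := congrArg (fun M : Matrix m m Ω => M.map D) hcm
      simp only [map_mul_deriv, hy0, mul_zero, zero_add, zero_mul, add_zero] at this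
      exact ⟨this, this⟩)
    refine h1.trans ?_
    gcongr
    let q : V →ₗ[Ω] (Bool → Zc y y) :=
      { toFun := fun w b => ⟨w.1 (some b), w.2.2 b⟩
        map_add' := fun _ _ => rfl
        map_smul' := fun _ _ => rfl }
    have hq : Function.Injective q := by
      intro a b hab
      apply Subtype.ext; funext o
      cases o with
      | none => rw [a.2.1, b.2.1]
      | some o => exact congrArg Subtype.val (congrFun hab o)
    have := LinearMap.finrank_le_finrank_of_injective hq
    rw [Module.finrank_pi_fintype] at this
    simpa using this
  have hz2 : rk k (ent h) + N ≤ rk k (ent z) := by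
    have := rk_add_card_le (k := k) (ent h) (fun i : Fin N => s i) (ent z) (by
      rintro D hD ⟨b, i, j⟩
      exact hD (some b, i, j)) (by
      intro D hD i
      rw [← hyp i]
      exact hD (none, (p i).1, (p i).2)) (by
      intro v
      obtain ⟨D, hD1, hD2⟩ := hs (fun i => if hi : i < N then v ⟨i, hi⟩ else 0)
      refine ⟨D, ?_, fun j => ?_⟩
      · rintro ⟨b, i, j⟩
        exact congrFun (congrFun (hD1 b) i) j
      · rw [hD2]; simp)
    simpa using this
  have : r0 + 1 ≤ n := hr0n
  nlinarith [Nat.mul_le_mul this this, sq_nonneg ((n : ℤ) - r0)]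

end PartB2

section PartC
variable {R : Type} [CommRing R] {m : Type} [Fintype m] [DecidableEq m]

theorem det_row_update (M : Matrix m m R) (o : m) (y : m → R) :
    (M - Matrix.vecMulVec (Pi.single o 1) y).det = M.det - y ⬝ᵥ (M.adjugate *ᵥ Pi.single o 1) := by
  have h1 : M - Matrix.vecMulVec (Pi.single o 1) y = M.updateRow o (M o + (-1 : R) • y) := by
    ext i j
    by_cases hi : i = o
    · subst hi; simp [Matrix.vecMulVec_apply, sub_eq_add_neg]
    · simp [Matrix.vecMulVec_apply, hi, Matrix.updateRow_ne hi]
  rw [h1, Matrix.det_updateRow_add, Matrix.det_updateRow_smul, Matrix.updateRow_eq_self]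
  have : (M.updateRow o y).det = y ⬝ᵥ (M.adjugate *ᵥ Pi.single o 1) := by
    rw [← Matrix.cramer_transpose_apply]
    have : y ⬝ᵥ (M.adjugate *ᵥ Pi.single o 1) = (M.adjugateᵀ *ᵥ y) o := by
      rw [Matrix.dotProduct_mulVec, ← Matrix.mulVec_transpose]; simp
    rw [this, Matrix.adjugate_transpose, Matrix.cramer_eq_adjugate_mulVec]
  rw [this]; ring

open Polynomial in
theorem adj_span (B : Matrix m m R) (f : Matrix m m R →ₗ[R] R)
    (hf : ∀ k, f ((matPolyEquiv (Matrix.charmatrix B).adjugate).coeff k) = 0) (j : ℕ) :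
    f (B ^ j) = 0 := by
  set N := matPolyEquiv (Matrix.charmatrix B).adjugate with hN
  rcases subsingleton_or_nontrivial R with hR | hR
  · exact Subsingleton.elim _ _
  have h1 : N * (Polynomial.X - Polynomial.C B) = (B.charpoly).map (algebraMap R (Matrix m m R)) := by
    rw [← matPolyEquiv_smul_one, ← Matrix.matPolyEquiv_charmatrix, ← map_mul, Matrix.adjugate_mul]; rfl
  have h2 : ∀ k, N.coeff k - N.coeff (k+1) * B = (B.charpoly.coeff (k+1)) • (1 : Matrix m m R) := by
    intro k
    have := congrArg (fun p => p.coeff (k+1)) h1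
    simp only [mul_sub, Polynomial.coeff_sub, Polynomial.coeff_mul_X, Polynomial.coeff_mul_C, Polynomial.coeff_map] at this
    rw [this, Algebra.algebraMap_eq_smul_one]
  have h20 : - (N.coeff 0 * B) = (B.charpoly.coeff 0) • (1 : Matrix m m R) := by
    have := congrArg (fun p => p.coeff 0) h1
    simp only [mul_sub, Polynomial.coeff_sub, Polynomial.coeff_mul_X_zero, Polynomial.coeff_mul_C, Polynomial.coeff_map, zero_sub] at this
    rw [this, Algebra.algebraMap_eq_smul_one]
  have h3 : ∀ l k, Fintype.card m ≤ k → N.natDegree < k + l → N.coeff k = 0 := by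
    intro l
    induction l with
    | zero => intro k _ hk; exact Polynomial.coeff_eq_zero_of_natDegree_lt hk
    | succ l ih =>
      intro k hk hk2
      have h4 := h2 k
      rw [ih (k+1) (by omega) (by omega), Polynomial.coeff_eq_zero_of_natDegree_lt (p := B.charpoly) (by rw [Matrix.charpoly_natDegree_eq_dim]; omega)] at h4
      simpa using h4
  rcases isEmpty_or_nonempty m with hm | hm
  · rw [Subsingleton.elim (B ^ j) 0, map_zero]
  obtain ⟨c, hc⟩ : ∃ c, Fintype.card m = c + 1 := ⟨Fintype.card m - 1, by have := Fintype.card_pos (α := m); omega⟩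
  let S : Submodule R (Matrix m m R) := Submodule.span R (Set.range fun k => N.coeff k)
  have hS1 : (1 : Matrix m m R) ∈ S := by
    have h4 := h2 c
    have h5 : B.charpoly.coeff (c+1) = 1 := by
      have := B.charpoly_monic
      rw [Polynomial.Monic, Polynomial.leadingCoeff, Matrix.charpoly_natDegree_eq_dim, hc] at this
      exact this
    rw [h3 (N.natDegree + 1) (c+1) (by omega) (by omega), h5, zero_mul, sub_zero, one_smul] at h4
    rw [← h4]; exact Submodule.subset_span ⟨c, rfl⟩
  have hSB : ∀ x ∈ S, x * B ∈ S := by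
    intro x hx
    induction hx using Submodule.span_induction with
    | mem x h =>
      obtain ⟨k, rfl⟩ := h
      cases k with
      | zero =>
        have : N.coeff 0 * B = -((B.charpoly.coeff 0) • (1 : Matrix m m R)) := by rw [← h20, neg_neg]
        simp only [this]; exact S.neg_mem (S.smul_mem _ hS1)
      | succ k =>
        have : N.coeff (k+1) * B = N.coeff k - (B.charpoly.coeff (k+1)) • (1 : Matrix m m R) := by
          rw [← h2]; abel
        simp only [this]; exact S.sub_mem (Submodule.subset_span ⟨k, rfl⟩) (S.smul_mem _ hS1)
    | zero => simp
    | add x y _ _ hx hy => rw [add_mul]; exact S.add_mem hx hy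
    | smul a x _ hx => rw [smul_mul_assoc]; exact S.smul_mem _ hx
  have hB : B ^ j ∈ S := by
    induction j with
    | zero => simpa using hS1
    | succ j ih => rw [pow_succ]; exact hSB _ ih
  have : S ≤ LinearMap.ker f := by
    rw [Submodule.span_le]; rintro _ ⟨k, rfl⟩; exact hf k
  exact this hB

open Polynomial in
theorem charpoly_rank_one (B U V : Matrix m m R) (o : m) (hUV : U * V = 1) (y z : m → R)
    (h : (B + Matrix.vecMulVec (Pi.single o 1) y).charpoly =
      (U * B * V + Matrix.vecMulVec (Pi.single o 1) z).charpoly) (j : ℕ) :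
    z ⬝ᵥ ((U * B ^ j * V) *ᵥ Pi.single o 1) = y ⬝ᵥ (B ^ j *ᵥ Pi.single o 1) := by
  have hVU : V * U = 1 := mul_eq_one_comm.mp hUV
  let c : R →+* R[X] := Polynomial.C
  have hcm : ∀ (M : Matrix m m R) (w : m → R), Matrix.charmatrix (M + Matrix.vecMulVec (Pi.single o 1) w) =
      Matrix.charmatrix M - Matrix.vecMulVec (Pi.single o 1) (fun i => Polynomial.C (w i)) := by
    intro M w
    ext1 i j
    simp only [Matrix.charmatrix_apply, Matrix.sub_apply, Matrix.vecMulVec_apply, Matrix.add_apply, map_add, map_mul]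
    by_cases hi : i = o
    · subst hi; simp; ring
    · simp [hi]
  have hch : Matrix.charmatrix (U * B * V) = U.map Polynomial.C * Matrix.charmatrix B * V.map Polynomial.C := by
    have h1 : U.map Polynomial.C * V.map Polynomial.C = (1 : Matrix m m R[X]) := by
      rw [← Matrix.map_mul, hUV]; simp
    simp only [Matrix.charmatrix, mul_sub, sub_mul, RingHom.mapMatrix_apply, Matrix.map_mul]
    congr 1
    rw [Matrix.scalar_apply, ← Matrix.smul_one_eq_diagonal, mul_smul_comm, smul_mul_assoc, mul_one, h1]
  have hcc : (U * B * V).charpoly = B.charpoly := by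
    rw [Matrix.charpoly_mul_comm, ← mul_assoc, hVU, one_mul]
  have hdet : (U.map Polynomial.C).det * (V.map Polynomial.C).det = (1 : R[X]) := by
    rw [← Matrix.det_mul, ← Matrix.map_mul, hUV]; simp
  have hadjU : (V.map Polynomial.C).adjugate = (V.map Polynomial.C).det • U.map Polynomial.C := by
    have h1 : V.map Polynomial.C * U.map Polynomial.C = (1 : Matrix m m R[X]) := by
      rw [← Matrix.map_mul, hVU]; simp
    calc (V.map Polynomial.C).adjugate = (V.map Polynomial.C).adjugate * (V.map Polynomial.C * U.map Polynomial.C) := by rw [h1, mul_one]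
      _ = _ := by rw [← mul_assoc, Matrix.adjugate_mul, smul_mul_assoc, one_mul]
  have hadjV : (U.map Polynomial.C).adjugate = (U.map Polynomial.C).det • V.map Polynomial.C := by
    have h1 : U.map Polynomial.C * V.map Polynomial.C = (1 : Matrix m m R[X]) := by
      rw [← Matrix.map_mul, hUV]; simp
    calc (U.map Polynomial.C).adjugate = (U.map Polynomial.C).adjugate * (U.map Polynomial.C * V.map Polynomial.C) := by rw [h1, mul_one]
      _ = _ := by rw [← mul_assoc, Matrix.adjugate_mul, smul_mul_assoc, one_mul]
  have hadj : (Matrix.charmatrix (U * B * V)).adjugate = U.map Polynomial.C * (Matrix.charmatrix B).adjugate * V.map Polynomial.C := by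
    rw [hch, Matrix.adjugate_mul_distrib, Matrix.adjugate_mul_distrib, hadjU, hadjV]
    simp only [smul_mul_assoc, mul_smul_comm, smul_smul, ← mul_assoc]
    rw [hdet, one_smul]
  have e1 : B.charpoly - (fun i => Polynomial.C (y i)) ⬝ᵥ ((Matrix.charmatrix B).adjugate *ᵥ Pi.single o 1) =
      B.charpoly - (fun i => Polynomial.C (z i)) ⬝ᵥ ((U.map Polynomial.C * (Matrix.charmatrix B).adjugate * V.map Polynomial.C) *ᵥ Pi.single o 1) := by
    rw [Matrix.charpoly, Matrix.charpoly, hcm, hcm, det_row_update, det_row_update, hadj] at h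
    have : (U * B * V).charmatrix.det = B.charpoly := hcc
    rw [this] at h; exact h
  have e2 : (fun i => Polynomial.C (z i)) ⬝ᵥ ((U.map Polynomial.C * (Matrix.charmatrix B).adjugate * V.map Polynomial.C) *ᵥ Pi.single o 1) = (fun i => Polynomial.C (y i)) ⬝ᵥ ((Matrix.charmatrix B).adjugate *ᵥ Pi.single o 1) := by
    linear_combination e1
  let f : Matrix m m R →ₗ[R] R :=
    { toFun := fun M => z ⬝ᵥ ((U * M * V) *ᵥ Pi.single o 1) - y ⬝ᵥ (M *ᵥ Pi.single o 1)
      map_add' := by intro a b; simp only [mul_add, add_mul, Matrix.add_mulVec, dotProduct_add]; ring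
      map_smul' := by
        intro a b
        simp only [mul_smul_comm, smul_mul_assoc, Matrix.smul_mulVec, dotProduct_smul, RingHom.id_apply, smul_sub] }
  have hk1 : ∀ (w : m → R) (W : Matrix m m R[X]) (k : ℕ),
      ((fun i => Polynomial.C (w i)) ⬝ᵥ (W *ᵥ Pi.single o 1)).coeff k =
        w ⬝ᵥ ((W.map (fun p => p.coeff k)) *ᵥ Pi.single o 1) := by
    intro w W k
    simp [dotProduct, Polynomial.finset_sum_coeff]
  have hk2 : ∀ (W : Matrix m m R[X]) (k : ℕ),
      (U.map Polynomial.C * W * V.map Polynomial.C).map (fun p => p.coeff k) =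
        U * W.map (fun p => p.coeff k) * V := by
    intro W k
    ext i j
    simp [Matrix.mul_apply, Polynomial.finset_sum_coeff, Finset.sum_mul, Polynomial.coeff_mul_C, Polynomial.coeff_C_mul]
  have := adj_span B f (by
    intro k
    have e3 := congrArg (fun p => p.coeff k) e2
    simp only [hk1, hk2] at e3
    have e4 : (matPolyEquiv (Matrix.charmatrix B).adjugate).coeff k = (Matrix.charmatrix B).adjugate.map (fun p => p.coeff k) := by
      ext i j; rw [matPolyEquiv_coeff_apply]; rfl
    rw [e4]
    exact sub_eq_zero.mpr e3) j
  exact sub_eq_zero.mp this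

/-- Krylov matrix. -/
def Kry {c : ℕ} (B : Matrix (Fin (c+1)) (Fin (c+1)) R) : Matrix (Fin (c+1)) (Fin (c+1)) R :=
  Matrix.of fun i j => (B ^ (j : ℕ)) i 0

def Crm {c : ℕ} (A B : Matrix (Fin (c+1)) (Fin (c+1)) R) : Matrix (Fin (c+1)) (Fin (c+1)) R :=
  Matrix.of fun i j => if j = Fin.last c then (if i = Fin.last c then 1 else 0) else
    ((A * B ^ ((j : ℕ) + 1) * A.adjugate - A.det • B ^ ((j : ℕ) + 1)) * B.adjugate) i 0

theorem kry_commute {c : ℕ} {B Y : Matrix (Fin (c+1)) (Fin (c+1)) R} (hK : IsUnit (Kry B).det)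
    (hY : Y * B = B * Y) (h0 : Y *ᵥ Pi.single 0 1 = 0) : Y = 0 := by
  have hYp : ∀ j : ℕ, Y * B ^ j = B ^ j * Y := fun j => (Commute.pow_right (show Commute Y B from hY) j)
  have h1 : Y * Kry B = 0 := by
    ext i j
    have h2 : (Y * B ^ (j : ℕ)) *ᵥ Pi.single 0 1 = 0 := by
      rw [hYp, ← Matrix.mulVec_mulVec, h0, Matrix.mulVec_zero]
    have h3 := congrFun h2 i
    simpa [Matrix.mul_apply, Kry] using h3
  have h2 : Kry B * (Kry B)⁻¹ = 1 := Matrix.mul_nonsing_inv _ hK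
  calc Y = Y * (Kry B * (Kry B)⁻¹) := by rw [h2, mul_one]
    _ = 0 := by rw [← mul_assoc, h1, zero_mul]

theorem UL {c : ℕ} {A B A' B' C : Matrix (Fin (c+1)) (Fin (c+1)) R}
    (hA : IsUnit A.det) (hB : IsUnit B.det) (hA' : IsUnit A'.det) (hC : IsUnit C.det)
    (hK : IsUnit (Kry B).det) (hCr : IsUnit (Crm A B).det)
    (h : A * B = C * (B * A)) (h' : A' * B' = C * (B' * A'))
    (hrow : ∀ i j, i ≠ 0 → B' i j = B i j) (hlast : B' 0 (Fin.last c) = B 0 (Fin.last c))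
    (hcol : ∀ i, A' i 0 = A i 0) : A' = A ∧ B' = B := by
  set y : Fin (c+1) → R := fun j => B' 0 j - B 0 j with hy
  have hBy : B' = B + Matrix.vecMulVec (Pi.single 0 1) y := by
    ext i j
    by_cases hi : i = 0
    · subst hi; simp [Matrix.vecMulVec_apply, hy]
    · simp [Matrix.vecMulVec_apply, hi, hrow i j hi]
  have i1 : A * A⁻¹ = 1 := Matrix.mul_nonsing_inv _ hA
  have i2 : A⁻¹ * A = 1 := Matrix.nonsing_inv_mul _ hA
  have i3 : B * B⁻¹ = 1 := Matrix.mul_nonsing_inv _ hB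
  have i4 : B⁻¹ * B = 1 := Matrix.nonsing_inv_mul _ hB
  have i5 : A' * A'⁻¹ = 1 := Matrix.mul_nonsing_inv _ hA'
  have i6 : A'⁻¹ * A' = 1 := Matrix.nonsing_inv_mul _ hA'
  have hUV : (B * A) * (A⁻¹ * B⁻¹) = 1 := by
    rw [mul_assoc, ← mul_assoc A, i1, one_mul, i3]
  have hCe : C = A * B * (A⁻¹ * B⁻¹) := by rw [h, mul_assoc, hUV, mul_one]
  have hBC : B * C = (B * A) * B * (A⁻¹ * B⁻¹) := by rw [hCe]; simp only [mul_assoc]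
  have hch : (B + Matrix.vecMulVec (Pi.single 0 1) y).charpoly =
      ((B * A) * B * (A⁻¹ * B⁻¹) + Matrix.vecMulVec (Pi.single 0 1) (y ᵥ* C)).charpoly := by
    have e1 : (B * A) * B * (A⁻¹ * B⁻¹) + Matrix.vecMulVec (Pi.single 0 1) (y ᵥ* C) = B' * C := by
      rw [hBy, add_mul, ← hBC, Matrix.vecMulVec_mul]
    rw [e1, ← hBy, Matrix.charpoly_mul_comm]
    have e2 : C * B' = A' * B' * A'⁻¹ := by
      rw [h', mul_assoc, mul_assoc, i5, mul_one]
    rw [e2, Matrix.charpoly_mul_comm, ← mul_assoc, i6, one_mul]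
  have key := charpoly_rank_one B _ _ 0 hUV y _ hch
  have hCr' : y ᵥ* Crm A B = 0 := by
    ext j
    by_cases hj : j = Fin.last c
    · subst hj
      simp [Matrix.vecMul, dotProduct, Crm, hy, hlast]
    · have k1 := key j
      rw [← Matrix.dotProduct_mulVec, Matrix.mulVec_mulVec] at k1
      have k2 : C * (B * A * B ^ (j : ℕ) * (A⁻¹ * B⁻¹)) = A * B ^ ((j : ℕ) + 1) * A⁻¹ * B⁻¹ := by
        have : C * (B * A * B ^ (j : ℕ) * (A⁻¹ * B⁻¹)) = (C * (B * A)) * (B ^ (j : ℕ) * (A⁻¹ * B⁻¹)) := by simp only [mul_assoc]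
        rw [this, ← h, pow_succ']; simp only [mul_assoc]
      have k3 : B ^ (j : ℕ) = B ^ ((j : ℕ) + 1) * B⁻¹ := by
        rw [pow_succ, mul_assoc, i3, mul_one]
      rw [k2, ← sub_eq_zero, ← dotProduct_sub, ← Matrix.sub_mulVec, k3, ← Matrix.sub_mul] at k1
      have hadjA : A.adjugate = A.det • A⁻¹ := by
        rw [← one_mul A.adjugate, ← i2, mul_assoc, Matrix.mul_adjugate, mul_smul_comm, mul_one]
      have hadjB : B.adjugate = B.det • B⁻¹ := by
        rw [← one_mul B.adjugate, ← i4, mul_assoc, Matrix.mul_adjugate, mul_smul_comm, mul_one]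
      have k4 : (A * B ^ ((j : ℕ) + 1) * A.adjugate - A.det • B ^ ((j : ℕ) + 1)) * B.adjugate =
          (A.det * B.det) • ((A * B ^ ((j : ℕ) + 1) * A⁻¹ - B ^ ((j : ℕ) + 1)) * B⁻¹) := by
        rw [hadjA, hadjB, mul_smul_comm, mul_smul_comm, ← smul_sub, smul_mul_assoc, smul_smul, mul_comm]
      have k5 : (y ᵥ* Crm A B) j = y ⬝ᵥ (((A * B ^ ((j : ℕ) + 1) * A.adjugate - A.det • B ^ ((j : ℕ) + 1)) * B.adjugate) *ᵥ Pi.single 0 1) := by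
        simp [Matrix.vecMul, dotProduct, Crm, hj]
      rw [k5, k4, Matrix.smul_mulVec, dotProduct_smul, k1]; simp
  have hy0 : y = 0 := by
    have h2 : Crm A B * (Crm A B)⁻¹ = 1 := Matrix.mul_nonsing_inv _ hCr
    calc y = y ᵥ* (Crm A B * (Crm A B)⁻¹) := by rw [h2, Matrix.vecMul_one]
      _ = 0 := by rw [← Matrix.vecMul_vecMul, hCr', Matrix.zero_vecMul]
  have hBB : B' = B := by rw [hBy, hy0]; simp
  refine ⟨?_, hBB⟩
  have hX : (A⁻¹ * A' - 1) = 0 := by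
    apply kry_commute hK
    · rw [sub_mul, mul_sub, one_mul, mul_one]
      congr 1
      rw [hBB] at h'
      have : A' * B * A'⁻¹ = A * B * A⁻¹ := by
        rw [h, h']; simp only [mul_assoc, i5, i1, mul_one]
      have t : A' * B = A * B * A⁻¹ * A' := by
        rw [← this, mul_assoc, i6, mul_one]
      rw [mul_assoc, t, ← mul_assoc, ← mul_assoc, ← mul_assoc, i2, one_mul, mul_assoc]
    · rw [Matrix.sub_mulVec, Matrix.one_mulVec, ← Matrix.mulVec_mulVec]
      have : A' *ᵥ Pi.single 0 1 = A *ᵥ Pi.single 0 1 := by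
        ext i; simp [hcol]
      rw [this, Matrix.mulVec_mulVec, i2, Matrix.one_mulVec, sub_self]
  have : A⁻¹ * A' = 1 := sub_eq_zero.mp hX
  calc A' = A * (A⁻¹ * A') := by rw [← mul_assoc, i1, one_mul]
    _ = A := by rw [this, mul_one]

theorem good_scalar {c : ℕ} {A B w : Matrix (Fin (c+1)) (Fin (c+1)) R}
    (hA : IsUnit A.det) 
    (hK : IsUnit (Kry B).det) (hCr : IsUnit (Crm A B).det)
    (h1 : w * A = A * w) (h2 : w * B = B * w) : ∃ t : R, w = t • (1 : Matrix (Fin (c+1)) (Fin (c+1)) R) := by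
  set p : Fin (c+1) → R := (Kry B)⁻¹ *ᵥ (w *ᵥ Pi.single 0 1) with hp
  have hKp : Kry B *ᵥ p = w *ᵥ Pi.single 0 1 := by
    rw [hp, Matrix.mulVec_mulVec, Matrix.mul_nonsing_inv _ hK, Matrix.one_mulVec]
  have hsum : (∑ k : Fin (c+1), p k • B ^ (k : ℕ)) *ᵥ Pi.single 0 1 = Kry B *ᵥ p := by
    ext i
    rw [Matrix.mulVec_single_one]
    simp [Matrix.mulVec, dotProduct, Kry, Matrix.sum_apply, mul_comm]
  have hw : w - ∑ k : Fin (c+1), p k • B ^ (k : ℕ) = 0 := by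
    apply kry_commute hK
    · rw [sub_mul, mul_sub, h2, Finset.sum_mul, Finset.mul_sum]
      congr 1
      refine Finset.sum_congr rfl fun k _ => ?_
      rw [smul_mul_assoc, mul_smul_comm, ← pow_succ, ← pow_succ']
    · rw [Matrix.sub_mulVec, hsum, hKp, sub_self]
  rw [sub_eq_zero] at hw
  have h3 : A * w * A.adjugate = A.det • w := by
    rw [← h1, mul_assoc, Matrix.mul_adjugate, mul_smul_comm, mul_one]
  have h4 : ∑ k : Fin (c+1), p k • ((A * B ^ (k : ℕ) * A.adjugate - A.det • B ^ (k : ℕ)) * B.adjugate) = 0 := by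
    have : (A * w * A.adjugate - A.det • w) * B.adjugate = 0 := by rw [h3, sub_self, zero_mul]
    rw [← this, hw]
    simp only [Finset.mul_sum, Finset.sum_mul, Finset.smul_sum, sub_mul, smul_sub, Finset.sum_sub_distrib, mul_smul_comm, smul_mul_assoc]
    congr 1
    refine Finset.sum_congr rfl fun k _ => ?_
    rw [smul_comm]
  -- shift the sum
  have h5 : Crm A B *ᵥ (fun j => if h : j = Fin.last c then 0 else p ⟨j + 1, by
      have := Fin.val_lt_last h; simpa using this⟩) = 0 := by
    ext i
    have h6 := congrFun (congrFun h4 i) 0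
    rw [Matrix.sum_apply, Fin.sum_univ_succ] at h6
    simp only [Matrix.mulVec, dotProduct]
    rw [Fin.sum_univ_castSucc]
    simp only [Fin.val_zero, pow_zero, mul_one, Matrix.mul_adjugate, sub_self, zero_mul, smul_zero, Matrix.zero_apply, zero_add, Pi.zero_apply] at h6 ⊢
    refine Eq.trans ?_ h6
    simp only [dif_pos, mul_zero, add_zero]
    refine Finset.sum_congr rfl fun k _ => ?_
    have hk : Fin.castSucc k ≠ Fin.last c := Fin.castSucc_ne_last k
    rw [dif_neg hk]
    simp only [Crm, Matrix.of_apply, if_neg hk, Matrix.smul_apply, smul_eq_mul, Fin.val_castSucc, Fin.val_succ]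
    rw [mul_comm]; rfl
  have h7 : (fun j : Fin (c+1) => if h : j = Fin.last c then (0:R) else p ⟨j + 1, by
      have := Fin.val_lt_last h; simpa using this⟩) = 0 := by
    have h2 : (Crm A B)⁻¹ * Crm A B = 1 := Matrix.nonsing_inv_mul _ hCr
    have := congrArg (fun v => (Crm A B)⁻¹ *ᵥ v) h5
    simpa only [Matrix.mulVec_mulVec, h2, Matrix.one_mulVec, Matrix.mulVec_zero] using this
  refine ⟨p 0, ?_⟩
  rw [hw, Fin.sum_univ_succ]
  simp only [Fin.val_zero, pow_zero]
  rw [Finset.sum_eq_zero, add_zero]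
  intro k _
  have := congrFun h7 k.castSucc
  simp only [dif_neg (Fin.castSucc_ne_last k)] at this
  have h8 : p k.succ = 0 := this
  rw [h8, zero_smul]

theorem good_finrank {Ω : Type} [Field Ω] {c : ℕ} {A B : Matrix (Fin (c+1)) (Fin (c+1)) Ω}
    (hA : A.det ≠ 0) 
    (hK : (Kry B).det ≠ 0) (hCr : (Crm A B).det ≠ 0) : Module.finrank Ω (Zc A B) ≤ 1 := by
  apply finrank_le_one (⟨1, by rw [mem_Zc]; simp⟩ : Zc A B)
  rintro ⟨w, hw⟩
  rw [mem_Zc] at hw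
  obtain ⟨t, ht⟩ := good_scalar (isUnit_iff_ne_zero.mpr hA) (isUnit_iff_ne_zero.mpr hK) (isUnit_iff_ne_zero.mpr hCr) hw.1 hw.2
  exact ⟨t, by ext1; exact ht.symm⟩
end PartC

section PartC2
variable {R S : Type} [CommRing R] [CommRing S] {c : ℕ}

/-- Hankel matrix of power traces. -/
def Hk (B : Matrix (Fin (c+1)) (Fin (c+1)) R) : Matrix (Fin (c+1)) (Fin (c+1)) R :=
  Matrix.of fun i j => (B ^ ((i : ℕ) + (j : ℕ))).trace

theorem Kry_map (f : R →+* S) (B : Matrix (Fin (c+1)) (Fin (c+1)) R) : Kry (B.map f) = (Kry B).map f := by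
  ext i j; simp [Kry, ← Matrix.map_pow]

theorem Hk_map (f : R →+* S) (B : Matrix (Fin (c+1)) (Fin (c+1)) R) : Hk (B.map f) = (Hk B).map f := by
  ext i j
  simp only [Hk, ← Matrix.map_pow, Matrix.of_apply, Matrix.map_apply]
  simp [Matrix.trace]

theorem Crm_map (f : R →+* S) (A B : Matrix (Fin (c+1)) (Fin (c+1)) R) :
    Crm (A.map f) (B.map f) = (Crm A B).map f := by
  have h1 : ∀ M : Matrix (Fin (c+1)) (Fin (c+1)) R, (M.map f).adjugate = M.adjugate.map f := fun M => by
    have := f.map_adjugate M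
    simpa [RingHom.mapMatrix_apply] using this.symm
  have h2 : ∀ M : Matrix (Fin (c+1)) (Fin (c+1)) R, (M.map f).det = f M.det := fun M => by
    have := f.map_det M
    simpa [RingHom.mapMatrix_apply] using this.symm
  ext i j
  simp only [Crm, Matrix.of_apply, Matrix.map_apply]
  split_ifs with h3 h4
  · simp
  · simp
  · rw [h1, h1, h2, ← Matrix.map_pow, ← Matrix.map_mul, ← Matrix.map_mul]
    have : f A.det • (B ^ ((j:ℕ)+1)).map f = (A.det • B ^ ((j:ℕ)+1)).map f := by
      ext; simp
    rw [this]
    have h5 : ∀ M N : Matrix (Fin (c+1)) (Fin (c+1)) R, M.map f - N.map f = (M - N).map f := by intro M N; ext; simp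
    rw [h5, ← Matrix.map_mul]; rfl

/-- The product of all genericity polynomials of a handle. -/
def Gd (A B : Matrix (Fin (c+1)) (Fin (c+1)) R) : R :=
  A.det * B.det * (Kry B).det * (Crm A B).det * (Kry A).det * (Hk A).det * (Hk B).det

theorem det_mapR (f : R →+* S) (M : Matrix (Fin (c+1)) (Fin (c+1)) R) : (M.map f).det = f M.det := by
  have := f.map_det M
  simpa [RingHom.mapMatrix_apply] using this.symm

theorem Gd_map (f : R →+* S) (A B : Matrix (Fin (c+1)) (Fin (c+1)) R) :
    Gd (A.map f) (B.map f) = f (Gd A B) := by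
  simp only [Gd, Kry_map, Crm_map, Hk_map, det_mapR, map_mul]

section example_
variable {K : Type} [Field K] [CharZero K]

def exA (K : Type) [Field K] (c : ℕ) : Matrix (Fin (c+1)) (Fin (c+1)) K := Matrix.diagonal fun i => ((i : ℕ) : K) + 1
def exB (K : Type) [Field K] (c : ℕ) : Matrix (Fin (c+1)) (Fin (c+1)) K := Matrix.of fun i j => if i = j + 1 then 1 else 0

theorem exB_pow (k : ℕ) : (exB K c) ^ k = Matrix.of fun i j => if i = j + (Fin.ofNat (c+1) k) then 1 else 0 := by
  induction k with
  | zero =>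
    ext i j
    have : (Fin.ofNat (c+1) 0 : Fin (c+1)) = 0 := rfl
    simp [Matrix.one_apply]
  | succ k ih =>
    ext i j
    rw [pow_succ, ih, Matrix.mul_apply]
    simp only [Matrix.of_apply, exB]
    rw [Finset.sum_eq_single (j+1)]
    · have : (Fin.ofNat (c+1) (k+1) : Fin (c+1)) = 1 + Fin.ofNat (c+1) k := by
        ext; simp [Fin.val_add, add_comm]
      rw [this, ← add_assoc]; simp
    · intro b _ hb; simp [hb]
    · simp

theorem exB_inv : exB K c * exB K c ^ c = 1 := by
  rw [← pow_succ', exB_pow]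
  have : (Fin.ofNat (c+1) (c+1) : Fin (c+1)) = 0 := by ext; simp
  ext i j; simp [this, Matrix.one_apply]

theorem exB_det : (exB K c).det ≠ 0 := by
  intro h
  have := congrArg Matrix.det (exB_inv (K := K) (c := c))
  rw [Matrix.det_mul, h, zero_mul, Matrix.det_one] at this
  exact zero_ne_one this

theorem ofNat_val (j : Fin (c+1)) : Fin.ofNat (c+1) (j : ℕ) = j := by ext; simp [Nat.mod_eq_of_lt j.2]

theorem exA_det : (exA K c).det ≠ 0 := by
  rw [exA, Matrix.det_diagonal, Finset.prod_ne_zero_iff]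
  intro i _; exact Nat.cast_add_one_ne_zero _

theorem exB_Kry : (Kry (exB K c)).det ≠ 0 := by
  have : Kry (exB K c) = 1 := by
    ext i j
    simp [Kry, exB_pow, Matrix.one_apply]
  rw [this]; simp

theorem exA_Hk : (Hk (exA K c)).det ≠ 0 := by
  have : Hk (exA K c) = (Matrix.vandermonde fun i : Fin (c+1) => ((i : ℕ) : K) + 1)ᵀ * (Matrix.vandermonde fun i : Fin (c+1) => ((i : ℕ) : K) + 1) := by
    ext i j
    simp only [Hk, exA, Matrix.diagonal_pow, Matrix.of_apply, Matrix.trace_diagonal, Matrix.mul_apply, Matrix.transpose_apply, Matrix.vandermonde_apply, Pi.pow_apply]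
    refine Finset.sum_congr rfl fun l _ => ?_
    rw [pow_add]
  rw [this, Matrix.det_mul, Matrix.det_transpose]
  have h : (Matrix.vandermonde fun i : Fin (c+1) => ((i : ℕ) : K) + 1).det ≠ 0 := by
    rw [Matrix.det_vandermonde_ne_zero_iff]
    intro a b hab
    have : (a : ℕ) = (b : ℕ) := by simpa using hab
    exact Fin.ext this
  exact mul_ne_zero h h

theorem ex_Crm : (Crm (exA K c) (exB K c)).det ≠ 0 := by
  set A := exA K c with hA
  set B := exB K c with hB
  have hadjB : B.adjugate = B.det • B ^ c := by
    rw [← mul_one B.adjugate, ← exB_inv (K := K) (c := c), ← hB, ← mul_assoc, Matrix.adjugate_mul, smul_mul_assoc, one_mul]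
  have hadjA : A.adjugate = A.det • Matrix.diagonal fun i : Fin (c+1) => (((i : ℕ) : K) + 1)⁻¹ := by
    have : A * (Matrix.diagonal fun i : Fin (c+1) => (((i : ℕ) : K) + 1)⁻¹) = 1 := by
      rw [hA, exA, Matrix.diagonal_mul_diagonal, ← Matrix.diagonal_one]
      congr 1; ext i
      have : ((i : ℕ) : K) + 1 ≠ 0 := by exact Nat.cast_add_one_ne_zero _
      field_simp
    rw [← mul_one A.adjugate, ← this, ← mul_assoc, Matrix.adjugate_mul, smul_mul_assoc, one_mul]
  have hlast : Fin.ofNat (c+1) c = Fin.last c := by ext; simp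
  have : Crm A B = Matrix.diagonal (fun j : Fin (c+1) => if j = Fin.last c then 1 else
      A.det * B.det * ((((j:ℕ):K) + 1) * ((c : K) + 1)⁻¹ - 1)) := by
    ext i j
    simp only [Crm, Matrix.of_apply, Matrix.diagonal_apply]
    by_cases hj : j = Fin.last c
    · subst hj; simp only [if_true]
      by_cases hi : i = Fin.last c <;> simp [hi]
    · simp only [if_neg hj]
      rw [hadjA, hadjB, mul_smul_comm, mul_smul_comm, ← smul_sub, smul_mul_assoc, smul_smul, mul_comm B.det, Matrix.smul_apply, smul_eq_mul]
      have hsucc : Fin.last c + Fin.ofNat (c+1) ((j:ℕ)+1) = j := by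
        have := Fin.val_lt_last hj
        ext; simp only [Fin.val_add, Fin.val_last, Fin.val_ofNat, Nat.add_mod_mod]
        rw [show c + ((j:ℕ)+1) = j + (c+1) by ring]; simp [Nat.mod_eq_of_lt j.2]
      have e1 : ((A * B ^ ((j:ℕ)+1) * (Matrix.diagonal fun i : Fin (c+1) => (((i : ℕ) : K) + 1)⁻¹) - B ^ ((j:ℕ)+1)) * B ^ c) i 0 =
        (A * B ^ ((j:ℕ)+1) * (Matrix.diagonal fun i : Fin (c+1) => (((i : ℕ) : K) + 1)⁻¹) - B ^ ((j:ℕ)+1)) i (Fin.last c) := by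
        rw [Matrix.mul_apply, Finset.sum_eq_single (Fin.last c)]
        · rw [hB, exB_pow c]; simp [hlast]
        · intro b _ hb; rw [hB, exB_pow c]; simp [hlast, hb]
        · simp
      rw [e1, Matrix.sub_apply, Matrix.mul_diagonal, hA, exA, Matrix.diagonal_mul, hB, exB_pow]
      simp only [Matrix.of_apply, hsucc, Fin.val_last]
      by_cases hi : i = j
      · subst hi; simp [hj]
      · simp [hi]
  rw [this, Matrix.det_diagonal, Finset.prod_ne_zero_iff]
  intro j _
  split_ifs with hj
  · exact one_ne_zero
  · refine mul_ne_zero (mul_ne_zero exA_det exB_det) ?_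
    have hc : (c : K) + 1 ≠ 0 := by exact Nat.cast_add_one_ne_zero _
    rw [sub_ne_zero]
    intro h
    rw [← div_eq_mul_inv, div_eq_one_iff_eq hc] at h
    have : (j:ℕ) = c := by simpa using h
    exact hj (Fin.ext this)
end example_

section generic
variable {k Ω : Type} [Field k] [Field Ω] [Algebra k Ω] [CharZero k]

theorem generic_Gd (h : Bool → Matrix (Fin (c+1)) (Fin (c+1)) Ω) (hh : AlgebraicIndependent k (ent h)) :
    Gd (h false) (h true) ≠ 0 := by
  let MP := MvPolynomial (Bool × Fin (c+1) × Fin (c+1)) k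
  let X : Bool → Matrix (Fin (c+1)) (Fin (c+1)) MP := fun b => Matrix.of fun i j => MvPolynomial.X (b, i, j)
  have hX : ∀ b, (X b).map (MvPolynomial.aeval (ent h) : MP →ₐ[k] Ω).toRingHom = h b := by
    intro b; ext i j; simp [X, ent]
  have hev : ∀ (e : Bool → Matrix (Fin (c+1)) (Fin (c+1)) k) b, (X b).map (MvPolynomial.eval (ent e) : MP →+* k) = e b := by
    intro e b; ext i j; simp [X, ent]
  have hex : ∀ F : (Bool → Matrix (Fin (c+1)) (Fin (c+1)) MP) → MP, ∀ e v, MvPolynomial.eval (ent e) (F X) = v → v ≠ 0 → F X ≠ 0 := by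
    intro F e v h1 h2 h3; rw [h3, map_zero] at h1; exact h2 h1.symm
  have hne : Gd (X false) (X true) ≠ 0 := by
    let e1 : Bool → Matrix (Fin (c+1)) (Fin (c+1)) k := fun b => if b then exB k c else exA k c
    let e2 : Bool → Matrix (Fin (c+1)) (Fin (c+1)) k := fun b => if b then exA k c else exB k c
    unfold Gd
    refine mul_ne_zero (mul_ne_zero (mul_ne_zero (mul_ne_zero (mul_ne_zero (mul_ne_zero ?_ ?_) ?_) ?_) ?_) ?_) ?_
    · refine hex (fun Y => (Y false).det) e1 _ ?_ (exA_det (K := k) (c := c)); rw [← det_mapR, hev]; rfl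
    · refine hex (fun Y => (Y true).det) e1 _ ?_ (exB_det (K := k) (c := c)); rw [← det_mapR, hev]; rfl
    · refine hex (fun Y => (Kry (Y true)).det) e1 _ ?_ (exB_Kry (K := k) (c := c)); rw [← det_mapR, ← Kry_map, hev]; rfl
    · refine hex (fun Y => (Crm (Y false) (Y true)).det) e1 _ ?_ (ex_Crm (K := k) (c := c)); rw [← det_mapR, ← Crm_map, hev, hev]; rfl
    · refine hex (fun Y => (Kry (Y false)).det) e2 _ ?_ (exB_Kry (K := k) (c := c)); rw [← det_mapR, ← Kry_map, hev]; rfl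
    · refine hex (fun Y => (Hk (Y false)).det) e1 _ ?_ (exA_Hk (K := k) (c := c)); rw [← det_mapR, ← Hk_map, hev]; rfl
    · refine hex (fun Y => (Hk (Y true)).det) e2 _ ?_ (exA_Hk (K := k) (c := c)); rw [← det_mapR, ← Hk_map, hev]; rfl
  rw [← hX, ← hX, Gd_map]
  intro h0
  exact hne (hh (by simpa using h0))

end generic
end PartC2

section PartD

theorem ofFn_prod_isUnit {M : Type} [Monoid M] {g : ℕ} (f : Fin g → M) (hu : ∀ j, IsUnit (f j)) :
    IsUnit (List.ofFn f).prod := by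
  induction g with
  | zero => simp
  | succ g ih =>
    rw [List.ofFn_succ, List.prod_cons]
    exact (hu 0).mul (ih _ fun j => hu _)

theorem ofFn_prod_cancel {M : Type} [Monoid M] {g : ℕ} (f f' : Fin g → M) (hu : ∀ j, IsUnit (f j))
    (i : Fin g) (hoff : ∀ j, j ≠ i → f j = f' j) (h : (List.ofFn f).prod = (List.ofFn f').prod) :
    f i = f' i := by
  induction g with
  | zero => exact i.elim0
  | succ g ih =>
    rw [List.ofFn_succ, List.prod_cons, List.ofFn_succ, List.prod_cons] at h
    by_cases hi : i = 0
    · subst hi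
      have e : (fun j : Fin g => f j.succ) = (fun j : Fin g => f' j.succ) := by
        ext j; exact hoff _ (Fin.succ_ne_zero j)
      rw [e] at h
      have hT : IsUnit (List.ofFn (fun j : Fin g => f' j.succ)).prod := by
        rw [← e]; exact ofFn_prod_isUnit _ fun j => hu _
      exact hT.mul_right_cancel h
    · obtain ⟨i', rfl⟩ := Fin.exists_succ_eq.mpr hi
      have e0 : f 0 = f' 0 := hoff 0 (Ne.symm hi)
      rw [← e0] at h
      have h2 := (hu 0).mul_left_cancel h
      exact ih (fun j => f j.succ) (fun j => f' j.succ) (fun j => hu _) i'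
        (fun j hj => hoff _ (fun hh => hj (Fin.succ_injective _ hh))) h2

variable {R S : Type} [CommRing R] [CommRing S] {g c : ℕ}

/-- `GL` representations of the surface group. -/
def GLr {m : Type} [Fintype m] [DecidableEq m] (ρ : Fin g × Bool → Matrix m m R) : Prop :=
  (∀ x, IsUnit (ρ x).det) ∧
    (List.ofFn fun i : Fin g => ρ (i, false) * ρ (i, true) * (ρ (i, false))⁻¹ * (ρ (i, true))⁻¹).prod = 1

section gen
variable {m : Type} [Fintype m] [DecidableEq m]

theorem map_inv_of_isUnit (f : R →+* S) (M : Matrix m m R) (hM : IsUnit M.det) : (M.map f)⁻¹ = (M⁻¹).map f := by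
  apply Matrix.inv_eq_right_inv
  rw [← Matrix.map_mul, Matrix.mul_nonsing_inv _ hM]
  simp

theorem isUnit_det_map (f : R →+* S) (M : Matrix m m R) (hM : IsUnit M.det) : IsUnit (M.map f).det := by
  have := f.map_det M
  rw [RingHom.mapMatrix_apply] at this
  rw [← this]; exact hM.map f

theorem GLr.map (f : R →+* S) {ρ : Fin g × Bool → Matrix m m R} (h : GLr ρ) : GLr (fun x => (ρ x).map f) := by
  refine ⟨fun x => isUnit_det_map f _ (h.1 x), ?_⟩
  have h2 := congrArg (f.mapMatrix : Matrix m m R →+* Matrix m m S) h.2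
  rw [map_one, map_list_prod, List.map_ofFn] at h2
  rw [← h2]
  congr 2
  ext1 i
  simp only [Function.comp, map_mul, RingHom.mapMatrix_apply, map_inv_of_isUnit f _ (h.1 _)]

theorem comm_isUnit {ρ : Fin g × Bool → Matrix m m R} (h : ∀ x, IsUnit (ρ x).det) (i : Fin g) :
    IsUnit (ρ (i, false) * ρ (i, true) * (ρ (i, false))⁻¹ * (ρ (i, true))⁻¹) := by
  rw [Matrix.isUnit_iff_isUnit_det]
  simp only [Matrix.det_mul]
  exact (((h _).mul (h _)).mul (Matrix.isUnit_nonsing_inv_det _ (h _))).mul (Matrix.isUnit_nonsing_inv_det _ (h _))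

theorem GLr.comm_eq {ρ ρ' : Fin g × Bool → Matrix m m R} (h : GLr ρ) (h' : GLr ρ') (i : Fin g)
    (hoff : ∀ j, j ≠ i → ∀ b, ρ (j, b) = ρ' (j, b)) :
    ρ (i, false) * ρ (i, true) * (ρ (i, false))⁻¹ * (ρ (i, true))⁻¹ =
     ρ' (i, false) * ρ' (i, true) * (ρ' (i, false))⁻¹ * (ρ' (i, true))⁻¹ := by
  refine ofFn_prod_cancel (fun i => ρ (i, false) * ρ (i, true) * (ρ (i, false))⁻¹ * (ρ (i, true))⁻¹)
    (fun i => ρ' (i, false) * ρ' (i, true) * (ρ' (i, false))⁻¹ * (ρ' (i, true))⁻¹) (fun j => comm_isUnit h.1 j) i ?_ (h.2.trans h'.2.symm)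
  intro j hj; simp only [hoff j hj]

theorem comm_rel (A B : Matrix m m R) (hA : IsUnit A.det) (hB : IsUnit B.det) :
    A * B = (A * B * A⁻¹ * B⁻¹) * (B * A) := by
  rw [mul_assoc (A * B * A⁻¹), ← mul_assoc B⁻¹, Matrix.nonsing_inv_mul _ hB, one_mul, mul_assoc, Matrix.nonsing_inv_mul _ hA, mul_one]
end gen

/-- index set of the parameters. -/
abbrev Par (g c : ℕ) (i0 : Fin g) : Type :=
  (({j : Fin g // j ≠ i0} × Bool) × Fin (c+1) × Fin (c+1)) ⊕ (Fin c × Fin (c+1)) ⊕ Unit ⊕ Fin (c+1)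

def parEmb (i0 : Fin g) : Par g c i0 → (Fin g × Bool) × Fin (c+1) × Fin (c+1)
  | .inl p => ((p.1.1.1, p.1.2), p.2.1, p.2.2)
  | .inr (.inl q) => ((i0, true), q.1.succ, q.2)
  | .inr (.inr (.inl _)) => ((i0, true), 0, Fin.last c)
  | .inr (.inr (.inr i)) => ((i0, false), i, 0)

def params (i0 : Fin g) (ρ : Fin g × Bool → Matrix (Fin (c+1)) (Fin (c+1)) R) : Par g c i0 → R :=
  fun p => ent ρ (parEmb i0 p)

theorem params_unique (i0 : Fin g) {ρ ρ' : Fin g × Bool → Matrix (Fin (c+1)) (Fin (c+1)) R}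
    (h : GLr ρ) (h' : GLr ρ') (hG : IsUnit (Gd (ρ (i0, false)) (ρ (i0, true))))
    (hp : params i0 ρ' = params i0 ρ) : ρ' = ρ := by
  have hoff : ∀ j, j ≠ i0 → ∀ b, ρ' (j, b) = ρ (j, b) := by
    intro j hj b
    ext r s
    exact congrFun hp (.inl ((⟨j, hj⟩, b), r, s))
  have hC := GLr.comm_eq h' h i0 hoff
  simp only [Gd, IsUnit.mul_iff] at hG
  have e := UL (A := ρ (i0, false)) (B := ρ (i0, true)) (A' := ρ' (i0, false)) (B' := ρ' (i0, true))
    (C := ρ (i0, false) * ρ (i0, true) * (ρ (i0, false))⁻¹ * (ρ (i0, true))⁻¹) (h.1 _) (h.1 _) (h'.1 _)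
    ((Matrix.isUnit_iff_isUnit_det _).mp (comm_isUnit h.1 i0)) (by tauto) (by tauto)
    (comm_rel _ _ (h.1 _) (h.1 _))
    (by rw [← hC]; exact comm_rel _ _ (h'.1 _) (h'.1 _))
    (by
      intro i j hi
      obtain ⟨i', rfl⟩ := Fin.exists_succ_eq.mpr hi
      exact congrFun hp (.inr (.inl (i', j))))
    (congrFun hp (.inr (.inr (.inl ()))))
    (fun i => congrFun hp (.inr (.inr (.inr i))))
  ext1 ⟨j, b⟩
  by_cases hj : j = i0
  · subst hj
    cases b
    · exact e.1
    · exact e.2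
  · exact hoff j hj b

section deriv
variable {k Ω : Type} [Field k] [Field Ω] [Algebra k Ω] 

/-- ring homomorphism to dual numbers associated with a derivation -/
def dualHom (D : Derivation k Ω Ω) : Ω →+* TrivSqZeroExt Ω Ω where
  toFun t := TrivSqZeroExt.inl t + TrivSqZeroExt.inr (D t)
  map_one' := by simp
  map_zero' := by simp
  map_add' a b := by
    ext <;> simp
  map_mul' a b := by
    ext
    · simp
    · simp [mul_comm]

theorem dualHom_of (D : Derivation k Ω Ω) (t : Ω) (h : D t = 0) :
    dualHom D t = TrivSqZeroExt.inlHom Ω Ω t := by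
  simp [dualHom, h]

theorem of_dualHom (D : Derivation k Ω Ω) (t : Ω) (h : dualHom D t = TrivSqZeroExt.inlHom Ω Ω t) : D t = 0 := by
  have := congrArg TrivSqZeroExt.snd h
  simpa [dualHom] using this

theorem deriv_rigid (i0 : Fin g) {ρ : Fin g × Bool → Matrix (Fin (c+1)) (Fin (c+1)) Ω}
    (h : GLr ρ) (hG : Gd (ρ (i0, false)) (ρ (i0, true)) ≠ 0) (D : Derivation k Ω Ω)
    (hp : ∀ p, D (params i0 ρ p) = 0) : ∀ p, D (ent ρ p) = 0 := by
  have e := params_unique i0 (h.map (TrivSqZeroExt.inlHom Ω Ω)) (h.map (dualHom D))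
    (by rw [Gd_map]; exact (isUnit_iff_ne_zero.mpr hG).map _)
    (by
      ext1 p
      exact dualHom_of D _ (hp p))
  rintro ⟨x, i, j⟩
  exact of_dualHom D _ (congrFun (congrFun (congrFun e x) i) j)

variable {m : Type} [Fintype m] [DecidableEq m]

theorem deriv_ell {ρ : Fin g × Bool → Matrix m m Ω} (h : GLr ρ) (i : Fin g) (D : Derivation k Ω Ω)
    (hD : ∀ j, j ≠ i → ∀ b, (ρ (j, b)).map D = 0) :
    ell (ρ (i, false)) (ρ (i, true)) (ρ (i, false) * ρ (i, true) * (ρ (i, false))⁻¹ * (ρ (i, true))⁻¹)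
      (fun b => (ρ (i, b)).map D) = 0 := by
  set C := ρ (i, false) * ρ (i, true) * (ρ (i, false))⁻¹ * (ρ (i, true))⁻¹ with hC
  have hCD : C.map D = 0 := by
    have e := GLr.comm_eq (h.map (dualHom D)) (h.map (TrivSqZeroExt.inlHom Ω Ω)) i (by
      intro j hj b
      ext1 r s
      exact dualHom_of D _ (congrFun (congrFun (hD j hj b) r) s))
    simp only [map_inv_of_isUnit _ _ (h.1 _), ← Matrix.map_mul, ← hC] at e
    ext r s
    exact of_dualHom D _ (congrFun (congrFun e r) s)
  have e := congrArg (fun M => M.map D) (comm_rel _ _ (h.1 (i, false)) (h.1 (i, true)))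
  simp only [← hC, map_mul_deriv, hCD] at e
  simp only [ell, LinearMap.coe_mk, AddHom.coe_mk]
  rw [sub_eq_zero, add_comm, add_comm _ (ρ (i, true) * _)]
  simpa [add_comm] using e

end deriv
end PartD

section PartD2
variable {k Ω : Type} [Field k] [Field Ω] [Algebra k Ω] {g c : ℕ}
variable {m : Type} [Fintype m] [DecidableEq m]

/-- restriction of a tuple to the handles different from `i`. -/
def offh (i : Fin g) (ρ : Fin g × Bool → Matrix m m Ω) : {j : Fin g // j ≠ i} × Bool → Matrix m m Ω :=
  fun x => ρ (x.1.1, x.2)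

theorem map_eq_zero_of_ent {ι : Type} (D : Derivation k Ω Ω) (A : ι → Matrix m m Ω)
    (h : ∀ p, D (ent A p) = 0) (i : ι) : (A i).map D = 0 := by
  ext r s; exact h (i, r, s)

theorem rk_D2 {ρ : Fin g × Bool → Matrix m m Ω} (h : GLr ρ) (i : Fin g) :
    rk k (ent ρ) ≤ rk k (ent (offh i ρ)) +
      (Fintype.card m ^ 2 + Module.finrank Ω (Zc (ρ (i, false)) (ρ (i, true)))) := by
  set C := ρ (i, false) * ρ (i, true) * (ρ (i, false))⁻¹ * (ρ (i, true))⁻¹ with hC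
  let E : (Fin g × Bool → Matrix m m Ω) →ₗ[Ω] (Bool → Matrix m m Ω) :=
    { toFun := fun w b => w (i, b), map_add' := fun _ _ => rfl, map_smul' := fun _ _ => rfl }
  let F : (Fin g × Bool → Matrix m m Ω) →ₗ[Ω] ({j : Fin g // j ≠ i} × Bool → Matrix m m Ω) :=
    { toFun := fun w => offh i w, map_add' := fun _ _ => rfl, map_smul' := fun _ _ => rfl }
  let V : Submodule Ω (Fin g × Bool → Matrix m m Ω) :=
    LinearMap.ker F ⊓ (LinearMap.ker (ell (ρ (i, false)) (ρ (i, true)) C)).comap E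
  refine (rk_le_addM (k := k) (ent (offh i ρ)) ρ V ?_).trans ?_
  · intro D hD
    have h0 := map_eq_zero_of_ent D (offh i ρ) hD
    refine ⟨?_, ?_⟩
    · rw [SetLike.mem_coe, LinearMap.mem_ker]
      ext1 x
      exact h0 x
    · exact deriv_ell h i D (fun j hj b => h0 (⟨j, hj⟩, b))
  · gcongr
    refine le_trans ?_ (finrank_ker_ell (isUnit_iff_ne_zero.mp (h.1 (i, false))) (isUnit_iff_ne_zero.mp (h.1 (i, true))) (comm_rel _ _ (h.1 _) (h.1 _)))
    let q : V →ₗ[Ω] LinearMap.ker (ell (ρ (i, false)) (ρ (i, true)) C) := E.restrict (fun x hx => hx.2)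
    refine LinearMap.finrank_le_finrank_of_injective (f := q) ?_
    rintro ⟨a, ha⟩ ⟨b, hb⟩ hab
    have h1 : E a = E b := congrArg Subtype.val hab
    have h2 : F a = 0 := ha.1
    have h3 : F b = 0 := hb.1
    apply Subtype.ext
    ext1 ⟨j, t⟩
    by_cases hj : j = i
    · subst hj; exact congrFun h1 t
    · have := congrFun (h2.trans h3.symm) (⟨j, hj⟩, t)
      exact this

theorem rk_off {ρ : Fin g × Bool → Matrix m m Ω} (i j : Fin g) (hij : j ≠ i) :
    rk k (ent (offh i ρ)) ≤ rk k (ent (fun b => ρ (j, b))) + (2 * (g - 2)) * Fintype.card m ^ 2 := by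
  let E : ({j : Fin g // j ≠ i} × Bool → Matrix m m Ω) →ₗ[Ω] (Bool → Matrix m m Ω) :=
    { toFun := fun w b => w (⟨j, hij⟩, b), map_add' := fun _ _ => rfl, map_smul' := fun _ _ => rfl }
  let q : ({j : Fin g // j ≠ i} × Bool → Matrix m m Ω) →ₗ[Ω] ({l : Fin g // l ≠ i ∧ l ≠ j} × Bool → Matrix m m Ω) :=
    { toFun := fun w b => w (⟨b.1.1, b.1.2.1⟩, b.2), map_add' := fun _ _ => rfl, map_smul' := fun _ _ => rfl }
  refine (rk_le_addM (k := k) (ent (fun b => ρ (j, b))) (offh i ρ) (LinearMap.ker E) ?_).trans ?_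
  · intro D hD
    have h0 := map_eq_zero_of_ent D _ hD
    rw [LinearMap.mem_ker]
    ext1 b
    exact h0 b
  · gcongr
    have e1 : Module.finrank Ω (LinearMap.ker E) ≤ Module.finrank Ω ({l : Fin g // l ≠ i ∧ l ≠ j} × Bool → Matrix m m Ω) := by
      refine LinearMap.finrank_le_finrank_of_injective (f := q.comp (LinearMap.ker E).subtype) ?_
      rintro ⟨a, ha⟩ ⟨b, hb⟩ hab
      have h1 : q a = q b := hab
      have h2 : E a = 0 := ha
      have h3 : E b = 0 := hb
      apply Subtype.ext
      ext1 ⟨⟨l, hl⟩, t⟩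
      by_cases hj : l = j
      · subst hj; exact congrFun (h2.trans h3.symm) t
      · exact congrFun h1 (⟨l, hl, hj⟩, t)
    refine e1.trans (le_of_eq ?_)
    rw [Module.finrank_pi_fintype]
    simp only [Module.finrank_matrix, Module.finrank_self, mul_one, Finset.sum_const, Finset.card_univ, smul_eq_mul, Fintype.card_prod, Fintype.card_bool]
    have : Fintype.card {l : Fin g // l ≠ i ∧ l ≠ j} = g - 2 := by
      rw [Fintype.card_subtype]
      have : (Finset.univ.filter fun l : Fin g => l ≠ i ∧ l ≠ j) = (Finset.univ.erase i).erase j := by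
        ext l; simp [and_comm]
      rw [this, Finset.card_erase_of_mem (by simp [hij]), Finset.card_erase_of_mem (by simp)]
      simp; omega
    rw [this]; ring

theorem card_off (i : Fin g) : Fintype.card (({j : Fin g // j ≠ i} × Bool) × m × m) = (2 * (g - 1)) * Fintype.card m ^ 2 := by
  have : Fintype.card {l : Fin g // l ≠ i} = g - 1 := by
    simp [Fintype.card_subtype_compl]
  simp only [Fintype.card_prod, Fintype.card_bool, this]; ring

theorem generic_main [CharZero k] [IsAlgClosed Ω] (hg : 2 ≤ g) {ρ : Fin g × Bool → Matrix (Fin (c+1)) (Fin (c+1)) Ω}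
    (h : GLr ρ)
    (hgen : ∃ s : ℕ → Ω, ∀ v : ℕ → Ω, ∃ D : Derivation k Ω Ω, (∀ b, (ρ b).map D = 0) ∧ ∀ i, D (s i) = v i)
    (hrk : (2 * g - 1) * (c+1)^2 + 1 ≤ rk k (ent ρ)) (i : Fin g) :
    Gd (ρ (i, false)) (ρ (i, true)) ≠ 0 := by
  set K : Fin g → ℕ := fun i => Module.finrank Ω (Zc (ρ (i, false)) (ρ (i, true))) with hK
  have step1 : ∀ i j, j ≠ i → K i ≤ 1 → Gd (ρ (j, false)) (ρ (j, true)) ≠ 0 := by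
    intro i j hij hKi
    have e1 := rk_D2 (k := k) h i
    have e2 : AlgebraicIndependent k (ent (offh i ρ)) := by
      apply algebraicIndependent_of_rk
      rw [card_off]
      simp only [Fintype.card_fin] at e1 ⊢
      have : (2 * g - 1) * (c+1)^2 = 2 * (g - 1) * (c+1)^2 + (c+1)^2 := by
        obtain ⟨g', rfl⟩ := Nat.exists_eq_add_of_le hg
        rw [show 2 * (2 + g') - 1 = 2 * g' + 3 by omega, show 2 + g' - 1 = g' + 1 by omega]; ring
      have hKi' : Module.finrank Ω (Zc (ρ (i, false)) (ρ (i, true))) ≤ 1 := hKi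
      omega
    have e3 := e2.comp (fun p : Bool × Fin (c+1) × Fin (c+1) => (((⟨j, hij⟩ : {j : Fin g // j ≠ i}), p.1), p.2)) (by
      rintro ⟨a, b⟩ ⟨a', b'⟩ hab
      simpa using hab)
    exact generic_Gd (k := k) (fun b => ρ (j, b)) e3
  have step2 : ∀ i j, j ≠ i → 2 ≤ K j → K j < K i := by
    intro i j hij hj
    have e1 := rk_D2 (k := k) h i
    have e2 := rk_off (k := k) (ρ := ρ) i j hij
    have e3 := D3 (k := k) (fun b => ρ (j, b)) (by
      obtain ⟨s, hs⟩ := hgen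
      refine ⟨s, fun v => ?_⟩
      obtain ⟨D, hD1, hD2⟩ := hs v
      exact ⟨D, fun b => hD1 _, hD2⟩) hj
    simp only [Fintype.card_fin] at e1 e2 e3
    have : (2 * g - 1) * (c+1)^2 = 2 * (g - 2) * (c+1)^2 + 3 * (c+1)^2 := by
      obtain ⟨g', rfl⟩ := Nat.exists_eq_add_of_le hg
      rw [show 2 * (2 + g') - 1 = 2 * g' + 3 by omega, show 2 + g' - 2 = g' by omega]; ring
    simp only [hK]
    omega
  obtain ⟨j, hj⟩ : ∃ j : Fin g, j ≠ i := by
    haveI : Nontrivial (Fin g) := Fin.nontrivial_iff_two_le.mpr hg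
    exact exists_ne i
  by_cases hKj : K j ≤ 1
  · exact step1 j i hj.symm hKj
  · have hKi : K i ≤ 1 := by
      by_contra hKi
      have a1 := step2 i j hj (by omega)
      have a2 := step2 j i hj.symm (by omega)
      omega
    have h2 := step1 i j hj hKi
    exfalso
    apply hKj
    simp only [Gd, mul_ne_zero_iff] at h2
    exact good_finrank h2.1.1.1.1.1.1 (by tauto) (by tauto)

theorem card_Par (hg : 2 ≤ g) (i0 : Fin g) : Fintype.card (Par g c i0) = (2 * g - 1) * (c+1)^2 + 1 := by
  rw [Fintype.card_sum, card_off]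
  simp only [Fintype.card_sum, Fintype.card_prod, Fintype.card_fin, Fintype.card_unit]
  obtain ⟨g', rfl⟩ := Nat.exists_eq_add_of_le hg
  rw [show 2 * (2 + g') - 1 = 2 * g' + 3 by omega, show 2 + g' - 1 = g' + 1 by omega]; ring

theorem generic_params [CharZero k] [IsAlgClosed Ω] (hg : 2 ≤ g) {ρ : Fin g × Bool → Matrix (Fin (c+1)) (Fin (c+1)) Ω}
    (h : GLr ρ)
    (hG : ∀ i, Gd (ρ (i, false)) (ρ (i, true)) ≠ 0)
    (hrk : (2 * g - 1) * (c+1)^2 + 1 ≤ rk k (ent ρ)) (i0 : Fin g) :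
    AlgebraicIndependent k (params i0 ρ) := by
  apply algebraicIndependent_of_rk
  rw [card_Par hg]
  refine hrk.trans (rk_le_of _ _ ?_)
  intro D hD
  exact deriv_rigid i0 h (hG i0) D hD

theorem generic_algebraic [CharZero k] {ρ : Fin g × Bool → Matrix (Fin (c+1)) (Fin (c+1)) Ω}
    (h : GLr ρ) (i0 : Fin g) (hG : Gd (ρ (i0, false)) (ρ (i0, true)) ≠ 0)  (p) :
    IsAlgebraic (IntermediateField.adjoin k (Set.range (params i0 ρ))) (ent ρ p) :=
  isAlgebraic_of_deriv _ _ fun D hD => deriv_rigid i0 h hG D hD p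

end PartD2

section PartE
variable {g c : ℕ}

theorem GLr_of_map {m : Type} [Fintype m] [DecidableEq m] {K L : Type} [Field K] [Field L] (f : K →+* L) {ρ : Fin g × Bool → Matrix m m K}
    (h : GLr (fun x => (ρ x).map f)) : GLr ρ := by
  have h1 : ∀ x, IsUnit (ρ x).det := by
    intro x
    rw [isUnit_iff_ne_zero]
    intro h0
    have := isUnit_iff_ne_zero.mp (h.1 x)
    have e := f.map_det (ρ x)
    rw [RingHom.mapMatrix_apply] at e
    rw [← e, h0, map_zero] at this
    exact this rfl
  refine ⟨h1, ?_⟩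
  have h2 := h.2
  have e : (fun i : Fin g => (ρ (i, false)).map f * (ρ (i, true)).map f * ((ρ (i, false)).map f)⁻¹ * ((ρ (i, true)).map f)⁻¹) =
     (f.mapMatrix : Matrix m m K →+* Matrix m m L) ∘ (fun i : Fin g => (ρ (i, false)) * (ρ (i, true)) * ((ρ (i, false)))⁻¹ * ((ρ (i, true)))⁻¹) := by
    ext1 i
    simp only [Function.comp, map_mul, RingHom.mapMatrix_apply, map_inv_of_isUnit f _ (h1 _)]
  rw [e, ← List.map_ofFn, ← map_list_prod] at h2
  have hinj : Function.Injective (f.mapMatrix : Matrix m m K →+* Matrix m m L) := by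
    intro A B hAB
    ext i j
    exact f.injective (congrFun (congrFun hAB i) j)
  exact hinj (h2.trans (map_one _).symm)

theorem lift_field {F A M : Type} [Field F] [Field A] [Field M] [Algebra F A] [Algebra F M] [IsAlgClosed M]
    (h : Algebra.IsAlgebraic F A) : Nonempty (A →ₐ[F] M) := ⟨IsAlgClosed.lift⟩

variable {k Ω₁ Ω₂ : Type} [Field k] [Field Ω₁] [Field Ω₂] [Algebra k Ω₁] [Algebra k Ω₂] [CharZero k]

theorem iso_lemma [IsAlgClosed Ω₁] (i0 : Fin g) {ρ₁ : Fin g × Bool → Matrix (Fin (c+1)) (Fin (c+1)) Ω₁}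
    {ρ₂ : Fin g × Bool → Matrix (Fin (c+1)) (Fin (c+1)) Ω₂} (h₁ : GLr ρ₁) (h₂ : GLr ρ₂)
    (hG₁ : Gd (ρ₁ (i0, false)) (ρ₁ (i0, true)) ≠ 0) (hG₂ : Gd (ρ₂ (i0, false)) (ρ₂ (i0, true)) ≠ 0)
    (ha₁ : AlgebraicIndependent k (params i0 ρ₁)) (ha₂ : AlgebraicIndependent k (params i0 ρ₂)) :
    ∃ (E : IntermediateField k Ω₂) (φ : E →ₐ[k] Ω₁), (∀ t : Ω₂, IsAlgebraic E t → t ∈ E) ∧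
      ∃ hE : ∀ p, ent ρ₂ p ∈ E, ∀ p, φ ⟨ent ρ₂ p, hE p⟩ = ent ρ₁ p := by
  let F₀ := IntermediateField.adjoin k (Set.range (params i0 ρ₂))
  let ψ : F₀ →ₐ[k] Ω₁ := (IntermediateField.val _).comp
    ((ha₁.aevalEquivField.toAlgHom).comp ha₂.aevalEquivField.symm.toAlgHom)
  have hmem : ∀ p, params i0 ρ₂ p ∈ F₀ := fun p => IntermediateField.subset_adjoin _ _ ⟨p, rfl⟩
  have hψ : ∀ p, ψ ⟨params i0 ρ₂ p, hmem p⟩ = params i0 ρ₁ p := by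
    intro p
    have e2 : (⟨params i0 ρ₂ p, hmem p⟩ : F₀) = ha₂.aevalEquivField (algebraMap (MvPolynomial (Par g c i0) k) _ (MvPolynomial.X p)) := by
      apply Subtype.ext
      rw [AlgebraicIndependent.aevalEquivField_algebraMap_apply_coe]; simp
    simp only [ψ, AlgHom.comp_apply, e2]
    simp [AlgebraicIndependent.aevalEquivField_algebraMap_apply_coe]
  letI : Algebra F₀ Ω₁ := ψ.toRingHom.toAlgebra
  haveI : IsScalarTower k F₀ Ω₁ := IsScalarTower.of_algebraMap_eq (fun x => (ψ.commutes x).symm)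
  let E' := algebraicClosure F₀ Ω₂
  haveI hEalg : Algebra.IsAlgebraic F₀ E' := algebraicClosure.isAlgebraic F₀ Ω₂
  obtain ⟨φ'⟩ : Nonempty (E' →ₐ[F₀] Ω₁) := lift_field hEalg
  let E := E'.restrictScalars k
  let φ : E →ₐ[k] Ω₁ := φ'.restrictScalars k
  have hE : ∀ p, ent ρ₂ p ∈ E := fun p => by
    show ent ρ₂ p ∈ E'
    rw [mem_algebraicClosure_iff]
    exact generic_algebraic h₂ i0 hG₂ p
  refine ⟨E, φ, ?_, hE, ?_⟩
  · intro t ht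
    show t ∈ E'
    rw [mem_algebraicClosure_iff]
    have : IsAlgebraic E' t := ht
    exact this.restrictScalars F₀
  · let σ : Fin g × Bool → Matrix (Fin (c+1)) (Fin (c+1)) E := fun x => Matrix.of fun i j => ⟨ent ρ₂ (x, i, j), hE _⟩
    have hσ : GLr σ := by
      apply GLr_of_map (algebraMap E Ω₂)
      exact h₂
    have e := params_unique i0 h₁ (hσ.map φ.toRingHom) (isUnit_iff_ne_zero.mpr hG₁) (by
      ext1 p
      have := φ'.commutes ⟨params i0 ρ₂ p, hmem p⟩
      exact this.trans (hψ p))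
    rintro ⟨x, i, j⟩
    exact congrFun (congrFun (congrFun e x) i) j
end PartE

section PartF

theorem height_eval_ge {k σ : Type} [Field k] [Fintype σ] (r : σ → k) :
    (Fintype.card σ : ℕ∞) ≤ (RingHom.ker (eval r)).height := by
  classical
  let f : Finset σ → (MvPolynomial σ k →ₐ[k] MvPolynomial σ k) := fun S =>
    aeval (fun j => if j ∈ S then C (r j) else X j)
  have key : ∀ S : Finset σ, (S.card : ℕ∞) ≤ (RingHom.ker (f S).toRingHom).height := by
    intro S
    induction S using Finset.induction_on with
    | empty => simp
    | insert a S ha ih =>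
      rw [Finset.card_insert_of_notMem ha]
      push_cast
      have h1 : (RingHom.ker (f S).toRingHom).IsPrime := RingHom.ker_isPrime _
      have h2 : (RingHom.ker (f (insert a S)).toRingHom).IsPrime := RingHom.ker_isPrime _
      refine le_trans (by gcongr) (Ideal.height_add_one_le_of_lt_of_isPrime (I := RingHom.ker (f S).toRingHom) ?_)
      refine lt_of_le_of_ne ?_ ?_
      · intro p hp
        have e : f (insert a S) = (f {a}).comp (f S) := by
          ext1 j
          simp only [f, AlgHom.comp_apply, aeval_X, Finset.mem_insert, Finset.mem_singleton]
          by_cases h1 : j ∈ S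
          · simp [h1]
          · by_cases h2 : j = a
            · simp [h1, h2, ha]
            · simp [h1, h2]
        rw [RingHom.mem_ker] at hp ⊢
        change f S p = 0 at hp
        change f (insert a S) p = 0
        rw [e, AlgHom.comp_apply, hp, map_zero]
      · intro he
        have hm : (X a - C (r a) : MvPolynomial σ k) ∈ RingHom.ker (f (insert a S)).toRingHom := by
          rw [RingHom.mem_ker]
          change f (insert a S) _ = 0
          simp [f]
        rw [← he, RingHom.mem_ker] at hm
        change f S _ = 0 at hm
        simp only [f, map_sub, aeval_X, ha, if_false, aeval_C, algebraMap_eq] at hm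
        have := congrArg (fun q => eval (fun _ => r a + 1) q) hm
        simp at this
  have h := key Finset.univ
  rw [Finset.card_univ] at h
  convert h using 2
  ext p
  rw [RingHom.mem_ker, RingHom.mem_ker]
  change _ ↔ f Finset.univ p = 0
  have e : f Finset.univ p = C (eval r p) := by
    simp only [f, Finset.mem_univ, if_true]
    induction p using MvPolynomial.induction_on with
    | C a => simp
    | add p q hp hq => rw [map_add, hp, hq, map_add, map_add]
    | mul_X p i hp => rw [map_mul, hp, aeval_X, map_mul, map_mul, eval_X]
  rw [e, MvPolynomial.C_eq_zero]

theorem algIndep_extend {k A A' : Type} [Field k] [CommRing A] [IsDomain A] [CommRing A'] [Algebra k A] [Algebra k A']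
    {ι : Type} (a : ι → A) (π : A →ₐ[k] A') (ha : AlgebraicIndependent k (fun i => π (a i))) (f : A) (hf : f ≠ 0)
    (hπ : π f = 0) : AlgebraicIndependent k (fun o : Option ι => o.elim f a) := by
  have ha' : AlgebraicIndependent k a := AlgebraicIndependent.of_comp π ha
  rw [ha'.option_iff_transcendental]
  have hinj : ∀ b : Algebra.adjoin k (Set.range a), π (b : A) = 0 → b = 0 := by
    rintro ⟨b, hb⟩ h
    rw [Algebra.adjoin_range_eq_range_aeval] at hb
    obtain ⟨q, rfl⟩ := hb
    have : aeval (fun i => π (a i)) q = 0 := by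
      rw [← h]
      change _ = π (aeval a q)
      rw [← AlgHom.comp_apply, MvPolynomial.comp_aeval]
      
    have hq : q = 0 := by
      apply ha
      rw [this, map_zero]
    subst hq
    apply Subtype.ext
    simp
  rw [transcendental_iff]
  intro p
  generalize hN : p.natDegree = N
  induction N using Nat.strong_induction_on generalizing p with
  | _ N ih =>
  intro hp
  have e := Polynomial.divX_mul_X_add p
  have h0 : p.coeff 0 = 0 := by
    apply hinj
    have h1 := congrArg π hp
    rw [← e] at h1
    simp only [map_add, map_mul, Polynomial.aeval_X, Polynomial.aeval_C, hπ, mul_zero, zero_add, map_zero] at h1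
    exact h1
  rw [h0] at e
  simp only [map_zero, add_zero] at e
  by_cases hd : p.natDegree = 0
  · rw [Polynomial.eq_C_of_natDegree_eq_zero hd, h0, map_zero]
  · have : p.divX = 0 := by
      refine ih p.divX.natDegree ?_ p.divX rfl ?_
      · rw [Polynomial.natDegree_divX_eq_natDegree_tsub_one]; omega
      · rw [← e] at hp
        simp only [map_mul, Polynomial.aeval_X] at hp
        exact (mul_eq_zero.mp hp).resolve_right hf
    rw [← e, this, zero_mul]

theorem algIndep_of_chain {k A : Type} [Field k] [CommRing A] [Algebra k A] (m : ℕ) :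
    ∀ l : LTSeries (PrimeSpectrum A), l.length = m → ∃ (ι : Type) (_ : Fintype ι) (a : ι → A), Fintype.card ι = m ∧
      AlgebraicIndependent k (fun i => Ideal.Quotient.mk (l.head).asIdeal (a i)) := by
  induction m with
  | zero =>
    intro l hl
    refine ⟨Empty, inferInstance, fun e => e.elim, rfl, ?_⟩
    rw [algebraicIndependent_empty_type_iff]
    exact (algebraMap k (A ⧸ (l.head).asIdeal)).injective
  | succ m ih =>
    intro l hl
    obtain ⟨ι, _, a, hc, ha⟩ := ih (l.tail (by omega)) (by simp [hl])
    have hlt : l.head < (l.tail (by omega)).head := by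
      rw [RelSeries.head_tail]
      apply l.strictMono
      exact Fin.mk_lt_mk.mpr (by simp [hl])
    generalize (l.tail (by omega)).head = q at ha hlt
    generalize l.head = p at hlt
    have hle : p.asIdeal ≤ q.asIdeal := hlt.le
    obtain ⟨f, hf, hfp⟩ : ∃ f ∈ q.asIdeal, f ∉ p.asIdeal := by
      by_contra! hcon
      exact absurd hlt.le.antisymm (fun h => hlt.ne (h hcon))
    refine ⟨Option ι, inferInstance, fun o => o.elim f a, by simp [hc], ?_⟩
    have := algIndep_extend (k := k) (fun i => Ideal.Quotient.mk p.asIdeal (a i)) (Ideal.Quotient.factorₐ k hle) ha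
      (Ideal.Quotient.mk p.asIdeal f) (by rwa [Ne, Ideal.Quotient.eq_zero_iff_mem]) (by
        change Ideal.Quotient.mk q.asIdeal f = 0
        rwa [Ideal.Quotient.eq_zero_iff_mem])
    have e : (fun o : Option ι => Ideal.Quotient.mk p.asIdeal (o.elim f a)) =
        (fun o => o.elim (Ideal.Quotient.mk p.asIdeal f) (fun i => Ideal.Quotient.mk p.asIdeal (a i))) := by
      funext o; cases o <;> rfl
    rw [e]
    exact this

variable {g c : ℕ}

/-- generic matrices -/
noncomputable def genM (k : Type) [Field k] (g c : ℕ) (x : Fin g × Bool) :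
    Matrix (Fin (c+1)) (Fin (c+1)) (MvPolynomial ((Fin g × Bool) × Fin (c+1) × Fin (c+1)) k) :=
  Matrix.of fun i j => X (x, i, j)

/-- generic relator with adjugates -/
noncomputable def adjW {R : Type} [CommRing R] (ρ : Fin g × Bool → Matrix (Fin (c+1)) (Fin (c+1)) R) :
    Matrix (Fin (c+1)) (Fin (c+1)) R :=
  (List.ofFn fun i : Fin g => ρ (i, false) * ρ (i, true) * (ρ (i, false)).adjugate * (ρ (i, true)).adjugate).prod

theorem adjW_map {R S : Type} [CommRing R] [CommRing S] (f : R →+* S) (ρ : Fin g × Bool → Matrix (Fin (c+1)) (Fin (c+1)) R) :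
    adjW (fun x => (ρ x).map f) = (adjW ρ).map f := by
  have h := map_list_prod (f.mapMatrix : Matrix (Fin (c+1)) (Fin (c+1)) R →+* _)
    (List.ofFn fun i : Fin g => ρ (i, false) * ρ (i, true) * (ρ (i, false)).adjugate * (ρ (i, true)).adjugate)
  rw [List.map_ofFn] at h
  rw [adjW, adjW]
  refine Eq.trans ?_ h.symm
  congr 2
  funext i
  simp only [Function.comp, map_mul, RingHom.map_adjugate]
  rfl

theorem adjW_eq {R : Type} [CommRing R] (ρ : Fin g × Bool → Matrix (Fin (c+1)) (Fin (c+1)) R) (hd : ∀ x, (ρ x).det = 1) :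
    adjW ρ = (List.ofFn fun i : Fin g => ρ (i, false) * ρ (i, true) * (ρ (i, false))⁻¹ * (ρ (i, true))⁻¹).prod := by
  rw [adjW]
  congr 2
  funext i
  rw [Matrix.inv_def, Matrix.inv_def, hd, hd]
  simp

theorem adjW_det {R : Type} [CommRing R] (ρ : Fin g × Bool → Matrix (Fin (c+1)) (Fin (c+1)) R) (hd : ∀ x, (ρ x).det = 1) :
    (adjW ρ).det = 1 := by
  rw [adjW]
  have h := map_list_prod (Matrix.detMonoidHom : Matrix (Fin (c+1)) (Fin (c+1)) R →* R)
    (List.ofFn fun i : Fin g => ρ (i, false) * ρ (i, true) * (ρ (i, false)).adjugate * (ρ (i, true)).adjugate)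
  refine Eq.trans h ?_
  rw [List.map_ofFn]
  apply List.prod_eq_one
  intro x hx
  rw [List.mem_ofFn] at hx
  obtain ⟨i, rfl⟩ := hx
  simp [Matrix.detMonoidHom, hd, Matrix.det_adjugate]

theorem eq_one_of_offlast {R : Type} [CommRing R] (M : Matrix (Fin (c+1)) (Fin (c+1)) R) (hd : M.det = 1)
    (h : ∀ i j, (i, j) ≠ (Fin.last c, Fin.last c) → M i j = (1 : Matrix (Fin (c+1)) (Fin (c+1)) R) i j) : M = 1 := by
  have hD : M = Matrix.diagonal (fun i => M i i) := by
    ext i j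
    by_cases hij : i = j
    · subst hij; simp
    · rw [Matrix.diagonal_apply_ne _ hij, h i j (by rintro ⟨⟩; exact hij rfl), Matrix.one_apply_ne hij]
  have hl : M (Fin.last c) (Fin.last c) = 1 := by
    rw [hD, Matrix.det_diagonal, Finset.prod_eq_single (Fin.last c)] at hd
    · exact hd
    · intro b _ hb
      rw [h b b (by intro hh; exact hb (Prod.ext_iff.mp hh).1), Matrix.one_apply_eq]
    · simp
  ext i j
  by_cases hij : (i, j) = (Fin.last c, Fin.last c)
  · obtain ⟨rfl, rfl⟩ := Prod.ext_iff.mp hij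
    rw [hl, Matrix.one_apply_eq]
  · exact h i j hij

/-- the index set of the defining equations -/
abbrev EqI (g c : ℕ) := (Fin g × Bool) ⊕ {p : Fin (c+1) × Fin (c+1) // p ≠ (Fin.last c, Fin.last c)}

theorem card_EqI : Fintype.card (EqI g c) = 2 * g + ((c+1)^2 - 1) := by
  rw [Fintype.card_sum, Fintype.card_subtype_compl]
  simp; ring_nf

/-- the equations -/
noncomputable def eqF (k : Type) [Field k] (g c : ℕ) : EqI g c → MvPolynomial ((Fin g × Bool) × Fin (c+1) × Fin (c+1)) k
  | Sum.inl x => (genM k g c x).det - 1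
  | Sum.inr p => adjW (genM k g c) p.1.1 p.1.2 - (1 : Matrix (Fin (c+1)) (Fin (c+1)) _) p.1.1 p.1.2

theorem genM_map {k T : Type} [Field k] [CommRing T] (f : MvPolynomial ((Fin g × Bool) × Fin (c+1) × Fin (c+1)) k →+* T)
    (ρ : Fin g × Bool → Matrix (Fin (c+1)) (Fin (c+1)) T) (h : ∀ p, f (X p) = ent ρ p) :
    (fun x => (genM k g c x).map f) = ρ := by
  funext x; ext i j
  exact h (x, i, j)

theorem eqF_map {k T : Type} [Field k] [CommRing T] (f : MvPolynomial ((Fin g × Bool) × Fin (c+1) × Fin (c+1)) k →+* T)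
    (ρ : Fin g × Bool → Matrix (Fin (c+1)) (Fin (c+1)) T) (h : ∀ p, f (X p) = ent ρ p) :
    (∀ e, f (eqF k g c e) = 0) ↔ (∀ x, (ρ x).det = 1) ∧ (GLr ρ) := by
  have hm := genM_map f ρ h
  have hx : ∀ x, f (genM k g c x).det = (ρ x).det := fun x => by
    rw [← hm, det_mapR]
  have hw : ∀ i j, f (adjW (genM k g c) i j) = adjW ρ i j := fun i j => by
    rw [← hm, adjW_map]; rfl
  have h1 : ∀ i j, f ((1 : Matrix (Fin (c+1)) (Fin (c+1)) _) i j) = (1 : Matrix (Fin (c+1)) (Fin (c+1)) T) i j := fun i j => by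
    simp [Matrix.one_apply, apply_ite f]
  constructor
  · intro he
    have hd : ∀ x, (ρ x).det = 1 := fun x => by
      have := he (Sum.inl x)
      simp only [eqF, map_sub, map_one, hx] at this
      exact sub_eq_zero.mp this
    refine ⟨hd, fun x => by rw [hd]; exact isUnit_one, ?_⟩
    rw [← adjW_eq ρ hd]
    apply eq_one_of_offlast _ (adjW_det ρ hd)
    intro i j hij
    have := he (Sum.inr ⟨(i, j), hij⟩)
    simp only [eqF, map_sub, h1, hw] at this
    exact sub_eq_zero.mp this
  · rintro ⟨hd, -, hW⟩
    rw [← adjW_eq ρ hd] at hW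
    rintro (x | p)
    · simp [eqF, hx, hd]
    · simp [eqF, hw, hW, h1]

theorem exists_generic {k : Type} [Field k] (ρ0 : Fin g × Bool → Matrix (Fin (c+1)) (Fin (c+1)) k)
    (hρ0 : ρ0 ∈ RepVariety g (c+1) k) :
    ∃ (L : Type) (_ : Field L) (_ : Algebra k L) (ρ : Fin g × Bool → Matrix (Fin (c+1)) (Fin (c+1)) L)
      (ι : Type) (_ : Fintype ι) (q : ι → MvPolynomial ((Fin g × Bool) × Fin (c+1) × Fin (c+1)) k),
      2 * g * (c+1)^2 ≤ Fintype.card ι + (2 * g + ((c+1)^2 - 1)) ∧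
      AlgebraicIndependent k (fun i => aeval (ent ρ) (q i)) ∧ (∀ x, (ρ x).det = 1) ∧ GLr ρ ∧
      ∀ P : MvPolynomial ((Fin g × Bool) × Fin (c+1) × Fin (c+1)) k, aeval (ent ρ) P = 0 → eval (ent ρ0) P = 0 := by
  classical
  let R := MvPolynomial ((Fin g × Bool) × Fin (c+1) × Fin (c+1)) k
  let s : Set R := Set.range (eqF k g c)
  let m : Ideal R := RingHom.ker (eval (ent ρ0))
  haveI : m.IsPrime := RingHom.ker_isPrime _
  have hs : s ⊆ m := by
    rintro _ ⟨e, rfl⟩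
    refine (eqF_map (eval (ent ρ0)) ρ0 (fun p => eval_X p)).mpr ⟨hρ0.1, fun x => ?_, hρ0.2⟩ e
    rw [hρ0.1]; exact isUnit_one
  have h1 := Ideal.height_le_height_add_encard_of_subset s hs
  have h2 := height_eval_ge (ent ρ0)
  have h3 : s.encard ≤ (2 * g + ((c+1)^2 - 1) : ℕ) := by
    rw [← card_EqI, ← ENat.card_eq_coe_fintype_card, ← Set.encard_univ]
    rw [show s = eqF k g c '' Set.univ from Set.image_univ.symm]
    exact Set.encard_image_le _ _
  let A := R ⧸ Ideal.span s
  have hsm : Ideal.span s ≤ m := Ideal.span_le.mpr hs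
  let m' : Ideal A := m.map (Ideal.Quotient.mk (Ideal.span s))
  haveI : m'.IsPrime := Ideal.map_isPrime_of_surjective Ideal.Quotient.mk_surjective (by rwa [Ideal.mk_ker])
  obtain ⟨N, hN, hN2⟩ : ∃ N : ℕ, (N : ℕ∞) ≤ m'.height ∧ 2 * g * (c+1)^2 ≤ N + (2 * g + ((c+1)^2 - 1)) := by
    have hcard : Fintype.card ((Fin g × Bool) × Fin (c+1) × Fin (c+1)) = 2 * g * (c+1)^2 := by
      simp; ring
    rw [hcard] at h2
    have h4 : ((2 * g * (c+1)^2 : ℕ) : ℕ∞) ≤ m'.height + (2 * g + ((c+1)^2 - 1) : ℕ) :=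
      h2.trans (h1.trans (by gcongr))
    refine ⟨2 * g * (c+1)^2 - (2 * g + ((c+1)^2 - 1)), ?_, by omega⟩
    cases hh : m'.height using ENat.recTopCoe with
    | top => exact le_top
    | coe a =>
      rw [hh] at h4
      norm_cast at h4 ⊢
      omega
  have e1 := PrimeSpectrum.height_eq_orderHeight (⟨m', inferInstance⟩ : PrimeSpectrum A)
  obtain ⟨l, hl1, hl2⟩ := Order.exists_series_of_le_height (⟨m', inferInstance⟩ : PrimeSpectrum A) (e1 ▸ hN)
  obtain ⟨ι, _, a, hc, ha⟩ := algIndep_of_chain (k := k) N l hl2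
  have hle : l.head.asIdeal ≤ m' := by
    have := l.head_le_last
    rw [hl1] at this
    exact this
  generalize l.head = p at ha hle
  let B := A ⧸ p.asIdeal
  let L := FractionRing B
  let f : R →ₐ[k] L := (IsScalarTower.toAlgHom k B L).comp ((Ideal.Quotient.mkₐ k p.asIdeal).comp (Ideal.Quotient.mkₐ k (Ideal.span s)))
  have hBL : Function.Injective (IsScalarTower.toAlgHom k B L) := IsFractionRing.injective B L
  let ρ : Fin g × Bool → Matrix (Fin (c+1)) (Fin (c+1)) L := fun x => Matrix.of fun i j => f (X (x, i, j))
  have hf : f = aeval (ent ρ) := by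
    ext1 p
    rw [aeval_X]; rfl
  have heq := (eqF_map f.toRingHom ρ (fun p => rfl)).mp (fun e => by
    have h0 : (Ideal.Quotient.mkₐ k (Ideal.span s) (eqF k g c e)) = 0 := Ideal.Quotient.eq_zero_iff_mem.mpr (Ideal.subset_span ⟨e, rfl⟩)
    have h00 : f (eqF k g c e) = 0 := by
      simp only [f, AlgHom.comp_apply]
      rw [h0, map_zero, map_zero]
    exact h00)
  choose q hq using fun i => Ideal.Quotient.mk_surjective (a i)
  refine ⟨L, inferInstance, inferInstance, ρ, ι, inferInstance, q, by rw [hc]; exact hN2, ?_, heq.1, heq.2, ?_⟩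
  · rw [← hf]
    have := ha.map' (f := IsScalarTower.toAlgHom k B L) hBL
    have e : (fun i => f (q i)) = (IsScalarTower.toAlgHom k B L : B → L) ∘ (fun i => Ideal.Quotient.mk p.asIdeal (a i)) := by
      funext i
      simp only [Function.comp, ← hq]
      rfl
    rw [e]
    exact this
  · intro P hP
    rw [← hf] at hP
    have h1 : Ideal.Quotient.mk p.asIdeal (Ideal.Quotient.mk (Ideal.span s) P) = 0 := hBL (by rw [map_zero]; exact hP)
    have h2 : Ideal.Quotient.mk (Ideal.span s) P ∈ m' := hle (Ideal.Quotient.eq_zero_iff_mem.mp h1)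
    have h3 := (Ideal.mem_quotient_iff_mem hsm).mp h2
    exact h3
end PartF

section PartF2
variable {g c : ℕ}

theorem exists_algclosed_indep (L σ : Type) [Field L] : ∃ (Ω : Type) (_ : Field Ω) (_ : Algebra L Ω) (_ : IsAlgClosed Ω)
    (s : σ → Ω), AlgebraicIndependent L s := by
  let S := MvPolynomial σ L
  let F := FractionRing S
  let Ω := AlgebraicClosure F
  refine ⟨Ω, inferInstance, ((algebraMap F Ω).comp ((algebraMap S F).comp (algebraMap L S))).toAlgebra, inferInstance,
    fun i => algebraMap F Ω (algebraMap S F (X i)), ?_⟩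
  letI : Algebra L Ω := ((algebraMap F Ω).comp ((algebraMap S F).comp (algebraMap L S))).toAlgebra
  let f : S →ₐ[L] Ω := { ((algebraMap F Ω).comp (algebraMap S F)) with commutes' := fun r => rfl }
  have hf : Function.Injective f := (algebraMap F Ω).injective.comp (IsFractionRing.injective S F)
  exact (MvPolynomial.algebraicIndependent_X σ L).map' (f := f) hf

theorem inv_smul_field {F m : Type} [Field F] [Fintype m] [DecidableEq m] (A : Matrix m m F) (hA : IsUnit A.det) (l : F) (hl : l ≠ 0) :
    (l • A)⁻¹ = l⁻¹ • A⁻¹ := by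
  apply Matrix.inv_eq_left_inv
  rw [Matrix.smul_mul, Matrix.mul_smul, smul_smul, inv_mul_cancel₀ hl, one_smul, Matrix.nonsing_inv_mul _ hA]

theorem comm_smul {F m : Type} [Field F] [Fintype m] [DecidableEq m] (A B : Matrix m m F) (hA : IsUnit A.det) (hB : IsUnit B.det)
    (l r : F) (hl : l ≠ 0) (hr : r ≠ 0) :
    (l • A) * (r • B) * (l • A)⁻¹ * (r • B)⁻¹ = A * B * A⁻¹ * B⁻¹ := by
  rw [inv_smul_field A hA l hl, inv_smul_field B hB r hr]
  simp only [Matrix.smul_mul, Matrix.mul_smul, smul_smul]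
  have : r⁻¹ * (l⁻¹ * (r * l)) = 1 := by field_simp
  rw [this, one_smul]

theorem GLr.smul {F m : Type} [Field F] [Fintype m] [DecidableEq m] {ρ : Fin g × Bool → Matrix m m F} (h : GLr ρ)
    (l : Fin g × Bool → F) (hl : ∀ x, l x ≠ 0) : GLr (fun x => l x • ρ x) := by
  refine ⟨fun x => ?_, ?_⟩
  · rw [Matrix.det_smul]
    exact (isUnit_iff_ne_zero.mpr (pow_ne_zero _ (hl x))).mul (h.1 x)
  · rw [← h.2]
    congr 2
    funext i
    exact comm_smul _ _ (h.1 _) (h.1 _) _ _ (hl _) (hl _)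

theorem deriv_det {k Ω : Type} [Field k] [Field Ω] [Algebra k Ω] (ρ : Fin g × Bool → Matrix (Fin (c+1)) (Fin (c+1)) Ω)
    (D : Derivation k Ω Ω) (hD : ∀ p, D (ent ρ p) = 0) (x) : D (ρ x).det = 0 := by
  have h := deriv_aeval_eq_zero (ent ρ) D hD (genM k g c x).det
  have e := genM_map (aeval (R := k) (ent ρ)).toRingHom ρ (fun p => aeval_X _ p)
  rw [← e, det_mapR]
  exact h

theorem generic_side {k : Type} [Field k] [CharZero k] (hg : 2 ≤ g) (i0 : Fin g)
    (ρ0 : Fin g × Bool → Matrix (Fin (c+1)) (Fin (c+1)) k) (hρ0 : ρ0 ∈ RepVariety g (c+1) k) :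
    ∃ (Ω : Type) (_ : Field Ω) (_ : Algebra k Ω) (_ : IsAlgClosed Ω)
      (ρ : Fin g × Bool → Matrix (Fin (c+1)) (Fin (c+1)) Ω) (l : Fin g × Bool → Ω),
      (∀ x, (ρ x).det = 1) ∧ (∀ x, l x ≠ 0) ∧ GLr (fun x => l x • ρ x) ∧
      Gd (l (i0, false) • ρ (i0, false)) (l (i0, true) • ρ (i0, true)) ≠ 0 ∧
      AlgebraicIndependent k (params i0 (fun x => l x • ρ x)) ∧
      ∀ P : MvPolynomial ((Fin g × Bool) × Fin (c+1) × Fin (c+1)) k, aeval (ent ρ) P = 0 → eval (ent ρ0) P = 0 := by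
  obtain ⟨L, _, _, ρ', ι, _, q, hcard, hq, hdet, hGL, hP⟩ := exists_generic ρ0 hρ0
  obtain ⟨Ω, _, _, hac, s, hs⟩ := exists_algclosed_indep L ((Fin g × Bool) ⊕ ℕ)
  letI : Algebra k Ω := ((algebraMap L Ω).comp (algebraMap k L)).toAlgebra
  haveI : IsScalarTower k L Ω := IsScalarTower.of_algebraMap_eq (fun x => rfl)
  haveI : CharZero L := charZero_of_injective_algebraMap (algebraMap k L).injective
  let ρ : Fin g × Bool → Matrix (Fin (c+1)) (Fin (c+1)) Ω := fun x => (ρ' x).map (algebraMap L Ω)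
  let l : Fin g × Bool → Ω := fun x => s (Sum.inl x)
  have hl : AlgebraicIndependent L l := hs.comp _ Sum.inl_injective
  have hl0 : ∀ x, l x ≠ 0 := fun x => hl.ne_zero x
  have hd : ∀ x, (ρ x).det = 1 := fun x => by simp only [ρ]; rw [det_mapR, hdet, map_one]
  have hG1 : GLr ρ := hGL.map (algebraMap L Ω)
  have hG2 : GLr (fun x => l x • ρ x) := hG1.smul l hl0
  have hent : ent ρ = fun p => algebraMap L Ω (ent ρ' p) := rfl
  have haev : ∀ P : MvPolynomial ((Fin g × Bool) × Fin (c+1) × Fin (c+1)) k, aeval (ent ρ) P = algebraMap L Ω (aeval (ent ρ') P) := by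
    intro P
    rw [hent, ← MvPolynomial.aeval_algebraMap_apply]; rfl
  have hrk : (2 * g - 1) * (c+1)^2 + 1 ≤ rk k (ent (fun x => l x • ρ x)) := by
    have h1 := card_le_rk (k := k) (ent (fun x => l x • ρ x)) (Sum.elim l (fun i => algebraMap L Ω (aeval (ent ρ') (q i))))
      (hq.sumElim_comp hl) (by
        intro D hD
        have hlD : ∀ x, D (l x) = 0 := by
          intro x
          have e : (l x • ρ x).det = (l x)^(c+1) := by
            rw [Matrix.det_smul, hd, mul_one, Fintype.card_fin]
          have h2 : D ((l x • ρ x).det) = 0 := by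
            exact deriv_det (fun x => l x • ρ x) D hD x
          rw [e, Derivation.leibniz_pow] at h2
          simp only [Nat.add_sub_cancel, smul_eq_mul, nsmul_eq_mul] at h2
          have h3 : ((c + 1 : ℕ) : Ω) ≠ 0 := by
            haveI : CharZero Ω := charZero_of_injective_algebraMap (algebraMap k Ω).injective
            exact Nat.cast_ne_zero.mpr (Nat.succ_ne_zero c)
          exact ((mul_eq_zero.mp h2).resolve_left h3 |> mul_eq_zero.mp).resolve_left (pow_ne_zero _ (hl0 x))
        rintro (x | i)
        · exact hlD x
        · simp only [Sum.elim_inr]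
          rw [← haev]
          apply deriv_aeval_eq_zero
          rintro ⟨x, i, j⟩
          have := hD (x, i, j)
          simp only [ent, Matrix.smul_apply, smul_eq_mul, Derivation.leibniz, hlD, mul_zero, add_zero] at this
          exact (mul_eq_zero.mp this).resolve_left (hl0 x))
    refine le_trans ?_ h1
    simp only [Fintype.card_sum, Fintype.card_prod, Fintype.card_fin, Fintype.card_bool]
    have : (2 * g - 1) * (c+1)^2 = 2 * g * (c+1)^2 - (c+1)^2 := by rw [Nat.sub_mul, one_mul]
    have : (c+1)^2 ≤ 2 * g * (c+1)^2 := Nat.le_mul_of_pos_left _ (by omega)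
    have : 0 < (c+1)^2 := by positivity
    omega
  have hGd := generic_main hg hG2 ⟨fun i => s (Sum.inr i), fun v => by
    obtain ⟨D, hD⟩ := exists_derivation hs (Sum.elim (fun _ => 0) v)
    refine ⟨D.restrictScalars k, fun b => ?_, fun i => hD (Sum.inr i)⟩
    ext i j
    have h1 : D (l b) = 0 := hD (Sum.inl b)
    change D (l b * algebraMap L Ω (ρ' b i j)) = 0
    rw [Derivation.leibniz, Derivation.map_algebraMap, h1]
    simp⟩ hrk
  refine ⟨Ω, inferInstance, inferInstance, hac, ρ, l, hd, hl0, hG2, hGd i0, generic_params hg hG2 hGd hrk i0, ?_⟩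
  intro P h
  rw [haev] at h
  exact hP P ((algebraMap L Ω).injective (by rw [h, map_zero]))
end PartF2

section PartG
variable {g c : ℕ}

theorem real_generic {k K : Type} [Field k] [CharZero k] [Field K] [Algebra k K] (hg : 2 ≤ g) (i0 : Fin g)
    {ρ : Fin g × Bool → Matrix (Fin (c+1)) (Fin (c+1)) K} (h : GLr ρ) {ι : Type} [Fintype ι]
    (q : ι → MvPolynomial ((Fin g × Bool) × Fin (c+1) × Fin (c+1)) k)
    (hc : (2 * g - 1) * (c+1)^2 + 1 ≤ Fintype.card ι) (hq : AlgebraicIndependent k (fun i => aeval (ent ρ) (q i))) :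
    (∀ i, Gd (ρ (i, false)) (ρ (i, true)) ≠ 0) ∧ AlgebraicIndependent k (params i0 ρ) := by
  obtain ⟨Ω, _, _, hac, s, hs⟩ := exists_algclosed_indep K ℕ
  letI : Algebra k Ω := ((algebraMap K Ω).comp (algebraMap k K)).toAlgebra
  haveI : IsScalarTower k K Ω := IsScalarTower.of_algebraMap_eq (fun x => rfl)
  haveI : CharZero K := charZero_of_injective_algebraMap (algebraMap k K).injective
  let σ : Fin g × Bool → Matrix (Fin (c+1)) (Fin (c+1)) Ω := fun x => (ρ x).map (algebraMap K Ω)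
  have hσ : GLr σ := h.map (algebraMap K Ω)
  have haev : ∀ P : MvPolynomial ((Fin g × Bool) × Fin (c+1) × Fin (c+1)) k, aeval (ent σ) P = algebraMap K Ω (aeval (ent ρ) P) := by
    intro P
    rw [← MvPolynomial.aeval_algebraMap_apply]; rfl
  have hrk : (2 * g - 1) * (c+1)^2 + 1 ≤ rk k (ent σ) := by
    refine hc.trans (card_le_rk (k := k) (ent σ) (fun i => aeval (ent σ) (q i)) ?_ ?_)
    · simp only [haev]
      exact hq.map' (f := IsScalarTower.toAlgHom k K Ω) (algebraMap K Ω).injective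
    · intro D hD j
      exact deriv_aeval_eq_zero _ D hD _
  have hGd := generic_main hg hσ ⟨s, fun v => by
    obtain ⟨D, hD⟩ := exists_derivation hs v
    refine ⟨D.restrictScalars k, fun b => ?_, fun i => hD i⟩
    ext i j
    change D (algebraMap K Ω (ρ b i j)) = 0
    rw [Derivation.map_algebraMap]⟩ hrk
  have hp := generic_params hg hσ hGd hrk i0
  constructor
  · intro i hi
    apply hGd i
    simp only [σ, Gd_map, hi, map_zero]
  · have e : params i0 σ = (IsScalarTower.toAlgHom k K Ω) ∘ params i0 ρ := rfl
    rw [e] at hp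
    exact hp.of_comp

theorem transfer {k : Type} [Field k] [CharZero k] [Algebra k ℂ] (hg : 2 ≤ g)
    (ρ0 : Fin g × Bool → Matrix (Fin (c+1)) (Fin (c+1)) k) (hρ0 : ρ0 ∈ RepVariety g (c+1) k)
    (ρ' : Fin g × Bool → Matrix (Fin (c+1)) (Fin (c+1)) ℂ) (m : Fin g × Bool → ℂ)
    (hd : ∀ x, (ρ' x).det = 1) (hm : ∀ x, m x ≠ 0) (hGL : GLr (fun x => m x • ρ' x))
    {ι : Type} [Fintype ι] (q : ι → MvPolynomial ((Fin g × Bool) × Fin (c+1) × Fin (c+1)) k)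
    (hc : (2 * g - 1) * (c+1)^2 + 1 ≤ Fintype.card ι)
    (hq : AlgebraicIndependent k (fun i => aeval (ent (fun x => m x • ρ' x)) (q i)))
    (P : MvPolynomial ((Fin g × Bool) × Fin (c+1) × Fin (c+1)) k)
    (hP : ∀ z : Fin g × Bool → ℂ, (∀ x, z x ^ (c+1) = 1) → aeval (ent (fun x => z x • ρ' x)) P = 0) :
    eval (ent ρ0) P = 0 := by
  let i0 : Fin g := ⟨0, by omega⟩
  obtain ⟨hG2, ha2⟩ := real_generic hg i0 hGL q hc hq
  obtain ⟨Ω, _, _, hac, ρ, l, hdet, hl, hGL1, hG1, ha1, hfin⟩ := generic_side hg i0 ρ0 hρ0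
  obtain ⟨E, φ, hEc, hE, hφ⟩ := iso_lemma i0 hGL1 hGL hG1 (hG2 i0) ha1 ha2
  apply hfin
  have hpow : ∀ t : ℂ, t ^ (c+1) ∈ E → t ∈ E := by
    intro t ht
    apply hEc
    refine ⟨Polynomial.X ^ (c+1) - Polynomial.C ⟨_, ht⟩, Polynomial.X_pow_sub_C_ne_zero (Nat.succ_pos c) _, ?_⟩
    simp
  let σ : Fin g × Bool → Matrix (Fin (c+1)) (Fin (c+1)) E := fun x => Matrix.of fun i j => ⟨ent (fun x => m x • ρ' x) (x, i, j), hE _⟩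
  have hσ1 : ∀ x, (σ x).map (algebraMap E ℂ) = m x • ρ' x := fun x => rfl
  have hσ2 : ∀ x, (σ x).map φ.toRingHom = l x • ρ x := fun x => by
    ext i j
    exact hφ (x, i, j)
  have hdm : ∀ x, algebraMap E ℂ (σ x).det = m x ^ (c+1) := fun x => by
    rw [← det_mapR, hσ1, Matrix.det_smul, hd, mul_one, Fintype.card_fin]
  have hmE : ∀ x, m x ∈ E := fun x => hpow _ (by rw [← hdm]; exact (σ x).det.2)
  let m' : Fin g × Bool → E := fun x => ⟨m x, hmE x⟩
  have hm'0 : ∀ x, m' x ≠ 0 := fun x h => hm x (congrArg (algebraMap E ℂ) h)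
  have hm' : ∀ x, m' x ^ (c+1) = (σ x).det := fun x => (algebraMap E ℂ).injective (by rw [hdm, map_pow]; rfl)
  have hφm : ∀ x, φ (m' x) ^ (c+1) = l x ^ (c+1) := fun x => by
    rw [← map_pow, hm']
    have : φ.toRingHom (σ x).det = l x ^ (c+1) := by
      rw [← det_mapR, hσ2, Matrix.det_smul, hdet, mul_one, Fintype.card_fin]
    exact this
  have hω := Complex.isPrimitiveRoot_exp (c+1) (Nat.succ_ne_zero c)
  set ω := Complex.exp (2 * Real.pi * Complex.I / (c+1 : ℕ)) with hωdef
  have hωE : ω ∈ E := hpow _ (by rw [hω.pow_eq_one]; exact one_mem E)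
  let w : E := ⟨ω, hωE⟩
  have hw : IsPrimitiveRoot w (c+1) := IsPrimitiveRoot.of_map_of_injective (f := algebraMap E ℂ) hω (algebraMap E ℂ).injective
  have hφw : IsPrimitiveRoot (φ w) (c+1) := hw.map_of_injective (f := φ) φ.toRingHom.injective
  have hex : ∀ x, ∃ j : ℕ, φ (w ^ j) * l x = φ (m' x) := fun x => by
    have : (φ (m' x) / l x) ^ (c+1) = 1 := by
      rw [div_pow, hφm, div_self (pow_ne_zero _ (hl x))]
    obtain ⟨j, -, hj⟩ := hφw.eq_pow_of_pow_eq_one this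
    exact ⟨j, by rw [map_pow, hj, div_mul_cancel₀ _ (hl x)]⟩
  choose j hj using hex
  have h0 := hP (fun x => ω ^ j x) (fun x => by rw [← pow_mul, mul_comm, pow_mul, hω.pow_eq_one, one_pow])
  let τ : Fin g × Bool → Matrix (Fin (c+1)) (Fin (c+1)) E := fun x => (w ^ j x * (m' x)⁻¹) • σ x
  have hτ1 : ent (fun x => ω ^ j x • ρ' x) = fun p => (IsScalarTower.toAlgHom k E ℂ) (ent τ p) := by
    funext ⟨x, a, b⟩
    simp only [ent, τ, Matrix.smul_apply, smul_eq_mul, map_mul, map_pow, map_inv₀]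
    change ω ^ j x * ρ' x a b = ω ^ j x * (m x)⁻¹ * (m x * ρ' x a b)
    rw [mul_assoc, inv_mul_cancel_left₀ (hm x)]
  have hτ2 : ent ρ = fun p => φ (ent τ p) := by
    funext ⟨x, a, b⟩
    simp only [ent, τ, Matrix.smul_apply, smul_eq_mul, map_mul, map_inv₀]
    have h1 : φ (σ x a b) = l x * ρ x a b := hφ (x, a, b)
    rw [h1, ← hj]
    have h2 : φ (w ^ j x) ≠ 0 := by
      rw [map_pow]; exact pow_ne_zero _ (hφw.ne_zero (Nat.succ_ne_zero c))
    have h3 := hl x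
    field_simp
  rw [hτ1] at h0
  rw [hτ2]
  have e1 := MvPolynomial.comp_aeval (R := k) (ent τ) (IsScalarTower.toAlgHom k E ℂ)
  have e2 := MvPolynomial.comp_aeval (R := k) (ent τ) φ
  rw [← e1, AlgHom.comp_apply] at h0
  rw [← e2, AlgHom.comp_apply]
  have : aeval (ent τ) P = 0 := (algebraMap E ℂ).injective (by rw [map_zero]; exact h0)
  rw [this, map_zero]
end PartG

section PartH
variable {g c : ℕ}

theorem exists_root_mat {F : Type} [Field F] [IsAlgClosed F] (B : Matrix (Fin (c+1)) (Fin (c+1)) F) (hK : (Kry B).det ≠ 0)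
    (hH : (Hk B).det ≠ 0) (y : F) (hy : y ^ (c+1) = 1) :
    ∃ f : Matrix (Fin (c+1)) (Fin (c+1)) F, f * B = B * f ∧ f.det = y ∧ f ^ (c+1) = 1 := by
  obtain ⟨α, hα⟩ := IsAlgClosed.exists_root B.charpoly (by
    rw [Matrix.charpoly_degree_eq_dim, Fintype.card_fin]; exact_mod_cast Nat.succ_ne_zero c)
  rw [Polynomial.IsRoot, Matrix.eval_charpoly] at hα
  obtain ⟨v, hv0, hv⟩ := Matrix.exists_mulVec_eq_zero_iff.mpr hα
  obtain ⟨u, hu0, hu⟩ := Matrix.exists_vecMul_eq_zero_iff.mpr hα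
  have hBv : B *ᵥ v = α • v := by
    rw [Matrix.sub_mulVec, sub_eq_zero] at hv
    rw [← hv]; simp
  have hBu : u ᵥ* B = α • u := by
    rw [Matrix.vecMul_sub, sub_eq_zero] at hu
    rw [← hu]
    ext i
    simp [Matrix.vecMul_diagonal, mul_comm]
  have hN1 : Matrix.vecMulVec v u * B = α • Matrix.vecMulVec v u := by
    rw [Matrix.vecMulVec_mul, hBu, Matrix.vecMulVec_smul]
  have hN2 : B * Matrix.vecMulVec v u = α • Matrix.vecMulVec v u := by
    rw [Matrix.mul_vecMulVec, hBv, Matrix.smul_vecMulVec]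
  have huv : v ⬝ᵥ u ≠ 0 := by
    intro h0
    let p := (Kry B)⁻¹ *ᵥ (Matrix.vecMulVec v u *ᵥ Pi.single 0 1)
    have hp : Kry B *ᵥ p = Matrix.vecMulVec v u *ᵥ Pi.single 0 1 := by
      simp only [p]
      rw [Matrix.mulVec_mulVec, Matrix.mul_nonsing_inv _ (isUnit_iff_ne_zero.mpr hK), Matrix.one_mulVec]
    have hY : Matrix.vecMulVec v u - ∑ k : Fin (c+1), p k • B ^ (k : ℕ) = 0 := by
      apply kry_commute (isUnit_iff_ne_zero.mpr hK)
      · rw [Matrix.sub_mul, Matrix.mul_sub, hN1, hN2, Finset.sum_mul, Finset.mul_sum]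
        congr 1
        refine Finset.sum_congr rfl fun k _ => ?_
        rw [Matrix.smul_mul, Matrix.mul_smul, ← pow_succ, ← pow_succ']
      · rw [Matrix.sub_mulVec, ← hp, sub_eq_zero]
        ext i
        simp only [Matrix.mulVec, dotProduct, Kry, Matrix.of_apply, Matrix.sum_apply, Matrix.smul_apply, smul_eq_mul]
        simp [Pi.single_apply, mul_comm]
    have hNp : ∀ j : ℕ, (Matrix.vecMulVec v u * B ^ j) = α ^ j • Matrix.vecMulVec v u := by
      intro j
      induction j with
      | zero => simp
      | succ j ih => rw [pow_succ, ← Matrix.mul_assoc, ih, Matrix.smul_mul, hN1, smul_smul, pow_succ]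
    have hHp : Hk B *ᵥ p = 0 := by
      ext j
      have h1 : (Matrix.vecMulVec v u * B ^ (j : ℕ)).trace = 0 := by
        rw [hNp, Matrix.trace_smul, Matrix.trace_vecMulVec, h0, smul_zero]
      rw [sub_eq_zero.mp hY, Finset.sum_mul, Matrix.trace_sum] at h1
      simp only [Matrix.smul_mul, Matrix.trace_smul, ← pow_add, smul_eq_mul] at h1
      simp only [Matrix.mulVec, dotProduct, Hk, Matrix.of_apply, Pi.zero_apply]
      rw [← h1]
      exact Finset.sum_congr rfl fun k _ => by rw [mul_comm, add_comm (j : ℕ) (k : ℕ)]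
    have hp0 : p = 0 := by
      by_contra hne
      exact hH (Matrix.exists_mulVec_eq_zero_iff.mp ⟨p, hne, hHp⟩)
    have := sub_eq_zero.mp hY
    rw [hp0] at this
    simp only [Pi.zero_apply, zero_smul, Finset.sum_const_zero] at this
    rcases Matrix.vecMulVec_eq_zero.mp this with h | h
    · exact hv0 h
    · exact hu0 h
  let t := (y - 1) * (v ⬝ᵥ u)⁻¹
  refine ⟨1 + t • Matrix.vecMulVec v u, ?_, ?_, ?_⟩
  · rw [Matrix.add_mul, Matrix.mul_add, Matrix.smul_mul, Matrix.mul_smul, hN1, hN2, Matrix.one_mul, Matrix.mul_one]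
  · have e : t • Matrix.vecMulVec v u = replicateCol Unit (t • v) * replicateRow Unit u := by
      rw [← Matrix.vecMulVec_eq, Matrix.smul_vecMulVec]
    rw [e, Matrix.det_one_add_replicateCol_mul_replicateRow, dotProduct_smul, dotProduct_comm]
    simp only [t, smul_eq_mul]
    field_simp; ring
  · have h1 : ∀ k : ℕ, (1 + t • Matrix.vecMulVec v u) ^ k = 1 + ((y ^ k - 1) * (v ⬝ᵥ u)⁻¹) • Matrix.vecMulVec v u := by
      intro k
      induction k with
      | zero => simp
      | succ k ih =>
        rw [pow_succ, ih]
        simp only [add_mul, mul_add, one_mul, mul_one, Matrix.smul_mul, Matrix.mul_smul, Matrix.vecMulVec_mul_vecMulVec,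
          Matrix.vecMulVec_smul, smul_smul]
        rw [add_assoc, ← add_smul, ← add_smul, dotProduct_comm u v]
        congr 2
        simp only [t]
        field_simp; ring
    rw [h1, hy]; simp

theorem real_path {B : Matrix (Fin (c+1)) (Fin (c+1)) ℝ} (hK : (Kry B).det ≠ 0)
    (hH : (Hk B).det ≠ 0) (y : ℂ) (hy : y ^ (c+1) = 1) :
    ∃ a b : Matrix (Fin (c+1)) (Fin (c+1)) ℝ, a * B = B * a ∧ b * B = B * b ∧
      (1 + Complex.I • b.map (algebraMap ℝ ℂ) - (Complex.I)^2 • a.map (algebraMap ℝ ℂ)).det = y ∧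
      (1 + Complex.I • b.map (algebraMap ℝ ℂ) - (Complex.I)^2 • a.map (algebraMap ℝ ℂ)) ^ (c+1) = 1 := by
  obtain ⟨f, h1, h2, h3⟩ := exists_root_mat (B.map (algebraMap ℝ ℂ)) (by
    rw [Kry_map, det_mapR]; simpa using hK) (by rw [Hk_map, det_mapR]; simpa using hH) y hy
  have e : 1 + Complex.I • ((f - 1).map Complex.im).map (algebraMap ℝ ℂ) - (Complex.I)^2 • ((f-1).map Complex.re).map (algebraMap ℝ ℂ) = f := by
    ext i j
    simp only [Matrix.sub_apply, Matrix.add_apply, Matrix.smul_apply, Matrix.map_apply, Complex.I_sq, smul_eq_mul]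
    have := Complex.re_add_im ((f - 1) i j)
    simp only [Matrix.sub_apply] at this ⊢
    simp only [Complex.coe_algebraMap]
    linear_combination this
  have hc : (f - 1) * B.map (algebraMap ℝ ℂ) = B.map (algebraMap ℝ ℂ) * (f - 1) := by
    rw [sub_mul, mul_sub, h1, one_mul, mul_one]
  refine ⟨(f-1).map Complex.re, (f-1).map Complex.im, ?_, ?_, by rw [e, h2], by rw [e, h3]⟩
  · ext i j
    have := congrArg Complex.re (congrFun (congrFun hc i) j)
    simpa [Matrix.mul_apply, Complex.re_sum] using this
  · ext i j
    have := congrArg Complex.im (congrFun (congrFun hc i) j)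
    simpa [Matrix.mul_apply, Complex.im_sum] using this

theorem clear_denoms {σ K : Type} [Field K] (P : MvPolynomial σ K) (N : σ → Polynomial K) (d : Polynomial K) :
    ∃ (k : ℕ) (G : Polynomial K), ∀ w : K, d.eval w ≠ 0 → (d.eval w) ^ k * eval (fun p => (N p).eval w / d.eval w) P = G.eval w := by
  induction P using MvPolynomial.induction_on with
  | C a => exact ⟨0, Polynomial.C a, fun w _ => by simp⟩
  | add p q hp hq =>
    obtain ⟨k, G, hG⟩ := hp
    obtain ⟨k', G', hG'⟩ := hq
    refine ⟨k + k', d ^ k' * G + d ^ k * G', fun w hw => ?_⟩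
    simp only [map_add, Polynomial.eval_add, Polynomial.eval_mul, Polynomial.eval_pow, ← hG w hw, ← hG' w hw]
    ring
  | mul_X p i hp =>
    obtain ⟨k, G, hG⟩ := hp
    refine ⟨k + 1, G * N i, fun w hw => ?_⟩
    simp only [map_mul, eval_X, Polynomial.eval_mul, ← hG w hw]
    field_simp
    ring
end PartH

section PartH2
variable {g c : ℕ}

theorem rep_update {K : Type} [Field K] {n : ℕ} {ρ : Fin g × Bool → Matrix (Fin n) (Fin n) K} (h : ρ ∈ RepVariety g n K)
    (x : Fin g × Bool) (Z : Matrix (Fin n) (Fin n) K) (hZ : Z.det = 1) (hc : Z * ρ (x.1, !x.2) = ρ (x.1, !x.2) * Z) :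
    Function.update ρ x (ρ x * Z) ∈ RepVariety g n K := by
  classical
  refine ⟨fun y => ?_, ?_⟩
  · by_cases hy : y = x
    · subst hy; simp [hZ, h.1]
    · rw [Function.update_of_ne hy]; exact h.1 y
  · rw [← h.2]
    congr 2
    funext i
    have hZu : IsUnit Z.det := by rw [hZ]; exact isUnit_one
    obtain ⟨i', b⟩ := x
    by_cases hi : i = i'
    · subst hi
      cases b
      · have hB : IsUnit (ρ (i, true)).det := by rw [h.1]; exact isUnit_one
        simp only [Bool.not_false] at hc
        rw [Function.update_self, Function.update_of_ne (by simp), Matrix.mul_inv_rev]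
        have : ρ (i, false) * Z * ρ (i, true) * (Z⁻¹ * (ρ (i, false))⁻¹) = ρ (i, false) * ρ (i, true) * (ρ (i, false))⁻¹ := by
          rw [Matrix.mul_assoc (ρ (i, false)), hc]
          simp only [Matrix.mul_assoc]
          rw [Matrix.mul_nonsing_inv_cancel_left _ _ hZu]
        rw [this]
      · have hB : IsUnit (ρ (i, false)).det := by rw [h.1]; exact isUnit_one
        simp only [Bool.not_true] at hc
        rw [Function.update_self, Function.update_of_ne (by simp), Matrix.mul_inv_rev]
        have : ρ (i, true) * Z * (ρ (i, false))⁻¹ * (Z⁻¹ * (ρ (i, true))⁻¹) = ρ (i, true) * (ρ (i, false))⁻¹ * (ρ (i, true))⁻¹ := by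
          have h2 : Z * (ρ (i, false))⁻¹ * Z⁻¹ = (ρ (i, false))⁻¹ := by
            have : Z * (ρ (i, false))⁻¹ = (ρ (i, false))⁻¹ * Z := by
              calc Z * (ρ (i, false))⁻¹ = (ρ (i, false))⁻¹ * (ρ (i, false) * Z) * (ρ (i, false))⁻¹ := by
                    rw [Matrix.nonsing_inv_mul_cancel_left _ _ hB]
                _ = (ρ (i, false))⁻¹ * Z := by
                    rw [← hc, ← Matrix.mul_assoc, Matrix.mul_nonsing_inv_cancel_right _ _ hB]
            rw [this, Matrix.mul_nonsing_inv_cancel_right _ _ hZu]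
          calc _ = ρ (i, true) * (Z * (ρ (i, false))⁻¹ * Z⁻¹) * (ρ (i, true))⁻¹ := by simp only [Matrix.mul_assoc]
            _ = _ := by rw [h2]
        calc _ = ρ (i, false) * (ρ (i, true) * Z * (ρ (i, false))⁻¹ * (Z⁻¹ * (ρ (i, true))⁻¹)) := by simp only [Matrix.mul_assoc]
            _ = _ := by rw [this]; simp only [Matrix.mul_assoc]
    · rw [Function.update_of_ne (by intro hh; exact hi (Prod.ext_iff.mp hh).1), Function.update_of_ne (by intro hh; exact hi (Prod.ext_iff.mp hh).1)]

/-- simple points -/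
def Smp (ρ : Fin g × Bool → Matrix (Fin (c+1)) (Fin (c+1)) ℝ) : Prop := ∀ x, (Kry (ρ x)).det ≠ 0 ∧ (Hk (ρ x)).det ≠ 0

theorem continuous_Kry : Continuous (fun B : Matrix (Fin (c+1)) (Fin (c+1)) ℝ => (Kry B).det) := by
  apply Continuous.matrix_det
  apply continuous_matrix
  intro i j
  simp only [Kry, Matrix.of_apply]
  exact (continuous_pow (j : ℕ)).matrix_elem i 0

theorem continuous_Hk : Continuous (fun B : Matrix (Fin (c+1)) (Fin (c+1)) ℝ => (Hk B).det) := by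
  apply Continuous.matrix_det
  apply continuous_matrix
  intro i j
  simp only [Hk, Matrix.of_apply]
  exact (continuous_pow _).matrix_trace

theorem real_flow {T ρ : Fin g × Bool → Matrix (Fin (c+1)) (Fin (c+1)) ℝ} (h : ρ ∈ HIT g (c+1) T) (hS : Smp ρ)
    (x : Fin g × Bool) (f : ℝ → Matrix (Fin (c+1)) (Fin (c+1)) ℝ) (hf : Continuous f) (hf0 : f 0 = 1)
    (hc : ∀ w, f w * ρ (x.1, !x.2) = ρ (x.1, !x.2) * f w) :
    ∃ ε > 0, ∀ w, |w| < ε → (f w).det ≠ 0 ∧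
      Function.update ρ x (ρ x * ((f w).det⁻¹ • f w ^ (c+1))) ∈ HIT g (c+1) T ∧
      Smp (Function.update ρ x (ρ x * ((f w).det⁻¹ • f w ^ (c+1)))) := by
  classical
  have hρ : ρ ∈ RepVariety g (c+1) ℝ := connectedComponentIn_subset _ _ h
  let U : Set ℝ := {w | (f w).det ≠ 0}
  have hU : IsOpen U := (hf.matrix_det).isOpen_preimage _ isOpen_ne
  let M : ℝ → Matrix (Fin (c+1)) (Fin (c+1)) ℝ := fun w => ρ x * ((f w).det⁻¹ • f w ^ (c+1))
  have hM : ContinuousOn M U := by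
    apply ContinuousOn.mul continuousOn_const
    exact ContinuousOn.smul (f := fun w => (f w).det⁻¹) (g := fun w => f w ^ (c+1))
      (ContinuousOn.inv₀ hf.matrix_det.continuousOn (fun w hw => hw)) (hf.pow _).continuousOn
  let V : Set ℝ := {w | w ∈ U ∧ (Kry (M w)).det ≠ 0 ∧ (Hk (M w)).det ≠ 0}
  have hV : IsOpen V := by
    have h1 := (continuous_Kry.comp_continuousOn hM).isOpen_inter_preimage hU (isOpen_ne (x := (0:ℝ)))
    have h2 := (continuous_Hk.comp_continuousOn hM).isOpen_inter_preimage hU (isOpen_ne (x := (0:ℝ)))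
    convert h1.inter h2 using 1
    ext w
    simp only [V, Set.mem_setOf_eq, Set.mem_inter_iff, Set.mem_preimage, Function.comp]
    tauto
  have hM0 : M 0 = ρ x := by simp [M, hf0]
  have h0 : (0:ℝ) ∈ V := by
    refine ⟨?_, ?_, ?_⟩
    · simp [U, hf0]
    · rw [hM0]; exact (hS x).1
    · rw [hM0]; exact (hS x).2
  obtain ⟨ε, hε, hball⟩ := Metric.isOpen_iff.mp hV 0 h0
  have hin : ∀ w, |w| < ε → w ∈ Metric.ball (0:ℝ) ε := fun w hw => by simpa using hw
  have hsub : (fun w => Function.update ρ x (M w)) '' Metric.ball (0:ℝ) ε ⊆ HIT g (c+1) T := by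
    unfold HIT
    rw [connectedComponentIn_eq h]
    apply IsPreconnected.subset_connectedComponentIn
    · apply IsPreconnected.image
      · exact (convex_ball 0 ε).isPreconnected
      · rw [continuousOn_pi]
        intro y
        by_cases hy : y = x
        · subst hy
          simp only [Function.update_self]
          exact hM.mono (fun w hw => (hball hw).1)
        · simp only [Function.update_of_ne hy]
          exact continuousOn_const
    · exact ⟨0, by simpa using hε, by simp [hM0]⟩
    · rintro _ ⟨w, hw, rfl⟩
      have hd : (f w).det ≠ 0 := (hball hw).1
      apply rep_update hρ
      · rw [Matrix.det_smul, Matrix.det_pow, Fintype.card_fin, ← mul_pow, inv_mul_cancel₀ hd, one_pow]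
      · rw [Matrix.smul_mul, Matrix.mul_smul]
        congr 1
        exact Commute.pow_left (show Commute (f w) _ from hc w) _
  refine ⟨ε, hε, fun w hw => ⟨(hball (hin w hw)).1, hsub ⟨w, hin w hw, rfl⟩, fun y => ?_⟩⟩
  by_cases hy : y = x
  · subst hy
    rw [Function.update_self]
    exact (hball (hin w hw)).2
  · rw [Function.update_of_ne hy]; exact hS y

theorem zeta_step {T : Fin g × Bool → Matrix (Fin (c+1)) (Fin (c+1)) ℝ}
    (P : MvPolynomial ((Fin g × Bool) × Fin (c+1) × Fin (c+1)) ℝ) (hP : ∀ A ∈ HIT g (c+1) T, eval (ent A) P = 0)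
    (S : Finset (Fin g × Bool)) : ∀ (ρ : Fin g × Bool → Matrix (Fin (c+1)) (Fin (c+1)) ℝ), ρ ∈ HIT g (c+1) T → Smp ρ →
    ∀ z : Fin g × Bool → ℂ, (∀ x, z x ^ (c+1) = 1) → (∀ x, x ∉ S → z x = 1) →
    aeval (ent (fun x => z x • (ρ x).map (algebraMap ℝ ℂ))) P = 0 := by
  classical
  induction S using Finset.induction_on with
  | empty =>
    intro ρ hρ hS z hz hz1
    have e : ent (fun x => z x • (ρ x).map (algebraMap ℝ ℂ)) = fun p => algebraMap ℝ ℂ (ent ρ p) := by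
      funext ⟨x, i, j⟩
      simp [ent, hz1]
    have := MvPolynomial.aeval_algebraMap_apply ℂ (ent ρ) P
    have h2 : aeval (ent ρ) P = 0 := by
      rw [MvPolynomial.aeval_eq_eval]
      exact hP ρ hρ
    rw [e]
    refine Eq.trans this ?_
    rw [h2, map_zero]
  | insert x S hx ih =>
    intro ρ hρ hS z hz hz1
    have hzx : z x ≠ 0 := fun h => by
      have := hz x
      rw [h, zero_pow (Nat.succ_ne_zero c)] at this
      exact zero_ne_one this
    obtain ⟨a, b, ha, hb, hd, hp⟩ := real_path (hS (x.1, !x.2)).1 (hS (x.1, !x.2)).2 (z x)⁻¹ (by rw [inv_pow, hz, inv_one])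
    obtain ⟨ε, hε, hw⟩ := real_flow hρ hS x (fun w => 1 + w • b - w^2 • a) (by fun_prop) (by simp) (fun w => by
      simp only [sub_mul, mul_sub, add_mul, mul_add, one_mul, mul_one, Matrix.smul_mul, Matrix.mul_smul, ha, hb])
    let z' : Fin g × Bool → ℂ := Function.update z x 1
    have hz'x : z' x = 1 := Function.update_self _ _ _
    have hz' : ∀ x, z' x ^ (c+1) = 1 := fun y => by
      by_cases hy : y = x
      · subst hy; rw [hz'x, one_pow]
      · simp only [z', Function.update_of_ne hy]; exact hz y
    have hz'1 : ∀ y, y ∉ S → z' y = 1 := fun y hy => by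
      by_cases hyx : y = x
      · subst hyx; exact hz'x
      · simp only [z', Function.update_of_ne hyx]
        exact hz1 y (by simp [hyx, hy])
    -- polynomial data
    let fc : Matrix (Fin (c+1)) (Fin (c+1)) (Polynomial ℂ) :=
      1 + (Polynomial.X : Polynomial ℂ) • (b.map (algebraMap ℝ ℂ)).map Polynomial.C
        - ((Polynomial.X : Polynomial ℂ)^2) • (a.map (algebraMap ℝ ℂ)).map Polynomial.C
    have hfc : ∀ w : ℂ, fc.map (Polynomial.evalRingHom w) =
        1 + w • b.map (algebraMap ℝ ℂ) - w^2 • a.map (algebraMap ℝ ℂ) := by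
      intro w
      ext i j
      simp [fc, Matrix.one_apply, apply_ite (Polynomial.eval w)]
      ring
    let d := fc.det
    have hdw : ∀ w : ℂ, d.eval w = (1 + w • b.map (algebraMap ℝ ℂ) - w^2 • a.map (algebraMap ℝ ℂ)).det := by
      intro w
      rw [← hfc, det_mapR]; rfl
    have hpw : ∀ (w : ℂ) i j, ((fc ^ (c+1)) i j).eval w = ((1 + w • b.map (algebraMap ℝ ℂ) - w^2 • a.map (algebraMap ℝ ℂ)) ^ (c+1)) i j := by
      intro w i j
      rw [← hfc, ← Matrix.map_pow]; rfl
    let N : (Fin g × Bool) × Fin (c+1) × Fin (c+1) → Polynomial ℂ := fun p =>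
      if p.1 = x then ∑ k, Polynomial.C ((ρ x p.2.1 k : ℝ) : ℂ) * (fc ^ (c+1)) k p.2.2
      else Polynomial.C (z' p.1 * ((ρ p.1 p.2.1 p.2.2 : ℝ) : ℂ)) * d
    obtain ⟨k, G, hG⟩ := clear_denoms (MvPolynomial.map (algebraMap ℝ ℂ) P) N d
    have hN : ∀ w : ℂ, d.eval w ≠ 0 → ∀ p, (N p).eval w / d.eval w = ent (fun y => z' y •
      Function.update (fun y => (ρ y).map (algebraMap ℝ ℂ)) x ((ρ x).map (algebraMap ℝ ℂ) * ((d.eval w)⁻¹ •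
        (1 + w • b.map (algebraMap ℝ ℂ) - w^2 • a.map (algebraMap ℝ ℂ)) ^ (c+1))) y) p := by
      rintro w hw ⟨y, i, j⟩
      by_cases hy : y = x
      · subst hy
        simp only [N, if_true, ent, Function.update_self, hz'x, one_smul, Polynomial.eval_finset_sum, Polynomial.eval_mul,
          Polynomial.eval_C, hpw, Matrix.mul_apply, Matrix.smul_apply, smul_eq_mul, Matrix.map_apply, Finset.sum_div, one_mul]
        refine Finset.sum_congr rfl fun k _ => ?_
        simp only [Complex.coe_algebraMap]
        field_simp
      · simp only [N, hy, if_false, ent, Function.update_of_ne hy, Polynomial.eval_mul, Polynomial.eval_C, Matrix.smul_apply,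
          smul_eq_mul, Matrix.map_apply]
        rw [mul_div_cancel_right₀ _ hw]
        rfl
    have hG0 : G = 0 := by
      apply Polynomial.eq_zero_of_infinite_isRoot
      have hinf : (Set.Ioo (-ε) ε).Infinite := Set.Ioo_infinite (by linarith)
      refine (hinf.image (f := fun w : ℝ => (w : ℂ)) (Complex.ofReal_injective.injOn)).mono ?_
      rintro _ ⟨w, hwI, rfl⟩
      obtain ⟨h1, h2, h3⟩ := hw w (abs_lt.mpr hwI)
      have emat : (1 + (w:ℂ) • b.map (algebraMap ℝ ℂ) - (w:ℂ)^2 • a.map (algebraMap ℝ ℂ)) = (1 + w • b - w^2 • a).map (algebraMap ℝ ℂ) := by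
        ext i j
        simp [Matrix.one_apply, apply_ite ((↑) : ℝ → ℂ)]
      have edet : d.eval (w:ℂ) = algebraMap ℝ ℂ (1 + w • b - w^2 • a).det := by
        rw [hdw, emat, det_mapR]
      have hd0 : d.eval (w:ℂ) ≠ 0 := by
        rw [edet]; simpa using h1
      have h4 := ih _ h2 h3 z' hz' hz'1
      rw [Set.mem_setOf_eq, Polynomial.IsRoot, ← hG _ hd0]
      simp only [hN _ hd0]
      rw [MvPolynomial.eval_map, ← MvPolynomial.aeval_def]
      rw [mul_eq_zero]; right
      refine Eq.trans ?_ h4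
      refine congrArg (fun A : Fin g × Bool → Matrix (Fin (c+1)) (Fin (c+1)) ℂ => aeval (ent A) P) ?_
      funext y
      refine congrArg (fun A => z' y • A) ?_
      by_cases hy : y = x
      · subst hy
        simp only [Function.update_self]
        rw [edet, emat]
        ext i j
        simp only [Matrix.mul_apply, Matrix.map_apply, map_sum, map_mul, Matrix.smul_apply, smul_eq_mul, map_inv₀, ← Matrix.map_pow]
      · simp only [Function.update_of_ne hy]
    have hdI : d.eval Complex.I = (z x)⁻¹ := by rw [hdw, hd]
    have hdI0 : d.eval Complex.I ≠ 0 := by rw [hdI]; exact inv_ne_zero hzx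
    have h5 := hG Complex.I hdI0
    rw [hG0, Polynomial.eval_zero, mul_eq_zero] at h5
    have h6 := h5.resolve_left (pow_ne_zero _ hdI0)
    simp only [hN _ hdI0] at h6
    rw [MvPolynomial.eval_map, ← MvPolynomial.aeval_def] at h6
    refine Eq.trans ?_ h6
    refine congrArg (fun A : Fin g × Bool → Matrix (Fin (c+1)) (Fin (c+1)) ℂ => aeval (ent A) P) ?_
    funext y
    by_cases hy : y = x
    · subst hy
      simp only [Function.update_self, hz'x, one_smul]
      rw [hp, hdI, inv_inv]
      simp
    · simp only [Function.update_of_ne hy, z']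
end PartH2

section PartI

theorem exists_indep_real {k : Type} [Field k] [Algebra k ℝ] [Countable k] (d : ℕ) :
    ∃ b : Fin d → ℝ, AlgebraicIndependent k b := by
  obtain ⟨s, hs⟩ := exists_isTranscendenceBasis k ℝ
  have hinf : s.Infinite := by
    intro hfin
    have hcs : Countable s := hfin.countable
    have halg := hs.isAlgebraic
    have hc : Countable (Algebra.adjoin k (Set.range ((↑) : s → ℝ))) := by
      have e := hs.1.aevalEquiv.toEquiv
      haveI : Countable (MvPolynomial s k) := by
        rw [← Cardinal.mk_le_aleph0_iff]
        refine (MvPolynomial.cardinalMk_le_max).trans ?_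
        simp only [max_le_iff, Cardinal.mk_le_aleph0_iff]
        refine ⟨⟨?_, ?_⟩, le_rfl⟩ <;> assumption
      exact e.symm.injective.countable
    have h1 := Algebra.IsAlgebraic.cardinalMk_le_max (Algebra.adjoin k (Set.range ((↑) : s → ℝ))) ℝ
    have h2 : Cardinal.mk ℝ ≤ Cardinal.aleph0 := h1.trans (max_le (Cardinal.mk_le_aleph0_iff.2 hc) le_rfl)
    have h3 : Countable ℝ := Cardinal.mk_le_aleph0_iff.1 h2
    exact not_countable h3
  let f := hinf.natEmbedding
  exact ⟨fun i => ((f i : s) : ℝ), hs.1.comp (fun i : Fin d => f i) (f.injective.comp Fin.val_injective)⟩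

theorem exists_indep_small {k : Type} [Field k] [CharZero k] [Algebra k ℝ] [Countable k] (d : ℕ) (r : ℝ) (hr : 0 < r) :
    ∃ b : Fin d → ℝ, AlgebraicIndependent k b ∧ b ∈ Metric.ball (0 : Fin d → ℝ) r := by
  obtain ⟨b, hb⟩ := exists_indep_real (k := k) d
  obtain ⟨N, hN⟩ := exists_nat_gt (‖b‖ / r)
  have hN0 : (0:ℝ) < N := lt_of_le_of_lt (by positivity) hN
  refine ⟨fun j => (N:ℝ)⁻¹ * b j, ?_, ?_⟩
  · apply algebraicIndependent_of_rk
    apply card_le_rk _ b hb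
    intro D hD j
    have h1 := hD j
    rw [Derivation.leibniz, Derivation.leibniz_inv, Derivation.map_natCast] at h1
    simp only [smul_zero, mul_zero, add_zero, smul_eq_mul] at h1
    exact (mul_eq_zero.mp h1).resolve_left (inv_ne_zero hN0.ne')
  · have : (fun j => (N:ℝ)⁻¹ * b j) = (N:ℝ)⁻¹ • b := rfl
    rw [mem_ball_zero_iff, this, norm_smul, Real.norm_eq_abs, abs_of_pos (inv_pos.2 hN0)]
    rw [div_lt_iff₀ hr] at hN
    rw [inv_mul_lt_iff₀ hN0]; exact hN

theorem ift_abs {E F : Type} [NormedAddCommGroup E] [NormedSpace ℝ E] [FiniteDimensional ℝ E]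
    [NormedAddCommGroup F] [NormedSpace ℝ F] [FiniteDimensional ℝ F] (Φ : E → F) (hΦ : ContDiff ℝ 1 Φ) (a : E)
    (ha : Φ a = 0) (hs : Function.Surjective (fderiv ℝ Φ a)) (U : Set E) (hU : U ∈ nhds a) (m : ℕ)
    (hm : m + Module.finrank ℝ F = Module.finrank ℝ E) :
    ∃ r > 0, ∃ ψ : (Fin m → ℝ) → E, ∃ L : E →ₗ[ℝ] (Fin m → ℝ), ψ 0 = a ∧ ContinuousOn ψ (Metric.ball 0 r) ∧
      ∀ v ∈ Metric.ball 0 r, Φ (ψ v) = 0 ∧ L (ψ v - a) = v ∧ ψ v ∈ U := by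
  haveI := FiniteDimensional.complete ℝ E
  haveI := FiniteDimensional.complete ℝ F
  have hf : HasStrictFDerivAt Φ (fderiv ℝ Φ a) a := hΦ.contDiffAt.hasStrictFDerivAt one_ne_zero
  have hf' : (fderiv ℝ Φ a).range = ⊤ := LinearMap.range_eq_top.2 hs
  have hker : (fderiv ℝ Φ a).ker.ClosedComplemented := Submodule.ClosedComplemented.of_finiteDimensional _
  let e := hf.implicitToOpenPartialHomeomorphOfComplemented Φ (fderiv ℝ Φ a) hf' hker
  have hfr : Module.finrank ℝ (fderiv ℝ Φ a).ker = Module.finrank ℝ (Fin m → ℝ) := by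
    have h1 := LinearMap.finrank_range_add_finrank_ker (fderiv ℝ Φ a).toLinearMap
    have h2 : LinearMap.range (fderiv ℝ Φ a).toLinearMap = ⊤ := hf'
    rw [h2, finrank_top] at h1
    rw [Module.finrank_fin_fun]
    have h3 : Module.finrank ℝ (fderiv ℝ Φ a).ker = Module.finrank ℝ (LinearMap.ker (fderiv ℝ Φ a).toLinearMap) := rfl
    omega
  let κ : (fderiv ℝ Φ a).ker ≃L[ℝ] (Fin m → ℝ) := ContinuousLinearEquiv.ofFinrankEq hfr
  let ι : (Fin m → ℝ) → F × (fderiv ℝ Φ a).ker := fun v => (0, κ.symm v)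
  have hι : Continuous ι := by fun_prop
  have hι0 : ι 0 = e a := by
    simp only [ι, e, HasStrictFDerivAt.implicitToOpenPartialHomeomorphOfComplemented_self, ha, map_zero]
  have hsrc : a ∈ e.source := hf.mem_implicitToOpenPartialHomeomorphOfComplemented_source hf' hker
  have htgt : ι 0 ∈ e.target := by rw [hι0]; exact e.map_source hsrc
  have hcont : ContinuousAt (fun v => e.symm (ι v)) 0 :=
    ContinuousAt.comp (f := ι) (g := e.symm) (e.symm.continuousAt htgt) hι.continuousAt
  have h00 : e.symm (ι 0) = a := by rw [hι0, e.left_inv hsrc]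
  have hnb : {v | ι v ∈ e.target ∧ e.symm (ι v) ∈ U} ∈ nhds (0 : Fin m → ℝ) := by
    apply Filter.inter_mem
    · exact hι.continuousAt.preimage_mem_nhds (e.open_target.mem_nhds htgt)
    · apply hcont.preimage_mem_nhds
      rw [h00]; exact hU
  obtain ⟨r, hr, hball⟩ := Metric.mem_nhds_iff.1 hnb
  refine ⟨r, hr, fun v => e.symm (ι v), (κ.toLinearMap).comp (Classical.choose hker).toLinearMap, h00, ?_, ?_⟩
  · intro v hv
    exact (ContinuousAt.comp (f := ι) (g := e.symm) (e.symm.continuousAt (hball hv).1) hι.continuousAt).continuousWithinAt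
  · intro v hv
    have h1 : e (e.symm (ι v)) = ι v := e.right_inv (hball hv).1
    have h2 : e (e.symm (ι v)) = (Φ (e.symm (ι v)), Classical.choose hker (e.symm (ι v) - a)) := rfl
    rw [h2] at h1
    refine ⟨congrArg Prod.fst h1, ?_, (hball hv).2⟩
    have h3 : Classical.choose hker (e.symm (ι v) - a) = κ.symm v := congrArg Prod.snd h1
    change κ (Classical.choose hker (e.symm (ι v) - a)) = v
    rw [h3, κ.apply_symm_apply]
end PartI

section PartI2
attribute [local instance] Matrix.normedAddCommGroup Matrix.normedSpace

theorem cd_mat {E : Type} [NormedAddCommGroup E] [NormedSpace ℝ E] {n : ℕ} {f : E → Matrix (Fin n) (Fin n) ℝ}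
    (h : ∀ i j, ContDiff ℝ 1 (fun x => f x i j)) : ContDiff ℝ 1 f :=
  contDiff_pi.2 fun i => contDiff_pi.2 fun j => h i j

theorem cd_ent {E : Type} [NormedAddCommGroup E] [NormedSpace ℝ E] {n : ℕ} {f : E → Matrix (Fin n) (Fin n) ℝ}
    (h : ContDiff ℝ 1 f) (i j : Fin n) : ContDiff ℝ 1 (fun x => f x i j) :=
  contDiff_pi.1 (contDiff_pi.1 h i) j

theorem cd_mul {E : Type} [NormedAddCommGroup E] [NormedSpace ℝ E] {n : ℕ} {f h : E → Matrix (Fin n) (Fin n) ℝ}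
    (hf : ContDiff ℝ 1 f) (hh : ContDiff ℝ 1 h) : ContDiff ℝ 1 (fun x => f x * h x) := by
  apply cd_mat
  intro i j
  simp only [Matrix.mul_apply]
  exact ContDiff.sum fun k _ => (cd_ent hf i k).mul (cd_ent hh k j)

theorem cd_det {E : Type} [NormedAddCommGroup E] [NormedSpace ℝ E] {n : ℕ} {f : E → Matrix (Fin n) (Fin n) ℝ}
    (hf : ContDiff ℝ 1 f) : ContDiff ℝ 1 (fun x => (f x).det) := by
  simp only [Matrix.det_apply']
  exact ContDiff.sum fun σ _ => contDiff_const.mul (contDiff_prod fun i _ => cd_ent hf _ _)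

theorem cd_adj {E : Type} [NormedAddCommGroup E] [NormedSpace ℝ E] {n : ℕ} {f : E → Matrix (Fin n) (Fin n) ℝ}
    (hf : ContDiff ℝ 1 f) : ContDiff ℝ 1 (fun x => (f x).adjugate) := by
  apply cd_mat
  intro i j
  simp only [Matrix.adjugate_apply]
  apply cd_det
  apply cd_mat
  intro a b
  by_cases ha : a = j
  · subst ha
    simp only [Matrix.updateRow_self]
    exact contDiff_const
  · simp only [Matrix.updateRow_ne ha]
    exact cd_ent hf a b

theorem cd_ofFn {E : Type} [NormedAddCommGroup E] [NormedSpace ℝ E] {n e : ℕ} {f : Fin e → E → Matrix (Fin n) (Fin n) ℝ}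
    (hf : ∀ i, ContDiff ℝ 1 (f i)) : ContDiff ℝ 1 (fun x => (List.ofFn fun i => f i x).prod) := by
  induction e with
  | zero => simpa using contDiff_const
  | succ e ih =>
    simp only [List.ofFn_succ, List.prod_cons]
    exact cd_mul (hf 0) (ih (fun i => hf i.succ))

/-- product of the adjugate-commutators of the handles other than the first -/
def Radj {R : Type} [CommRing R] {e n : ℕ} (ρ : Fin (e+1) × Bool → Matrix (Fin n) (Fin n) R) : Matrix (Fin n) (Fin n) R :=
  (List.ofFn fun i : Fin e => ρ (i.succ, false) * ρ (i.succ, true) * (ρ (i.succ, false)).adjugate * (ρ (i.succ, true)).adjugate).prod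

def pdet {R : Type} [CommRing R] {e n : ℕ} (ρ : Fin (e+1) × Bool → Matrix (Fin n) (Fin n) R) : R :=
  ∏ i : Fin e, ((ρ (i.succ, false)).det * (ρ (i.succ, true)).det)

theorem ofFn_smul {R : Type} [CommRing R] {e n : ℕ} (t : Fin e → R) (f : Fin e → Matrix (Fin n) (Fin n) R) :
    (List.ofFn fun i => t i • f i).prod = (∏ i, t i) • (List.ofFn f).prod := by
  induction e with
  | zero => simp
  | succ e ih =>
    rw [List.ofFn_succ, List.ofFn_succ, List.prod_cons, List.prod_cons, ih, Fin.prod_univ_succ, Matrix.smul_mul, Matrix.mul_smul, smul_smul]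

theorem Radj_eq {R : Type} [CommRing R] {e n : ℕ} (ρ : Fin (e+1) × Bool → Matrix (Fin n) (Fin n) R) (h : ∀ x, IsUnit (ρ x).det) :
    Radj ρ = pdet ρ • (List.ofFn fun i : Fin e => ρ (i.succ, false) * ρ (i.succ, true) * (ρ (i.succ, false))⁻¹ * (ρ (i.succ, true))⁻¹).prod := by
  unfold Radj pdet
  rw [← ofFn_smul]
  congr 2
  funext i
  have h1 : ∀ x, (ρ x).adjugate = (ρ x).det • (ρ x)⁻¹ := fun x => by
    rw [Matrix.inv_def, smul_smul, Ring.mul_inverse_cancel _ (h x), one_smul]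
  rw [h1, h1, Matrix.mul_smul, Matrix.mul_smul, Matrix.smul_mul, smul_smul, mul_comm (ρ (i.succ, true)).det]

theorem ofFn_det_one {R : Type} [CommRing R] {e n : ℕ} (f : Fin e → Matrix (Fin n) (Fin n) R) (h : ∀ i, (f i).det = 1) :
    (List.ofFn f).prod.det = 1 := by
  induction e with
  | zero => simp
  | succ e ih =>
    rw [List.ofFn_succ, List.prod_cons, Matrix.det_mul, h, one_mul]
    exact ih _ (fun i => h i.succ)

theorem comm_det_one {R : Type} [CommRing R] {n : ℕ} (A B : Matrix (Fin n) (Fin n) R) (hA : IsUnit A.det) (hB : IsUnit B.det) :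
    (A * B * A⁻¹ * B⁻¹).det = 1 := by
  have h1 : A.det * A⁻¹.det = 1 := by rw [← Matrix.det_mul, Matrix.mul_nonsing_inv _ hA, Matrix.det_one]
  have h2 : B.det * B⁻¹.det = 1 := by rw [← Matrix.det_mul, Matrix.mul_nonsing_inv _ hB, Matrix.det_one]
  rw [Matrix.det_mul, Matrix.det_mul, Matrix.det_mul]
  calc A.det * B.det * A⁻¹.det * B⁻¹.det = (A.det * A⁻¹.det) * (B.det * B⁻¹.det) := by ring
    _ = 1 := by rw [h1, h2, one_mul]

theorem rel_iff {R : Type} [CommRing R] {n : ℕ} (A B X : Matrix (Fin n) (Fin n) R) (hA : IsUnit A.det) (hB : IsUnit B.det) :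
    (A * B * A⁻¹ * B⁻¹) * X = 1 ↔ B * A = X * (A * B) := by
  rw [mul_eq_one_comm]
  constructor
  · intro h
    have := congrArg (fun M => M * (B * A)) h
    simp only [one_mul, mul_assoc] at this
    rw [← mul_assoc B⁻¹ B A, Matrix.nonsing_inv_mul _ hB, one_mul, Matrix.nonsing_inv_mul _ hA, mul_one] at this
    exact this.symm
  · intro h
    have : X * (A * B * A⁻¹ * B⁻¹) = X * (A * B) * A⁻¹ * B⁻¹ := by simp only [mul_assoc]
    rw [this, ← h, mul_assoc B, Matrix.mul_nonsing_inv _ hA, mul_one, Matrix.mul_nonsing_inv _ hB]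

theorem GLr_of_zero {e c : ℕ} (ρ : Fin (e+1) × Bool → Matrix (Fin (c+1)) (Fin (c+1)) ℝ) (s : ℝ) (hs : 0 < s)
    (hd : ∀ x, 0 < (ρ x).det) (h : s • (ρ (0, true) * ρ (0, false)) - Radj ρ * (ρ (0, false) * ρ (0, true)) = 0) :
    GLr ρ ∧ s = pdet ρ := by
  have hu : ∀ x, IsUnit (ρ x).det := fun x => isUnit_iff_ne_zero.2 (hd x).ne'
  rw [Radj_eq ρ hu, sub_eq_zero] at h
  have hp : 0 < pdet ρ := Finset.prod_pos fun i _ => mul_pos (hd _) (hd _)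
  set X := (List.ofFn fun i : Fin e => ρ (i.succ, false) * ρ (i.succ, true) * (ρ (i.succ, false))⁻¹ * (ρ (i.succ, true))⁻¹).prod with hX
  have hXd : X.det = 1 := ofFn_det_one _ fun i => comm_det_one _ _ (hu _) (hu _)
  have h2 := congrArg Matrix.det h
  rw [Matrix.smul_mul, Matrix.det_smul, Matrix.det_smul, Matrix.det_mul, Matrix.det_mul, Matrix.det_mul, hXd, one_mul,
    mul_comm (ρ (0, true)).det, Fintype.card_fin] at h2
  have h3 : s ^ (c+1) = pdet ρ ^ (c+1) := mul_right_cancel₀ (mul_pos (hd _) (hd _)).ne' h2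
  have h4 : s = pdet ρ := (pow_left_inj₀ hs.le hp.le (Nat.succ_ne_zero c)).1 h3
  refine ⟨⟨hu, ?_⟩, h4⟩
  rw [List.ofFn_succ, List.prod_cons, rel_iff _ _ _ (hu _) (hu _)]
  rw [h4, Matrix.smul_mul] at h
  exact smul_right_injective _ hp.ne' h
end PartI2

section PartI3
attribute [local instance] Matrix.normedAddCommGroup Matrix.normedSpace

variable {e c : ℕ}

theorem quad_deriv {F : Type} [NormedAddCommGroup F] [NormedSpace ℝ F] (a b d : F) :
    HasDerivAt (fun t : ℝ => a + t • b + t^2 • d) b 0 := by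
  have h1 : HasDerivAt (fun t : ℝ => t • b) ((1:ℝ) • b) 0 := (hasDerivAt_id (0:ℝ)).smul_const b
  have h2 : HasDerivAt (fun t : ℝ => t^2 • d) (((2:ℕ) * (0:ℝ)^(2-1) * 1) • d) 0 := ((hasDerivAt_id (0:ℝ)).pow 2).smul_const d
  exact HasDerivAt.congr_deriv ((h1.const_add a).add h2) (by simp)

theorem fderiv_line {E F : Type} [NormedAddCommGroup E] [NormedSpace ℝ E] [NormedAddCommGroup F] [NormedSpace ℝ F]
    (Φ : E → F) (a v : E) (hΦ : DifferentiableAt ℝ Φ a) (p q r : F) (h : ∀ t : ℝ, Φ (a + t • v) = p + t • q + t^2 • r) :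
    fderiv ℝ Φ a v = q := by
  have h1 : HasLineDerivAt ℝ Φ (fderiv ℝ Φ a v) a v := hΦ.hasFDerivAt.hasLineDerivAt v
  have h2 : HasDerivAt (fun t : ℝ => Φ (a + t • v)) (fderiv ℝ Φ a v) 0 := h1
  simp only [h] at h2
  exact h2.unique (quad_deriv p q r)

def Phi (z : (Fin (e+1) × Bool → Matrix (Fin (c+1)) (Fin (c+1)) ℝ) × ℝ) : Matrix (Fin (c+1)) (Fin (c+1)) ℝ :=
  z.2 • (z.1 (0, true) * z.1 (0, false)) - Radj z.1 * (z.1 (0, false) * z.1 (0, true))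

theorem Phi_cd : ContDiff ℝ 1 (Phi (e := e) (c := c)) := by
  have hc : ∀ x, ContDiff ℝ 1 (fun z : (Fin (e+1) × Bool → Matrix (Fin (c+1)) (Fin (c+1)) ℝ) × ℝ => z.1 x) := fun x =>
    (contDiff_pi.1 (contDiff_id (n := 1) (𝕜 := ℝ) (E := Fin (e+1) × Bool → Matrix (Fin (c+1)) (Fin (c+1)) ℝ)) x).comp contDiff_fst
  apply ContDiff.sub
  · exact ContDiff.smul contDiff_snd (cd_mul (hc _) (hc _))
  · apply cd_mul
    · exact cd_ofFn fun i => cd_mul (cd_mul (cd_mul (hc _) (hc _)) (cd_adj (hc _))) (cd_adj (hc _))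
    · exact cd_mul (hc _) (hc _)

theorem Phi_T (T : Fin (e+1) × Bool → Matrix (Fin (c+1)) (Fin (c+1)) ℝ) (hT : T ∈ RepVariety (e+1) (c+1) ℝ) :
    T (0, true) * T (0, false) = Radj T * (T (0, false) * T (0, true)) := by
  have hu : ∀ x, IsUnit (T x).det := fun x => by rw [hT.1]; exact isUnit_one
  rw [Radj_eq _ hu]
  have : pdet T = 1 := by simp [pdet, hT.1]
  rw [this, one_smul, ← rel_iff _ _ _ (hu _) (hu _)]
  have := hT.2
  rwa [List.ofFn_succ, List.prod_cons] at this

theorem Phi_surj (T : Fin (e+1) × Bool → Matrix (Fin (c+1)) (Fin (c+1)) ℝ) (hT : T ∈ RepVariety (e+1) (c+1) ℝ)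
    (hZ : ∀ y : Matrix (Fin (c+1)) (Fin (c+1)) ℝ, y * T (0, false) = T (0, false) * y → y * T (0, true) = T (0, true) * y →
      ∃ t : ℝ, y = t • 1) :
    Function.Surjective (fderiv ℝ (Phi (e := e) (c := c)) (T, 1)) := by
  have hC := Phi_T T hT
  have hdif : DifferentiableAt ℝ (Phi (e := e) (c := c)) (T, 1) := Phi_cd.differentiable one_ne_zero _
  set L := fderiv ℝ (Phi (e := e) (c := c)) (T, 1) with hL
  have hs : L (0, 1) = T (0, true) * T (0, false) := by
    apply fderiv_line _ _ _ hdif 0 _ 0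
    intro t
    simp only [Phi, Prod.smul_mk, Prod.mk_add_mk, smul_zero, add_zero, smul_eq_mul, mul_one, add_smul, one_smul, ← hC]
    abel
  have hh : ∀ x : Bool → Matrix (Fin (c+1)) (Fin (c+1)) ℝ,
      ∃ v, L v = ell (T (0, true)) (T (0, false)) (Radj T) x := by
    intro x
    let v : Fin (e+1) × Bool → Matrix (Fin (c+1)) (Fin (c+1)) ℝ := fun p => if p.1 = 0 then x (!p.2) else 0
    refine ⟨(v, 0), ?_⟩
    apply fderiv_line _ _ _ hdif 0 _ (x false * x true - Radj T * (x true * x false))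
    intro t
    have hR : Radj (T + t • v) = Radj T := by
      simp only [Radj, Pi.add_apply, Pi.smul_apply, v, Fin.succ_ne_zero, if_false, smul_zero, add_zero]
    simp only [Phi, Prod.smul_mk, Prod.mk_add_mk, smul_zero, add_zero, one_smul, hR]
    simp only [Pi.add_apply, Pi.smul_apply, v, if_true, Bool.not_true, Bool.not_false]
    simp only [ell, LinearMap.coe_mk, AddHom.coe_mk]
    have : (T (0, true) + t • x false) * (T (0, false) + t • x true) - Radj T * ((T (0, false) + t • x true) * (T (0, true) + t • x false))
      = (T (0, true) * T (0, false) - Radj T * (T (0, false) * T (0, true))) + t • (x false * T (0, false) + T (0, true) * x true - Radj T * (x true * T (0, true) + T (0, false) * x false)) + t^2 • (x false * x true - Radj T * (x true * x false)) := by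
      simp only [mul_add, add_mul, smul_add, smul_sub, Matrix.smul_mul, Matrix.mul_smul, smul_smul, ← sq]
      abel
    rw [this, sub_eq_zero.2 hC]
  rw [← ContinuousLinearMap.coe_coe, ← LinearMap.range_eq_top]
  by_contra hne
  obtain ⟨φ, hφ0, hφ⟩ := Submodule.exists_le_ker_of_lt_top _ (lt_top_iff_ne_top.2 hne)
  have hφ' : ∀ v, φ (L v) = 0 := fun v => hφ ⟨v, rfl⟩
  have hm := tz_mem hC φ (fun x => by
    obtain ⟨v, hv⟩ := hh x
    rw [← hv]; exact hφ' v)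
  obtain ⟨t, ht⟩ := hZ _ hm.2 hm.1
  have h0 := hφ' (0, 1)
  rw [hs, tz_spec, ← mul_assoc, ht, Matrix.trace_smul, Matrix.trace_one, Fintype.card_fin, smul_eq_mul] at h0
  have ht0 : t = 0 := (mul_eq_zero.1 h0).resolve_right (by positivity)
  rw [ht0, zero_smul] at ht
  have hz : tz φ = 0 := by
    apply mul_right_cancel_det (A := T (0, true)) (by rw [hT.1]; exact one_ne_zero)
    apply mul_right_cancel_det (A := T (0, false)) (by rw [hT.1]; exact one_ne_zero)
    rw [ht]; simp
  apply hφ0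
  ext1 u
  rw [tz_spec, hz, zero_mul, Matrix.trace_zero]; rfl

theorem real_point (T : Fin (e+1) × Bool → Matrix (Fin (c+1)) (Fin (c+1)) ℝ) (hT : T ∈ RepVariety (e+1) (c+1) ℝ)
    (hZ : ∀ y : Matrix (Fin (c+1)) (Fin (c+1)) ℝ, y * T (0, false) = T (0, false) * y → y * T (0, true) = T (0, true) * y →
      ∃ t : ℝ, y = t • 1) (d : ℕ) (hd : d + (c+1)^2 = 2 * (e+1) * (c+1)^2 + 1) :
    ∃ (co : Fin d → (Fin (e+1) × Bool) × Fin (c+1) × Fin (c+1) → ℝ) (la ka : Fin d → ℝ), ∃ r > 0,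
    ∃ ψ : (Fin d → ℝ) → (Fin (e+1) × Bool → Matrix (Fin (c+1)) (Fin (c+1)) ℝ), ψ 0 = T ∧ ContinuousOn ψ (Metric.ball 0 r) ∧
    ∀ v ∈ Metric.ball 0 r, GLr (ψ v) ∧ (∀ x, 0 < (ψ v x).det) ∧
      ∀ j, v j = ∑ p, co j p * ent (ψ v) p + la j * pdet (ψ v) + ka j := by
  classical
  let U : Set ((Fin (e+1) × Bool → Matrix (Fin (c+1)) (Fin (c+1)) ℝ) × ℝ) := {z | 0 < z.2 ∧ ∀ x, 0 < (z.1 x).det}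
  have hU : IsOpen U := by
    have : U = {z | 0 < z.2} ∩ ⋂ x, {z | 0 < (z.1 x).det} := by ext z; simp [U]
    rw [this]
    apply IsOpen.inter
    · exact isOpen_lt continuous_const continuous_snd
    · apply isOpen_iInter_of_finite
      intro x
      exact isOpen_lt continuous_const (((continuous_apply x).comp continuous_fst).matrix_det)
  obtain ⟨r, hr, ψ, L, h0, hcont, hv⟩ := ift_abs (Phi (e := e) (c := c)) Phi_cd (T, 1)
    (by simp only [Phi, one_smul]; rw [sub_eq_zero]; exact Phi_T T hT) (Phi_surj T hT hZ) U
    (hU.mem_nhds ⟨one_pos, fun x => by simp only [hT.1]; exact one_pos⟩) d (by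
      rw [Module.finrank_prod, Module.finrank_pi_fintype]
      simp only [Module.finrank_matrix, Module.finrank_self, Fintype.card_fin, Finset.sum_const, Finset.card_univ, Fintype.card_prod, Fintype.card_bool, smul_eq_mul]
      linarith)
  refine ⟨fun j p => L (Pi.single p.1 (Matrix.single p.2.1 p.2.2 1), 0) j, fun j => L (0, 1) j, fun j => - L (T, 1) j, r, hr,
    fun v => (ψ v).1, by simp only [h0], continuous_fst.comp_continuousOn hcont, fun v hvb => ?_⟩
  obtain ⟨h1, h2, h3, h4⟩ := hv v hvb
  obtain ⟨h5, h6⟩ := GLr_of_zero (ψ v).1 (ψ v).2 h3 h4 h1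
  refine ⟨h5, h4, fun j => ?_⟩
  have hdec : ψ v = ∑ p : (Fin (e+1) × Bool) × Fin (c+1) × Fin (c+1), ent (ψ v).1 p • ((Pi.single p.1 (Matrix.single p.2.1 p.2.2 1), 0) : (Fin (e+1) × Bool → Matrix (Fin (c+1)) (Fin (c+1)) ℝ) × ℝ) + pdet (ψ v).1 • (0, 1) := by
    rw [← h6]
    apply Prod.ext
    · rw [Prod.fst_add, Prod.fst_sum]
      funext x
      ext a b
      simp only [Prod.smul_mk, Pi.add_apply, Finset.sum_apply, Matrix.add_apply, Matrix.sum_apply, Pi.smul_apply, Matrix.smul_apply, smul_zero, Matrix.zero_apply, Pi.zero_apply, add_zero]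
      rw [Finset.sum_eq_single (x, a, b)]
      · simp [ent]
      · rintro ⟨y, i, k⟩ - hne
        by_cases hy : y = x
        · subst hy
          simp only [Pi.single_eq_same]
          rw [Matrix.single_apply_of_ne, smul_zero]
          rintro ⟨rfl, rfl⟩
          exact hne rfl
        · simp only [Pi.single_eq_of_ne' hy]
          simp
      · simp
    · rw [Prod.snd_add, Prod.snd_sum]; simp
  have h7 := congrFun h2 j
  rw [map_sub, Pi.sub_apply, hdec, map_add, map_sum] at h7
  simp only [map_smul, Pi.add_apply, Finset.sum_apply, Pi.smul_apply, smul_eq_mul] at h7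
  rw [← h7, sub_eq_add_neg, mul_comm (pdet _)]
  congr 2
  exact Finset.sum_congr rfl fun p _ => mul_comm _ _
end PartI3

section PartI4

theorem det_Kry_smul {c : ℕ} (l : ℝ) (B : Matrix (Fin (c+1)) (Fin (c+1)) ℝ) :
    (Kry (l • B)).det = (∏ j : Fin (c+1), l ^ (j:ℕ)) * (Kry B).det := by
  rw [← Matrix.det_mul_row]
  congr 1
  ext i j
  simp [Kry, smul_pow]

theorem det_Hk_smul {c : ℕ} (l : ℝ) (B : Matrix (Fin (c+1)) (Fin (c+1)) ℝ) :
    (Hk (l • B)).det = (∏ j : Fin (c+1), l ^ (j:ℕ)) * ((∏ j : Fin (c+1), l ^ (j:ℕ)) * (Hk B).det) := by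
  rw [← Matrix.det_mul_row (fun j : Fin (c+1) => l ^ (j:ℕ)) (Hk B), ← Matrix.det_mul_column]
  congr 1
  ext i j
  simp [Hk, smul_pow, pow_add, mul_assoc]
  ring

theorem Smp_of_Gd {g c : ℕ} {ρ : Fin g × Bool → Matrix (Fin (c+1)) (Fin (c+1)) ℝ}
    (h : ∀ i, Gd (ρ (i, false)) (ρ (i, true)) ≠ 0) (l : Fin g × Bool → ℝ) (hl : ∀ x, l x ≠ 0) :
    Smp (fun x => l x • ρ x) := by
  rintro ⟨i, b⟩
  have h1 := h i
  simp only [Gd, mul_ne_zero_iff] at h1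
  have hp : (∏ j : Fin (c+1), l (i,b) ^ (j:ℕ)) ≠ 0 := Finset.prod_ne_zero_iff.2 fun j _ => pow_ne_zero _ (hl _)
  have h2 : (Kry (ρ (i,b))).det ≠ 0 ∧ (Hk (ρ (i,b))).det ≠ 0 := by
    cases b
    · exact ⟨h1.1.1.2, h1.1.2⟩
    · exact ⟨h1.1.1.1.1.2, h1.2⟩
  refine ⟨?_, ?_⟩
  · show (Kry (l (i,b) • ρ (i,b))).det ≠ 0
    rw [det_Kry_smul]
    exact mul_ne_zero hp h2.1
  · show (Hk (l (i,b) • ρ (i,b))).det ≠ 0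
    rw [det_Hk_smul]
    exact mul_ne_zero hp (mul_ne_zero hp h2.2)

theorem pdet_map {R S : Type} [CommRing R] [CommRing S] {e c : ℕ} (f : R →+* S) (ρ : Fin (e+1) × Bool → Matrix (Fin (c+1)) (Fin (c+1)) R) :
    pdet (fun x => (ρ x).map f) = f (pdet ρ) := by
  simp only [pdet, map_prod, map_mul, det_mapR]

theorem closure_countable (S : Set ℝ) (hS : S.Finite) : Countable (Subfield.closure S) := by
  have h := Subfield.cardinalMk_closure_le_max S
  rw [← Cardinal.mk_le_aleph0_iff]
  exact h.trans (max_le (Cardinal.mk_le_aleph0_iff.2 hS.countable.to_subtype) le_rfl)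

/-- normalising scalars -/
noncomputable def mu {c : ℕ} (A : Matrix (Fin (c+1)) (Fin (c+1)) ℝ) : ℝ := A.det ^ (((c:ℝ)+1)⁻¹)

theorem mu_pos {c : ℕ} {A : Matrix (Fin (c+1)) (Fin (c+1)) ℝ} (h : 0 < A.det) : 0 < mu A := Real.rpow_pos_of_pos h _

theorem mu_pow {c : ℕ} {A : Matrix (Fin (c+1)) (Fin (c+1)) ℝ} (h : 0 < A.det) : mu A ^ (c+1) = A.det := by
  have := Real.rpow_inv_natCast_pow h.le (Nat.succ_ne_zero c)
  simpa [mu] using this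

theorem norm_mem {e c : ℕ} {ρ : Fin (e+1) × Bool → Matrix (Fin (c+1)) (Fin (c+1)) ℝ} (h : GLr ρ) (hd : ∀ x, 0 < (ρ x).det) :
    (fun x => (mu (ρ x))⁻¹ • ρ x) ∈ RepVariety (e+1) (c+1) ℝ := by
  have h2 := h.smul (fun x => (mu (ρ x))⁻¹) (fun x => inv_ne_zero (mu_pos (hd x)).ne')
  refine ⟨fun x => ?_, h2.2⟩
  show ((mu (ρ x))⁻¹ • ρ x).det = 1
  rw [Matrix.det_smul, Fintype.card_fin, inv_pow, mu_pow (hd x), inv_mul_cancel₀ (hd x).ne']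

theorem path_mem_HIT {e c d : ℕ} {T : Fin (e+1) × Bool → Matrix (Fin (c+1)) (Fin (c+1)) ℝ} (hT : T ∈ RepVariety (e+1) (c+1) ℝ)
    {r : ℝ} (hr : 0 < r) (ψ : (Fin d → ℝ) → (Fin (e+1) × Bool → Matrix (Fin (c+1)) (Fin (c+1)) ℝ))
    (h0 : ψ 0 = T) (hc : ContinuousOn ψ (Metric.ball 0 r))
    (h : ∀ v ∈ Metric.ball (0 : Fin d → ℝ) r, GLr (ψ v) ∧ ∀ x, 0 < (ψ v x).det) :
    ∀ v ∈ Metric.ball (0 : Fin d → ℝ) r, (fun x => (mu (ψ v x))⁻¹ • ψ v x) ∈ HIT (e+1) (c+1) T := by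
  have hcx : ∀ x, ContinuousOn (fun v => ψ v x) (Metric.ball 0 r) := fun x => continuousOn_pi.1 hc x
  have hdet : ∀ x, ContinuousOn (fun v => (ψ v x).det) (Metric.ball 0 r) := fun x =>
    (continuous_id.matrix_det).comp_continuousOn (hcx x)
  have hmu : ∀ x, ContinuousOn (fun v => (mu (ψ v x))⁻¹) (Metric.ball 0 r) := by
    intro x
    refine ContinuousOn.inv₀ ?_ (fun v hv => (mu_pos ((h v hv).2 x)).ne')
    exact (hdet x).rpow_const (fun v hv => Or.inl ((h v hv).2 x).ne')
  have hΨ : ContinuousOn (fun v => fun x => (mu (ψ v x))⁻¹ • ψ v x) (Metric.ball 0 r) :=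
    continuousOn_pi.2 fun x => ContinuousOn.smul (f := fun v => (mu (ψ v x))⁻¹) (g := fun v => ψ v x) (hmu x) (hcx x)
  have hpre := ((convex_ball (0 : Fin d → ℝ) r).isPreconnected).image _ hΨ
  have hT' : T ∈ (fun v => fun x => (mu (ψ v x))⁻¹ • ψ v x) '' (Metric.ball 0 r) := by
    refine ⟨0, Metric.mem_ball_self hr, ?_⟩
    funext x
    show (mu (ψ 0 x))⁻¹ • ψ 0 x = T x
    rw [h0, mu, hT.1 x]
    simp
  have hsub := hpre.subset_connectedComponentIn hT' (by
    rintro _ ⟨v, hv, rfl⟩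
    exact norm_mem (h v hv).1 (h v hv).2)
  intro v hv
  exact hsub ⟨v, hv, rfl⟩

theorem main_of_T {e c : ℕ} (hg : 2 ≤ e + 1) (T : Fin (e+1) × Bool → Matrix (Fin (c+1)) (Fin (c+1)) ℝ)
    (hT : T ∈ RepVariety (e+1) (c+1) ℝ)
    (hZ : ∀ y : Matrix (Fin (c+1)) (Fin (c+1)) ℝ, y * T (0,false) = T (0,false) * y → y * T (0,true) = T (0,true) * y → ∃ t : ℝ, y = t • 1)
    (P : MvPolynomial ((Fin (e+1) × Bool) × Fin (c+1) × Fin (c+1)) ℝ)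
    (hP : ∀ A ∈ HIT (e+1) (c+1) T, eval (ent A) P = 0)
    (ρ0 : Fin (e+1) × Bool → Matrix (Fin (c+1)) (Fin (c+1)) ℝ) (hρ0 : ρ0 ∈ RepVariety (e+1) (c+1) ℝ) :
    eval (ent ρ0) P = 0 := by
  classical
  set d := (2 * (e+1) - 1) * (c+1)^2 + 1 with hdd
  have hd : d + (c+1)^2 = 2*(e+1)*(c+1)^2 + 1 := by
    have h1 : 2 * (e+1) = (2*(e+1) - 1) + 1 := by omega
    rw [hdd]
    conv_rhs => rw [h1, add_mul, one_mul]
    ring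
  obtain ⟨co, la, ka, r, hr, ψ, h0, hψc, hψ⟩ := real_point T hT hZ d hd
  let S : Set ℝ := (P.coeffs : Set ℝ) ∪ Set.range (ent ρ0) ∪ Set.range (fun x : Fin d × ((Fin (e+1) × Bool) × Fin (c+1) × Fin (c+1)) => co x.1 x.2) ∪ Set.range la ∪ Set.range ka
  have hSf : S.Finite := by
    refine Set.Finite.union (Set.Finite.union (Set.Finite.union (Set.Finite.union P.coeffs.finite_toSet ?_) ?_) ?_) ?_
    all_goals exact Set.finite_range _
  let k := Subfield.closure S
  haveI : Countable k := closure_countable S hSf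
  have hmem : ∀ s ∈ S, s ∈ k := fun s hs => Subfield.subset_closure hs
  have hk : ∀ x : k, algebraMap k ℝ x = x := fun x => rfl
  obtain ⟨b, hb, hbr⟩ := exists_indep_small (k := k) d r hr
  obtain ⟨hGL, hdet, hv⟩ := hψ b hbr
  -- descend P
  obtain ⟨P', hP'⟩ : P ∈ Set.range (MvPolynomial.map (algebraMap k ℝ)) := by
    rw [MvPolynomial.mem_range_map_iff_coeffs_subset]
    intro s hs
    exact ⟨⟨s, hmem s (Or.inl (Or.inl (Or.inl (Or.inl hs))))⟩, rfl⟩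
  -- descend ρ0
  let ρk : Fin (e+1) × Bool → Matrix (Fin (c+1)) (Fin (c+1)) k := fun x => Matrix.of fun i j =>
    ⟨ρ0 x i j, hmem _ (Or.inl (Or.inl (Or.inl (Or.inr ⟨(x, i, j), rfl⟩))))⟩
  have hρk : ∀ x, (ρk x).map (algebraMap k ℝ) = ρ0 x := fun x => by ext i j; rfl
  have hinj : Function.Injective (algebraMap k ℝ) := (algebraMap k ℝ).injective
  have hdk : ∀ x, (ρk x).det = 1 := fun x => hinj (by rw [← det_mapR, hρk, hρ0.1 x, map_one])
  have hρkm : ρk ∈ RepVariety (e+1) (c+1) k := by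
    refine ⟨hdk, ?_⟩
    have hinj2 : Function.Injective ((algebraMap k ℝ).mapMatrix : Matrix (Fin (c+1)) (Fin (c+1)) k →+* _) :=
      Matrix.map_injective hinj
    apply hinj2
    rw [map_one, map_list_prod, List.map_ofFn, ← hρ0.2]
    congr 2
    funext i
    have hi : ∀ x, ((ρk x)⁻¹).map (algebraMap k ℝ) = (ρ0 x)⁻¹ := by
      intro x
      rw [← hρk x]
      refine (Matrix.inv_eq_right_inv ?_).symm
      rw [← Matrix.map_mul, Matrix.mul_nonsing_inv _ (by rw [hdk]; exact isUnit_one), Matrix.map_one _ (map_zero _) (map_one _)]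
    simp only [Function.comp, map_mul, RingHom.mapMatrix_apply, hi, hρk]
  let q : Fin d → MvPolynomial ((Fin (e+1) × Bool) × Fin (c+1) × Fin (c+1)) k := fun j =>
    ∑ p, C (⟨co j p, hmem _ (Or.inl (Or.inl (Or.inr ⟨(j, p), rfl⟩)))⟩ : k) * X p
      + C (⟨la j, hmem _ (Or.inl (Or.inr ⟨j, rfl⟩))⟩ : k) * pdet (fun x => Matrix.of fun i l => (X (x, i, l) : MvPolynomial ((Fin (e+1) × Bool) × Fin (c+1) × Fin (c+1)) k))
      + C (⟨ka j, hmem _ (Or.inr ⟨j, rfl⟩)⟩ : k)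
  have hq : ∀ j, aeval (ent (ψ b)) (q j) = b j := by
    intro j
    have hpd : aeval (ent (ψ b)) (pdet (fun x => Matrix.of fun i l => (X (x, i, l) : MvPolynomial ((Fin (e+1) × Bool) × Fin (c+1) × Fin (c+1)) k))) = pdet (ψ b) := by
      refine (pdet_map (aeval (R := k) (ent (ψ b))).toRingHom _).symm.trans ?_
      congr 1
      funext x
      ext i l
      simp [ent]
    rw [hv j]
    simp only [q, map_add, map_sum, map_mul, aeval_C, aeval_X, hpd, hk]
  have hq1 : AlgebraicIndependent k (fun i => aeval (ent (ψ b)) (q i)) := by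
    simpa only [hq] using hb
  have hcard : (2 * (e+1) - 1) * (c+1)^2 + 1 ≤ Fintype.card (Fin d) := by rw [Fintype.card_fin]
  obtain ⟨hG, -⟩ := real_generic hg 0 hGL q hcard hq1
  set μ : Fin (e+1) × Bool → ℝ := fun x => mu (ψ b x) with hμ
  have hμ0 : ∀ x, μ x ≠ 0 := fun x => (mu_pos (hdet x)).ne'
  have hmemH := path_mem_HIT hT hr ψ h0 hψc (fun v hv => ⟨(hψ v hv).1, (hψ v hv).2.1⟩) b hbr
  have hS := Smp_of_Gd hG (fun x => (μ x)⁻¹) (fun x => inv_ne_zero (hμ0 x))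
  have hz := zeta_step P hP Finset.univ _ hmemH hS
  set ρ' : Fin (e+1) × Bool → Matrix (Fin (c+1)) (Fin (c+1)) ℂ := fun x => ((μ x)⁻¹ • ψ b x).map (algebraMap ℝ ℂ) with hρ'
  have hm : (fun x => (μ x : ℂ) • ρ' x) = fun x => (ψ b x).map (algebraMap ℝ ℂ) := by
    funext x
    ext i l
    have : (μ x : ℂ) ≠ 0 := by exact_mod_cast hμ0 x
    simp [hρ']
    field_simp
  have key := transfer (k := k) hg ρk hρkm ρ' (fun x => (μ x : ℂ)) (fun x => by
      rw [hρ']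
      show (((μ x)⁻¹ • ψ b x).map (algebraMap ℝ ℂ)).det = 1
      rw [det_mapR, (norm_mem hGL hdet).1 x, map_one]) (fun x => by exact_mod_cast hμ0 x)
    (by rw [hm]; exact hGL.map _) q hcard (by
      rw [hm]
      have h1 : ∀ i, aeval (ent (fun x => (ψ b x).map (algebraMap ℝ ℂ))) (q i) = algebraMap ℝ ℂ (aeval (ent (ψ b)) (q i)) := by
        intro i
        rw [← MvPolynomial.aeval_algebraMap_apply]
        rfl
      simp only [h1]
      exact hq1.map' (f := IsScalarTower.toAlgHom k ℝ ℂ) (algebraMap ℝ ℂ).injective) P' (by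
      intro z hz1
      have := hz z hz1 (fun x hx => absurd (Finset.mem_univ x) hx)
      rw [← hP', MvPolynomial.aeval_map_algebraMap] at this
      exact this)
  rw [← hP', MvPolynomial.eval_map]
  have h2 := congrArg (algebraMap k ℝ) key
  rw [map_zero, ← MvPolynomial.eval₂_id, MvPolynomial.eval₂_comp_left, RingHom.comp_id] at h2
  exact h2
end PartI4

section PartT1
open Polynomial in
/-- `w • f` agrees with a polynomial matrix wherever `w ≠ 0`. -/
def RatM {n : ℕ} (w : ℝ[X]) (f : ℝ → Matrix (Fin n) (Fin n) ℝ) : Prop :=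
  ∃ F : Matrix (Fin n) (Fin n) ℝ[X], ∀ t, w.eval t ≠ 0 → w.eval t • f t = F.map (Polynomial.eval t)

variable {n : ℕ}

open Polynomial in
theorem map_eval_mul (F G : Matrix (Fin n) (Fin n) ℝ[X]) (t : ℝ) :
    (F * G).map (Polynomial.eval t) = F.map (Polynomial.eval t) * G.map (Polynomial.eval t) :=
  Matrix.map_mul (f := Polynomial.evalRingHom t)

open Polynomial in
theorem RatM.mul {w1 w2 : ℝ[X]} {f1 f2 : ℝ → Matrix (Fin n) (Fin n) ℝ} (h1 : RatM w1 f1) (h2 : RatM w2 f2) :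
    RatM (w1 * w2) (fun t => f1 t * f2 t) := by
  obtain ⟨F, hF⟩ := h1
  obtain ⟨G, hG⟩ := h2
  refine ⟨F * G, fun t ht => ?_⟩
  rw [Polynomial.eval_mul] at ht ⊢
  rw [map_eval_mul, ← hF t (left_ne_zero_of_mul ht), ← hG t (right_ne_zero_of_mul ht), Matrix.smul_mul, Matrix.mul_smul, smul_smul]

open Polynomial in
theorem RatM.const (A : Matrix (Fin n) (Fin n) ℝ) : RatM 1 (fun _ => A) := by
  refine ⟨A.map Polynomial.C, fun t _ => ?_⟩
  ext i j
  simp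

open Polynomial in
/-- substituting a fraction in a polynomial curve -/
theorem RatM.subst {N : ℕ} (Pc : ℕ → Matrix (Fin n) (Fin n) ℝ) (q p : ℝ[X]) :
    RatM (p ^ N) (fun t => ∑ i ∈ Finset.range (N+1), (q.eval t / p.eval t) ^ i • Pc i) := by
  refine ⟨∑ i ∈ Finset.range (N+1), (q ^ i * p ^ (N - i)) • (Pc i).map Polynomial.C, fun t ht => ?_⟩
  by_cases hp : p.eval t = 0
  · have hN : N = 0 := by
      by_contra h
      rw [Polynomial.eval_pow, hp, zero_pow h] at ht
      exact ht rfl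
    subst hN
    ext a b
    simp
  ext a b
  simp only [Polynomial.eval_pow, Matrix.smul_apply, Matrix.sum_apply, Matrix.map_apply, Polynomial.eval_finset_sum, smul_eq_mul, Polynomial.eval_mul, Polynomial.eval_C, Finset.mul_sum]
  refine Finset.sum_congr rfl fun i hi => ?_
  have hi : i ≤ N := by simpa [Nat.lt_succ_iff] using hi
  rw [div_pow]
  have : p.eval t ^ N = p.eval t ^ i * p.eval t ^ (N - i) := by rw [← pow_add]; congr 1; omega
  rw [this]
  field_simp

open Polynomial in
theorem RatM.commute {w : ℝ[X]} {f : ℝ → Matrix (Fin n) (Fin n) ℝ} (h : RatM w f) (y : Matrix (Fin n) (Fin n) ℝ)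
    (hw : w ≠ 0) {S : Set ℝ} (hS : S.Infinite) (hy : ∀ t ∈ S, y * f t = f t * y) :
    ∀ t, w.eval t ≠ 0 → y * f t = f t * y := by
  obtain ⟨F, hF⟩ := h
  have key : y.map Polynomial.C * F = F * y.map Polynomial.C := by
    refine Matrix.ext fun a b => ?_
    refine Polynomial.eq_of_infinite_eval_eq _ _ ((hS.diff (Polynomial.finite_setOf_isRoot hw)).mono ?_)
    rintro t ⟨ht, ht2⟩
    have ht2 : w.eval t ≠ 0 := ht2
    have h1 : (y.map Polynomial.C * F).map (Polynomial.eval t) = (F * y.map Polynomial.C).map (Polynomial.eval t) := by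
      have h2 : (y.map (Polynomial.C : ℝ →+* ℝ[X])).map (Polynomial.eval t) = y := by ext i j; simp
      rw [map_eval_mul, map_eval_mul, ← hF t ht2, h2, Matrix.mul_smul, hy t ht, Matrix.smul_mul]
    exact congrFun (congrFun h1 a) b
  intro t ht
  have h1 := congrArg (fun G : Matrix (Fin n) (Fin n) ℝ[X] => G.map (Polynomial.eval t)) key
  have h2 : (y.map (Polynomial.C : ℝ →+* ℝ[X])).map (Polynomial.eval t) = y := by ext i j; simp
  simp only [map_eval_mul, ← hF t ht, h2, Matrix.mul_smul, Matrix.smul_mul] at h1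
  exact smul_right_injective _ ht h1

theorem sum_pow_smul_zero {V : Type} [AddCommGroup V] [Module ℝ V] [Module.Finite ℝ V] (N : ℕ) (B : ℕ → V) {S : Set ℝ} (hS : S.Infinite)
    (h : ∀ t ∈ S, ∑ i ∈ Finset.range N, t ^ i • B i = 0) : ∀ i < N, B i = 0 := by
  intro i hi
  refine (Module.forall_dual_apply_eq_zero_iff ℝ (B i)).1 fun φ => ?_
  have hp : (∑ i ∈ Finset.range N, Polynomial.C (φ (B i)) * Polynomial.X ^ i) = 0 := by
    refine Polynomial.eq_of_infinite_eval_eq _ _ (hS.mono ?_)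
    intro t ht
    have h1 := congrArg φ (h t ht)
    simp only [map_sum, map_smul, map_zero, smul_eq_mul] at h1
    simp only [Set.mem_setOf_eq, Polynomial.eval_finset_sum, Polynomial.eval_mul, Polynomial.eval_C, Polynomial.eval_pow, Polynomial.eval_X, Polynomial.eval_zero]
    rw [← h1]
    exact Finset.sum_congr rfl fun i _ => mul_comm _ _
  have h2 := congrArg (fun p => Polynomial.coeff p i) hp
  simpa [Polynomial.finset_sum_coeff, Polynomial.coeff_C_mul, Polynomial.coeff_X_pow, hi] using h2
end PartT1

section PartT2
variable {n : ℕ}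

open Polynomial in
theorem nilp_poly (N : Matrix (Fin n) (Fin n) ℝ) (hN : N ^ n = 0) :
    ∃ G : Matrix (Fin n) (Fin n) ℝ[X], ∀ k : ℕ, (1 + N) ^ k = G.map (Polynomial.eval (k:ℝ)) := by
  refine ⟨∑ i ∈ Finset.range n, (Polynomial.C ((i.factorial : ℝ)⁻¹) * descPochhammer ℝ i) • (N ^ i).map Polynomial.C, fun k => ?_⟩
  have h1 : (1 + N) ^ k = ∑ i ∈ Finset.range n, (k.choose i : ℝ) • N ^ i := by
    rw [add_comm, (Commute.one_right N).add_pow]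
    simp only [one_pow, mul_one]
    have h2 : ∀ m, k < m → n ≤ m → ∑ i ∈ Finset.range m, N ^ i * (k.choose i : Matrix (Fin n) (Fin n) ℝ) = ∑ i ∈ Finset.range n, (k.choose i : ℝ) • N ^ i := by
      intro m hkm hnm
      rw [← Finset.sum_subset (Finset.range_mono hnm)]
      · refine Finset.sum_congr rfl fun i _ => ?_
        rw [← nsmul_eq_mul', Nat.cast_smul_eq_nsmul]
      · intro i _ hi
        have : n ≤ i := by simpa using hi
        rw [pow_eq_zero_of_le this hN, zero_mul]
    rw [← h2 (max (k+1) n) (by omega) (le_max_right _ _)]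
    refine Finset.sum_subset (Finset.range_mono (le_max_left _ _)) ?_
    intro i _ hi
    have : k < i := by simpa using hi
    rw [Nat.choose_eq_zero_of_lt this]
    simp
  rw [h1]
  ext a b
  simp only [Matrix.sum_apply, Matrix.smul_apply, Matrix.map_apply, Polynomial.eval_finset_sum, smul_eq_mul, Polynomial.eval_mul, Polynomial.eval_C, descPochhammer_eval_eq_descFactorial]
  refine Finset.sum_congr rfl fun i hi => ?_
  rw [Nat.descFactorial_eq_factorial_mul_choose]
  have : (i.factorial : ℝ) ≠ 0 := by exact_mod_cast i.factorial_ne_zero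
  push_cast
  field_simp

open Polynomial in
theorem polymat_ext {F G : Matrix (Fin n) (Fin n) ℝ[X]} {S : Set ℝ} (hS : S.Infinite)
    (h : ∀ t ∈ S, F.map (Polynomial.eval t) = G.map (Polynomial.eval t)) : F = G := by
  refine Matrix.ext fun a b => Polynomial.eq_of_infinite_eval_eq _ _ (hS.mono fun t ht => ?_)
  exact congrFun (congrFun (h t ht) a) b

theorem infinite_nat : (Set.range (fun k : ℕ => (k : ℝ))).Infinite := Set.infinite_range_of_injective Nat.cast_injective

open Polynomial in
theorem unip_poly (f : ℝ → Matrix (Fin n) (Fin n) ℝ) (hc : Continuous f) (h0 : f 0 = 1)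
    (hadd : ∀ s t, f (s + t) = f s * f t) (hn : ∀ t, 0 < t → (f t - 1) ^ n = 0) :
    ∃ F : Matrix (Fin n) (Fin n) ℝ[X], ∀ t, f t = F.map (Polynomial.eval t) := by
  have hpow : ∀ t (k : ℕ), f (k * t) = f t ^ k := by
    intro t k
    induction k with
    | zero => simp [h0]
    | succ k ih => rw [pow_succ, ← ih, ← hadd]; congr 1; push_cast; ring
  have hG : ∀ m : ℕ, 0 < m → ∃ G : Matrix (Fin n) (Fin n) ℝ[X], ∀ k : ℕ, f (k / m) = G.map (Polynomial.eval ((k:ℝ) / m)) := by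
    intro m hm
    have hm' : (0:ℝ) < m := by exact_mod_cast hm
    obtain ⟨G, hG⟩ := nilp_poly (f (1 / m) - 1) (hn _ (by positivity))
    refine ⟨G.map (fun p => p.comp (Polynomial.C (m:ℝ) * Polynomial.X)), fun k => ?_⟩
    have h1 := hG k
    rw [add_sub_cancel, ← hpow] at h1
    rw [show (k:ℝ) / m = k * (1 / m) by ring, h1]
    ext a b
    simp only [Matrix.map_apply, Polynomial.eval_comp, Polynomial.eval_mul, Polynomial.eval_C, Polynomial.eval_X]
    congr 1
    field_simp
  obtain ⟨F, hF⟩ := hG 1 one_pos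
  have hF1 : ∀ k : ℕ, f k = F.map (Polynomial.eval (k:ℝ)) := fun k => by simpa using hF k
  have hpos : ∀ k m : ℕ, 0 < m → f (k / m) = F.map (Polynomial.eval ((k:ℝ) / m)) := by
    intro k m hm
    have hm' : (m:ℝ) ≠ 0 := by exact_mod_cast hm.ne'
    obtain ⟨G, hG⟩ := hG m hm
    rw [hG k, show G = F from polymat_ext infinite_nat ?_]
    rintro _ ⟨k', rfl⟩
    have := hG (k' * m)
    push_cast at this
    rw [mul_div_cancel_right₀ _ hm'] at this
    exact this.symm.trans (hF1 k')
  have hrat : ∀ q : ℚ, 0 ≤ q → f q = F.map (Polynomial.eval (q:ℝ)) := by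
    intro q hq
    have h1 := hpos q.num.toNat q.den q.den_pos
    have h2 : (q : ℝ) = (q.num.toNat : ℝ) / q.den := by
      rw [Rat.cast_def]
      have h3 : ((q.num.toNat : ℤ) : ℝ) = q.num := by rw [Int.toNat_of_nonneg (Rat.num_nonneg.2 hq)]
      rw [← h3, Int.cast_natCast]
    rw [h2]
    exact h1
  have hrat2 : ∀ q : ℚ, f q = F.map (Polynomial.eval (q:ℝ)) := by
    intro q
    obtain ⟨N, hN⟩ := exists_nat_gt (-q)
    have hsh : (f (-N)).map Polynomial.C * F.map (fun p => p.comp (Polynomial.X + Polynomial.C (N:ℝ))) = F := by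
      refine polymat_ext infinite_nat ?_
      rintro _ ⟨k, rfl⟩
      have h2 : ((f (-N)).map (Polynomial.C : ℝ →+* ℝ[X])).map (Polynomial.eval (k:ℝ)) = f (-N) := by ext i j; simp
      have h3 : (F.map (fun p => p.comp (Polynomial.X + Polynomial.C (N:ℝ)))).map (Polynomial.eval (k:ℝ)) = f ((k + N : ℕ)) := by
        rw [hF1]; ext i j; simp
      rw [map_eval_mul, h2, h3, ← hadd, ← hF1]
      congr 1
      push_cast; ring
    rw [← hsh, map_eval_mul]
    have h2 : ((f (-N)).map (Polynomial.C : ℝ →+* ℝ[X])).map (Polynomial.eval (q:ℝ)) = f (-N) := by ext i j; simp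
    have h3 : (F.map (fun p => p.comp (Polynomial.X + Polynomial.C (N:ℝ)))).map (Polynomial.eval (q:ℝ)) = f ((q + N : ℚ)) := by
      rw [hrat _ (by linarith)]; ext i j; simp
    rw [h2, h3, ← hadd]
    congr 1
    push_cast; ring
  refine ⟨F, fun t => ?_⟩
  have hFc : Continuous (fun t : ℝ => F.map (Polynomial.eval t)) := by
    refine continuous_matrix fun i j => ?_
    exact (F i j).continuous
  refine congrFun (Continuous.ext_on (Rat.denseRange_cast (𝕜 := ℝ)) hc hFc ?_) t
  rintro _ ⟨q, rfl⟩
  exact hrat2 q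

open Polynomial in
theorem polymat_sum (F : Matrix (Fin n) (Fin n) ℝ[X]) : ∃ (N : ℕ) (Pc : ℕ → Matrix (Fin n) (Fin n) ℝ),
    ∀ t, F.map (Polynomial.eval t) = ∑ i ∈ Finset.range (N+1), t ^ i • Pc i := by
  refine ⟨∑ a, ∑ b, (F a b).natDegree, fun i => F.map (fun p => p.coeff i), fun t => ?_⟩
  ext a b
  rw [Matrix.map_apply, Polynomial.eval_eq_sum_range' (n := (∑ a, ∑ b, (F a b).natDegree) + 1)]
  · simp only [Matrix.sum_apply, Matrix.smul_apply, Matrix.map_apply, smul_eq_mul]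
    exact Finset.sum_congr rfl fun i _ => mul_comm _ _
  · rw [Nat.lt_succ_iff]
    exact (Finset.single_le_sum (f := fun b => (F a b).natDegree) (fun _ _ => Nat.zero_le _) (Finset.mem_univ b)).trans
      (Finset.single_le_sum (f := fun a => ∑ b, (F a b).natDegree) (fun _ _ => Nat.zero_le _) (Finset.mem_univ a))

end PartT2

section PartT3
def uu (t : ℝ) : SL 2 ℝ := ⟨!![1, t; 0, 1], by simp [Matrix.det_fin_two]⟩
def ll (t : ℝ) : SL 2 ℝ := ⟨!![1, 0; t, 1], by simp [Matrix.det_fin_two]⟩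
def ww : SL 2 ℝ := ⟨!![0, -1; 1, 0], by simp [Matrix.det_fin_two]⟩
noncomputable def dd (s : ℝ) (hs : s ≠ 0) : SL 2 ℝ := ⟨!![s, 0; 0, s⁻¹], by simp [Matrix.det_fin_two, hs]⟩

theorem sl2_ext {A B : SL 2 ℝ} (h0 : A.1 0 0 = B.1 0 0) (h1 : A.1 0 1 = B.1 0 1) (h2 : A.1 1 0 = B.1 1 0) (h3 : A.1 1 1 = B.1 1 1) : A = B := by
  apply Subtype.ext
  ext i j
  fin_cases i <;> fin_cases j <;> assumption

theorem sl2_mul (A B : SL 2 ℝ) (i k : Fin 2) : (A * B).1 i k = A.1 i 0 * B.1 0 k + A.1 i 1 * B.1 1 k := by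
  rw [Matrix.SpecialLinearGroup.coe_mul, Matrix.mul_apply, Fin.sum_univ_two]
theorem uu00 (t : ℝ) : (uu t).1 0 0 = 1 := rfl
theorem uu01 (t : ℝ) : (uu t).1 0 1 = t := rfl
theorem uu10 (t : ℝ) : (uu t).1 1 0 = 0 := rfl
theorem uu11 (t : ℝ) : (uu t).1 1 1 = 1 := rfl
theorem ll00 (t : ℝ) : (ll t).1 0 0 = 1 := rfl
theorem ll01 (t : ℝ) : (ll t).1 0 1 = 0 := rfl
theorem ll10 (t : ℝ) : (ll t).1 1 0 = t := rfl
theorem ll11 (t : ℝ) : (ll t).1 1 1 = 1 := rfl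
theorem ww00 : ww.1 0 0 = 0 := rfl
theorem ww01 : ww.1 0 1 = -1 := rfl
theorem ww10 : ww.1 1 0 = 1 := rfl
theorem ww11 : ww.1 1 1 = 0 := rfl
theorem dd00 (s : ℝ) (hs : s ≠ 0) : (dd s hs).1 0 0 = s := rfl
theorem dd01 (s : ℝ) (hs : s ≠ 0) : (dd s hs).1 0 1 = 0 := rfl
theorem dd10 (s : ℝ) (hs : s ≠ 0) : (dd s hs).1 1 0 = 0 := rfl
theorem dd11 (s : ℝ) (hs : s ≠ 0) : (dd s hs).1 1 1 = s⁻¹ := rfl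
theorem uu_add (s t : ℝ) : uu (s + t) = uu s * uu t := by
  apply sl2_ext <;> simp [sl2_mul, uu00, uu01, uu10, uu11, ll00, ll01, ll10, ll11, ww00, ww01, ww10, ww11, dd00, dd01, dd10, dd11, add_comm]
theorem ll_add (s t : ℝ) : ll (s + t) = ll s * ll t := by
  apply sl2_ext <;> simp [sl2_mul, uu00, uu01, uu10, uu11, ll00, ll01, ll10, ll11, ww00, ww01, ww10, ww11, dd00, dd01, dd10, dd11, add_comm]
theorem uu_zero : uu 0 = 1 := by apply sl2_ext <;> simp [sl2_mul, uu00, uu01, uu10, uu11, ll00, ll01, ll10, ll11, ww00, ww01, ww10, ww11, dd00, dd01, dd10, dd11]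
theorem ll_zero : ll 0 = 1 := by apply sl2_ext <;> simp [sl2_mul, uu00, uu01, uu10, uu11, ll00, ll01, ll10, ll11, ww00, ww01, ww10, ww11, dd00, dd01, dd10, dd11]
theorem ll_conj (t : ℝ) : ll t * ww = ww * uu (-t) := by
  apply sl2_ext <;> simp [sl2_mul, uu00, uu01, uu10, uu11, ll00, ll01, ll10, ll11, ww00, ww01, ww10, ww11, dd00, dd01, dd10, dd11]
theorem dd_uu (s : ℝ) (hs : s ≠ 0) (t : ℝ) : dd s hs * uu t = uu (s^2 * t) * dd s hs := by
  apply sl2_ext <;> simp [sl2_mul, uu00, uu01, uu10, uu11, ll00, ll01, ll10, ll11, ww00, ww01, ww10, ww11, dd00, dd01, dd10, dd11]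
  field_simp
theorem dd_ll (s : ℝ) (hs : s ≠ 0) (t : ℝ) : dd s hs * ll t = ll (t / s^2) * dd s hs := by
  apply sl2_ext <;> simp [sl2_mul, uu00, uu01, uu10, uu11, ll00, ll01, ll10, ll11, ww00, ww01, ww10, ww11, dd00, dd01, dd10, dd11]
  field_simp
theorem dd_eq (s : ℝ) (hs : s ≠ 0) : dd s hs = uu s * ll (-1/s) * uu s * ww := by
  apply sl2_ext <;> simp only [sl2_mul, uu00, uu01, uu10, uu11, ll00, ll01, ll10, ll11, ww00, ww01, ww10, ww11, dd00, dd01, dd10, dd11] <;> field_simp <;> ring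
theorem dd_mul (s t : ℝ) (hs : s ≠ 0) (ht : t ≠ 0) : dd (s * t) (mul_ne_zero hs ht) = dd s hs * dd t ht := by
  apply sl2_ext <;> simp [sl2_mul, uu00, uu01, uu10, uu11, ll00, ll01, ll10, ll11, ww00, ww01, ww10, ww11, dd00, dd01, dd10, dd11, mul_comm]
theorem dd_one : dd 1 one_ne_zero = 1 := by apply sl2_ext <;> simp [sl2_mul, uu00, uu01, uu10, uu11, ll00, ll01, ll10, ll11, ww00, ww01, ww10, ww11, dd00, dd01, dd10, dd11]
theorem ww_eq : ww * (uu 1 * ll (-1) * uu 1) = 1 := by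
  apply sl2_ext <;> simp [sl2_mul, uu00, uu01, uu10, uu11, ll00, ll01, ll10, ll11, ww00, ww01, ww10, ww11, dd00, dd01, dd10, dd11]

theorem sl2_det (M : SL 2 ℝ) : M.1 0 0 * M.1 1 1 - M.1 0 1 * M.1 1 0 = 1 := by
  have := M.2
  rwa [Matrix.det_fin_two] at this

theorem big_cell (M : SL 2 ℝ) (h : M.1 0 0 ≠ 0) : M = ll (M.1 1 0 / M.1 0 0) * dd (M.1 0 0) h * uu (M.1 0 1 / M.1 0 0) := by
  have h1 := sl2_det M
  apply sl2_ext <;> simp [sl2_mul, uu00, uu01, uu10, uu11, ll00, ll01, ll10, ll11, ww00, ww01, ww10, ww11, dd00, dd01, dd10, dd11] <;> field_simp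
  linear_combination h1

theorem uu_ll (q t : ℝ) (h : 1 + q * t ≠ 0) : uu q * ll t = ll (t / (1 + q * t)) * dd (1 + q*t) h * uu (q / (1 + q * t)) := by
  have h' : 1 + t * q ≠ 0 := by rwa [mul_comm] at h
  apply sl2_ext <;> simp only [sl2_mul, uu00, uu01, uu10, uu11, ll00, ll01, ll10, ll11, ww00, ww01, ww10, ww11, dd00, dd01, dd10, dd11] <;> field_simp <;> ring

theorem sl2_gen (H : Subgroup (SL 2 ℝ)) (hu : ∀ t, uu t ∈ H) (hl : ∀ t, ll t ∈ H) : ∀ M, M ∈ H := by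
  have hw : ww ∈ H := by
    rw [eq_inv_of_mul_eq_one_left ww_eq]
    exact H.inv_mem (H.mul_mem (H.mul_mem (hu _) (hl _)) (hu _))
  have key : ∀ M : SL 2 ℝ, M.1 0 0 ≠ 0 → M ∈ H := by
    intro M h
    rw [big_cell M h, dd_eq]
    exact H.mul_mem (H.mul_mem (hl _) (H.mul_mem (H.mul_mem (H.mul_mem (hu _) (hl _)) (hu _)) hw)) (hu _)
  intro M
  by_cases h : M.1 0 0 = 0
  · have h1 := sl2_det M
    have h2 : M.1 1 0 ≠ 0 := by
      intro h2; rw [h, h2] at h1; simp at h1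
    have h3 := key (uu 1 * M) (by simpa [sl2_mul, uu00, uu01, h] using h2)
    exact (H.mul_mem_cancel_left (hu 1)).1 h3
  · exact key M h

variable {n : ℕ}

theorem continuous_uu : Continuous uu := by
  refine continuous_induced_rng.2 ?_
  refine continuous_matrix fun i j => ?_
  fin_cases i <;> fin_cases j <;> simp [uu] <;> fun_prop

theorem continuous_val (j : SL 2 ℝ →* SL n ℝ) (hj : Continuous j) (f : ℝ → SL 2 ℝ) (hf : Continuous f) :
    Continuous (fun t => (j (f t)).1) :=
  (continuous_induced_dom (f := fun A : SL n ℝ => (A : Matrix (Fin n) (Fin n) ℝ))).comp (hj.comp hf)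

open Polynomial in
theorem ju_poly (j : SL 2 ℝ →* SL n ℝ) (hj : Continuous j) :
    ∃ F : Matrix (Fin n) (Fin n) ℝ[X], ∀ t, (j (uu t)).1 = F.map (Polynomial.eval t) := by
  have hc := continuous_val j hj uu continuous_uu
  refine unip_poly (fun t => (j (uu t)).1) hc ?_ ?_ ?_
  · simp [uu_zero]
  · intro s t
    simp [uu_add]
  · have hconj : ∀ t, 0 < t → ∀ x : ℝ, (x • (1 : Matrix (Fin n) (Fin n) ℝ) - (j (uu t)).1).det = (x • (1 : Matrix (Fin n) (Fin n) ℝ) - (j (uu 1)).1).det := by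
      intro t ht x
      have hs : Real.sqrt t ≠ 0 := (Real.sqrt_pos.2 ht).ne'
      have h1 := dd_uu (Real.sqrt t) hs 1
      rw [Real.sq_sqrt ht.le, mul_one] at h1
      have h2 := congrArg (fun A => (j A).1) h1
      simp only [map_mul, Matrix.SpecialLinearGroup.coe_mul] at h2
      have h3 : (x • (1 : Matrix (Fin n) (Fin n) ℝ) - (j (uu t)).1) * (j (dd _ hs)).1 = (j (dd _ hs)).1 * (x • (1 : Matrix (Fin n) (Fin n) ℝ) - (j (uu 1)).1) := by
        rw [sub_mul, mul_sub, h2]; simp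
      have h4 := congrArg Matrix.det h3
      rw [Matrix.det_mul, Matrix.det_mul, (j (dd _ hs)).2, one_mul, mul_one] at h4
      exact h4
    have hone : ∀ x : ℝ, (x • (1 : Matrix (Fin n) (Fin n) ℝ) - (j (uu 1)).1).det = (x - 1)^n := by
      intro x
      have hcx : Continuous (fun t => (x • (1 : Matrix (Fin n) (Fin n) ℝ) - (j (uu t)).1).det) :=
        Continuous.matrix_det (continuous_const.sub hc)
      have h0 : (x • (1 : Matrix (Fin n) (Fin n) ℝ) - (j (uu 0)).1).det = (x - 1)^n := by
        rw [uu_zero, map_one, Matrix.SpecialLinearGroup.coe_one]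
        have : x • (1 : Matrix (Fin n) (Fin n) ℝ) - 1 = (x - 1) • 1 := by rw [sub_smul, one_smul]
        rw [this, Matrix.det_smul]; simp
      have h1 := (hcx.tendsto 0).mono_left (nhdsWithin_le_nhds (s := Set.Ioi (0:ℝ)))
      rw [h0] at h1
      refine tendsto_nhds_unique (f := fun t : ℝ => (x • (1 : Matrix (Fin n) (Fin n) ℝ) - (j (uu t)).1).det) (l := nhdsWithin 0 (Set.Ioi (0:ℝ))) ?_ h1
      refine Filter.Tendsto.congr' ?_ tendsto_const_nhds
      filter_upwards [self_mem_nhdsWithin] with t ht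
      exact (hconj t ht x).symm
    intro t ht
    have hcp : (j (uu t)).1.charpoly = (Polynomial.X - Polynomial.C 1) ^ n := by
      refine Polynomial.funext fun x => ?_
      rw [Matrix.eval_charpoly]
      have : (Matrix.scalar (Fin n)) x = x • (1 : Matrix (Fin n) (Fin n) ℝ) := by
        ext a b; simp [Matrix.diagonal_apply, Matrix.one_apply]
      rw [this, hconj t ht x, hone x]
      simp
    have h1 := Matrix.aeval_self_charpoly (j (uu t)).1
    rw [hcp] at h1
    simpa using h1

/-- coefficients of the unipotent curves -/
theorem curves (j : SL 2 ℝ →* SL n ℝ) (hj : Continuous j) :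
    ∃ (N : ℕ) (Pc Lc : ℕ → Matrix (Fin n) (Fin n) ℝ), (∀ t, (j (uu t)).1 = ∑ i ∈ Finset.range (N+1), t ^ i • Pc i) ∧
      (∀ t, (j (ll t)).1 = ∑ i ∈ Finset.range (N+1), t ^ i • Lc i) := by
  obtain ⟨F, hF⟩ := ju_poly j hj
  obtain ⟨N, Pc, h⟩ := polymat_sum F
  refine ⟨N, Pc, fun i => (-1 : ℝ) ^ i • ((j ww).1 * Pc i * (j ww⁻¹).1), fun t => (hF t).trans (h t), fun t => ?_⟩
  have h1 : ll t = ww * uu (-t) * ww⁻¹ := by rw [← ll_conj, mul_inv_cancel_right]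
  rw [h1, map_mul, map_mul, Matrix.SpecialLinearGroup.coe_mul, Matrix.SpecialLinearGroup.coe_mul, hF, h, Finset.mul_sum, Finset.sum_mul]
  refine Finset.sum_congr rfl fun i _ => ?_
  rw [Matrix.mul_smul, Matrix.smul_mul, smul_smul, ← mul_pow]
  congr 2
  ring
end PartT3

section PartT4

theorem commute_of_deriv {A : Type} [NormedRing A] [NormedAlgebra ℝ A] (f : ℝ → A) (E y : A) (h0 : f 0 = 1)
    (hadd : ∀ s t, f (s + t) = f s * f t) (hE : HasDerivAt f E 0) (hy : y * E = E * y) (t : ℝ) : y * f t = f t * y := by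
  have hd : ∀ t, HasDerivAt f (f t * E) t := by
    intro t
    have h1 : HasDerivAt (fun s => f t * f (s - t)) (f t * E) t := by
      have h2 : HasDerivAt f E (t - t) := by rwa [sub_self]
      exact (h2.comp_sub_const t t).const_mul (f t)
    refine h1.congr_of_eventuallyEq (Filter.Eventually.of_forall fun s => ?_)
    show f s = f t * f (s - t)
    rw [← hadd]; congr 1; ring
  have hd' : ∀ t, HasDerivAt (fun s => f (-s)) (-(E * f (-t))) t := by
    intro t
    have h1 : HasDerivAt (fun s => f (-s)) (-(f (-t) * E)) t := by
      have := (hd (-t)).scomp t (hasDerivAt_neg t)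
      exact HasDerivAt.congr_deriv (f := fun s => f (-s)) this (by simp)
    have h2 : f (-t) * E = E * f (-t) := by
      have h3 : HasDerivAt f (E * f (-t)) (-t) := by
        have h1 : HasDerivAt (fun s => f (s - (-t)) * f (-t)) (E * f (-t)) (-t) := by
          have h2 : HasDerivAt f E (-t - -t) := by rwa [sub_self]
          exact (h2.comp_sub_const (-t) (-t)).mul_const (f (-t))
        refine h1.congr_of_eventuallyEq (Filter.Eventually.of_forall fun s => ?_)
        show f s = f (s - (-t)) * f (-t)
        rw [← hadd]; congr 1; ring
      exact (hd (-t)).unique h3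
    rwa [h2] at h1
  have hcons : ∀ t, HasDerivAt (fun s => f s * y * f (-s)) 0 t := by
    intro t
    have h1 := ((hd t).mul_const y).mul (hd' t)
    refine HasDerivAt.congr_deriv (f := fun s => f s * y * f (-s)) h1 ?_
    rw [mul_neg, ← mul_assoc, mul_assoc (f t) E y, ← hy, ← mul_assoc, add_neg_cancel]
  have h1 := is_const_of_deriv_eq_zero (fun s => (hcons s).differentiableAt) (fun s => (hcons s).deriv) t 0
  simp only [h0, neg_zero, one_mul, mul_one] at h1
  calc y * f t = f t * y * f (-t) * f t := by rw [h1]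
    _ = f t * y * (f (-t) * f t) := by rw [mul_assoc]
    _ = f t * y := by rw [← hadd, neg_add_cancel, h0, mul_one]

variable {n : ℕ}

attribute [local instance] Matrix.linftyOpNormedAddCommGroup Matrix.linftyOpNormedSpace Matrix.linftyOpNormedRing Matrix.linftyOpNormedAlgebra

/-- the Bruhat form of `j` on the big cell -/
noncomputable def PhiJ (j : SL 2 ℝ →* SL n ℝ) (p q r : ℝ) : Matrix (Fin n) (Fin n) ℝ :=
  (j (ll (r / p))).1 * ((j (uu p)).1 * (j (ll (-1 / p))).1 * (j (uu p)).1 * (j ww).1) * (j (uu (q / p))).1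

theorem PhiJ_eq (j : SL 2 ℝ →* SL n ℝ) (M : SL 2 ℝ) (h : M.1 0 0 ≠ 0) :
    PhiJ j (M.1 0 0) (M.1 0 1) (M.1 1 0) = (j M).1 := by
  conv_rhs => rw [big_cell M h, dd_eq]
  simp only [map_mul, Matrix.SpecialLinearGroup.coe_mul]
  rfl

theorem diff_sum {N : ℕ} (Pc : ℕ → Matrix (Fin n) (Fin n) ℝ) : Differentiable ℝ (fun t : ℝ => ∑ i ∈ Finset.range (N+1), t ^ i • Pc i) := by
  intro t
  refine DifferentiableAt.fun_sum fun i _ => ?_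
  exact (differentiableAt_id.pow i).smul_const (Pc i)

theorem lie_data (j : SL 2 ℝ →* SL n ℝ) (hj : Continuous j) : ∃ E F H : Matrix (Fin n) (Fin n) ℝ,
    (∀ y : Matrix (Fin n) (Fin n) ℝ, ∀ p q r : ℝ → ℝ, ∀ m0 p' q' r' : ℝ, HasDerivAt p p' m0 → HasDerivAt q q' m0 → HasDerivAt r r' m0 → p m0 = 1 → q m0 = 0 → r m0 = 0 →
      (∀ᶠ m in nhds m0, y * PhiJ j (p m) (q m) (r m) = PhiJ j (p m) (q m) (r m) * y) →
      y * (p' • H + q' • E + r' • F) = (p' • H + q' • E + r' • F) * y) ∧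
    (∀ y : Matrix (Fin n) (Fin n) ℝ, y * E = E * y → ∀ t, y * (j (uu t)).1 = (j (uu t)).1 * y) ∧
    (∀ y : Matrix (Fin n) (Fin n) ℝ, y * F = F * y → ∀ t, y * (j (ll t)).1 = (j (ll t)).1 * y) := by
  obtain ⟨N, Pc, Lc, hP, hL⟩ := curves j hj
  set Pf : ℝ → Matrix (Fin n) (Fin n) ℝ := fun t => (j (uu t)).1 with hPf
  set Lf : ℝ → Matrix (Fin n) (Fin n) ℝ := fun t => (j (ll t)).1 with hLf
  have hPd : Differentiable ℝ Pf := by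
    rw [show Pf = fun t : ℝ => ∑ i ∈ Finset.range (N+1), t ^ i • Pc i from funext hP]
    exact diff_sum Pc
  have hLd : Differentiable ℝ Lf := by
    rw [show Lf = fun t : ℝ => ∑ i ∈ Finset.range (N+1), t ^ i • Lc i from funext hL]
    exact diff_sum Lc
  have hP0 : Pf 0 = 1 := by simp [hPf, uu_zero]
  have hL0 : Lf 0 = 1 := by simp [hLf, ll_zero]
  set K : ℝ → Matrix (Fin n) (Fin n) ℝ := fun p => Pf p * Lf (-1 / p) * Pf p * (j ww).1 with hK
  have hK1 : K 1 = 1 := by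
    have h1 := dd_eq 1 one_ne_zero
    rw [dd_one] at h1
    have h2 := congrArg (fun A => (j A).1) h1
    simp only [map_mul, map_one, Matrix.SpecialLinearGroup.coe_mul, Matrix.SpecialLinearGroup.coe_one] at h2
    exact h2.symm
  have hKd : DifferentiableAt ℝ K 1 := by
    have h1 : DifferentiableAt ℝ (fun p : ℝ => Lf (-1 / p)) 1 := by
      refine DifferentiableAt.comp (g := Lf) (1 : ℝ) (hLd _) ?_
      exact DifferentiableAt.div (differentiableAt_const _) differentiableAt_id one_ne_zero
    exact (((hPd 1).mul h1).mul (hPd 1)).mul_const _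
  refine ⟨deriv Pf 0, deriv Lf 0, deriv K 1, ?_, ?_, ?_⟩
  · intro y p q r m0 p' q' r' hp hq hr hp0 hq0 hr0 hy
    have hΦ : HasDerivAt (fun m => PhiJ j (p m) (q m) (r m)) (p' • deriv K 1 + q' • deriv Pf 0 + r' • deriv Lf 0) m0 := by
      have hp1 : p m0 ≠ 0 := by rw [hp0]; exact one_ne_zero
      have hqp : HasDerivAt (fun m => q m / p m) q' m0 := by
        have := hq.div hp hp1
        exact HasDerivAt.congr_deriv (f := fun m => q m / p m) this (by simp [hp0, hq0])
      have hrp : HasDerivAt (fun m => r m / p m) r' m0 := by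
        have := hr.div hp hp1
        exact HasDerivAt.congr_deriv (f := fun m => r m / p m) this (by simp [hp0, hr0])
      have h1 : HasDerivAt (fun m => Lf (r m / p m)) (r' • deriv Lf 0) m0 := by
        refine HasDerivAt.scomp (g₁ := Lf) m0 ?_ hrp
        simp only [hr0, zero_div]
        exact (hLd 0).hasDerivAt
      have h2 : HasDerivAt (fun m => Pf (q m / p m)) (q' • deriv Pf 0) m0 := by
        refine HasDerivAt.scomp (g₁ := Pf) m0 ?_ hqp
        simp only [hq0, zero_div]
        exact (hPd 0).hasDerivAt
      have h3 : HasDerivAt (fun m => K (p m)) (p' • deriv K 1) m0 := by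
        refine HasDerivAt.scomp (g₁ := K) m0 ?_ hp
        rw [hp0]
        exact hKd.hasDerivAt
      have h4 := (h1.mul h3).mul h2
      refine HasDerivAt.congr_deriv (f := fun m => PhiJ j (p m) (q m) (r m)) h4 ?_
      simp only [hp0, hq0, hr0, zero_div, hK1, hP0, hL0, mul_one, one_mul, Pi.mul_apply]
      abel
    have h5 : HasDerivAt (fun m => y * PhiJ j (p m) (q m) (r m)) _ m0 := hΦ.const_mul y
    have h6 : HasDerivAt (fun m => PhiJ j (p m) (q m) (r m) * y) _ m0 := hΦ.mul_const y
    exact h5.unique (h6.congr_of_eventuallyEq hy)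
  · intro y hy t
    exact commute_of_deriv Pf _ y hP0 (fun s t => by simp [hPf, uu_add]) (hPd 0).hasDerivAt hy t
  · intro y hy t
    exact commute_of_deriv Lf _ y hL0 (fun s t => by simp [hLf, ll_add]) (hLd 0).hasDerivAt hy t
end PartT4

section PartT5
variable {n : ℕ}

open Polynomial in
theorem RatM.constw (w : ℝ[X]) (A : Matrix (Fin n) (Fin n) ℝ) : RatM w (fun _ => A) := by
  refine ⟨w • A.map Polynomial.C, fun t _ => ?_⟩
  ext i j
  simp

open Polynomial in
theorem RatM.congr {w : ℝ[X]} {f g : ℝ → Matrix (Fin n) (Fin n) ℝ} (h : RatM w f) (hfg : ∀ t, w.eval t ≠ 0 → f t = g t) : RatM w g := by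
  obtain ⟨F, hF⟩ := h
  exact ⟨F, fun t ht => by rw [← hfg t ht]; exact hF t ht⟩

open Polynomial in
theorem rat_Phi (j : SL 2 ℝ →* SL n ℝ) (hj : Continuous j) (p q r d : ℝ[X]) : ∃ N : ℕ,
    RatM ((p * d) ^ (N + 1)) (fun m => PhiJ j (p.eval m / d.eval m) (q.eval m / d.eval m) (r.eval m / d.eval m)) := by
  obtain ⟨N, Pc, Lc, hP, hL⟩ := curves j hj
  refine ⟨3 * N, ?_⟩
  have h1 := (((RatM.subst (N := N) Lc r p).mul ((((RatM.subst (N := N) Pc p d).mul (RatM.subst (N := N) Lc (-d) p)).mul (RatM.subst (N := N) Pc p d)).mul (RatM.const (j ww).1))).mul (RatM.subst (N := N) Pc q p)).mul (RatM.constw (p * d * d ^ N) (1 : Matrix (Fin n) (Fin n) ℝ))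
  have h2 : p ^ N * (d ^ N * p ^ N * d ^ N * 1) * p ^ N * (p * d * d ^ N) = (p * d) ^ (3 * N + 1) := by ring
  rw [h2] at h1
  refine h1.congr fun t ht => ?_
  have hpd : p.eval t ≠ 0 ∧ d.eval t ≠ 0 := by
    rw [Polynomial.eval_pow, Polynomial.eval_mul] at ht
    exact mul_ne_zero_iff.1 ((pow_ne_zero_iff (Nat.succ_ne_zero _)).1 ht)
  have hp := hpd.1
  have hd := hpd.2
  simp only [← hP, ← hL, mul_one, PhiJ, Polynomial.eval_neg]
  rw [div_div_div_cancel_right₀ hd, div_div_div_cancel_right₀ hd, show -1 / (p.eval t / d.eval t) = -d.eval t / p.eval t by field_simp]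

open Polynomial in
theorem fam (j : SL 2 ℝ →* SL n ℝ) (hj : Continuous j) (y E F H : Matrix (Fin n) (Fin n) ℝ)
    (hlie : ∀ y : Matrix (Fin n) (Fin n) ℝ, ∀ p q r : ℝ → ℝ, ∀ m0 p' q' r' : ℝ, HasDerivAt p p' m0 → HasDerivAt q q' m0 → HasDerivAt r r' m0 → p m0 = 1 → q m0 = 0 → r m0 = 0 →
      (∀ᶠ m in nhds m0, y * PhiJ j (p m) (q m) (r m) = PhiJ j (p m) (q m) (r m) * y) →
      y * (p' • H + q' • E + r' • F) = (p' • H + q' • E + r' • F) * y)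
    (p q r d : ℝ[X]) (m0 : ℝ) (hd : d.eval m0 ≠ 0) (hp : p.eval m0 = d.eval m0) (hq : q.eval m0 = 0) (hr : r.eval m0 = 0)
    (hd' : d.derivative.eval m0 = 0) {S : Set ℝ} (hS : S.Infinite)
    (hy : ∀ m ∈ S, p.eval m ≠ 0 → d.eval m ≠ 0 → y * PhiJ j (p.eval m / d.eval m) (q.eval m / d.eval m) (r.eval m / d.eval m) = PhiJ j (p.eval m / d.eval m) (q.eval m / d.eval m) (r.eval m / d.eval m) * y) :
    y * (p.derivative.eval m0 • H + q.derivative.eval m0 • E + r.derivative.eval m0 • F) = (p.derivative.eval m0 • H + q.derivative.eval m0 • E + r.derivative.eval m0 • F) * y := by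
  obtain ⟨N, hN⟩ := rat_Phi j hj p q r d
  have hp0 : p ≠ 0 := by rintro rfl; rw [← hp] at hd; simp at hd
  have hd0 : d ≠ 0 := by rintro rfl; simp at hd
  have hw0 : (p * d) ^ (N+1) ≠ 0 := pow_ne_zero _ (mul_ne_zero hp0 hd0)
  have hcom := hN.commute y hw0 (hS.diff (Polynomial.finite_setOf_isRoot (mul_ne_zero hp0 hd0))) (by
    rintro m ⟨hm, hm2⟩
    have hm2 : (p * d).eval m ≠ 0 := hm2
    rw [Polynomial.eval_mul, mul_ne_zero_iff] at hm2
    exact hy m hm hm2.1 hm2.2)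
  have hder : ∀ f : ℝ[X], HasDerivAt (fun m => f.eval m / d.eval m) ((d.eval m0)⁻¹ * f.derivative.eval m0) m0 := by
    intro f
    have := (f.hasDerivAt m0).div (d.hasDerivAt m0) hd
    refine HasDerivAt.congr_deriv (f := fun m => f.eval m / d.eval m) this ?_
    rw [hd']
    field_simp
    ring
  have h1 := hlie y _ _ _ m0 _ _ _ (hder p) (hder q) (hder r) (by rw [hp, div_self hd]) (by rw [hq, zero_div]) (by rw [hr, zero_div]) (by
    have hc : ContinuousAt (fun m => ((p * d) ^ (N+1)).eval m) m0 := ((p * d) ^ (N+1)).continuous.continuousAt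
    have hne : ((p * d) ^ (N+1)).eval m0 ≠ 0 := by
      rw [Polynomial.eval_pow, Polynomial.eval_mul, hp]
      exact pow_ne_zero _ (mul_ne_zero hd hd)
    filter_upwards [hc.eventually_ne hne] with m hm
    exact hcom m hm)
  simp only [mul_smul, ← smul_add, Matrix.mul_smul, Matrix.smul_mul] at h1
  exact smul_right_injective _ (inv_ne_zero hd) h1

theorem sl2_CH (h : SL 2 ℝ) : h.1 * h.1 = (h.1 0 0 + h.1 1 1) • h.1 - 1 := by
  have hd := sl2_det h
  ext i k
  rw [Matrix.mul_apply, Fin.sum_univ_two]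
  fin_cases i <;> fin_cases k <;> simp <;> first | ring1 | linear_combination -hd | linear_combination hd

theorem pow_xy (h : SL 2 ℝ) (k : ℕ) : ∃ x z : ℝ, (h ^ k).1 = x • 1 + z • h.1 := by
  induction k with
  | zero => exact ⟨1, 0, by simp⟩
  | succ k ih =>
    obtain ⟨x, z, hxz⟩ := ih
    refine ⟨-z, x + z * (h.1 0 0 + h.1 1 1), ?_⟩
    rw [pow_succ, Matrix.SpecialLinearGroup.coe_mul, hxz, add_mul, Matrix.smul_mul, Matrix.smul_mul, sl2_CH]
    simp only [one_mul, smul_sub, add_smul, mul_smul, neg_smul]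
    abel

theorem tangent (j : SL 2 ℝ →* SL n ℝ) (hj : Continuous j) (y E F H : Matrix (Fin n) (Fin n) ℝ)
    (hlie : ∀ y : Matrix (Fin n) (Fin n) ℝ, ∀ p q r : ℝ → ℝ, ∀ m0 p' q' r' : ℝ, HasDerivAt p p' m0 → HasDerivAt q q' m0 → HasDerivAt r r' m0 → p m0 = 1 → q m0 = 0 → r m0 = 0 →
      (∀ᶠ m in nhds m0, y * PhiJ j (p m) (q m) (r m) = PhiJ j (p m) (q m) (r m) * y) →
      y * (p' • H + q' • E + r' • F) = (p' • H + q' • E + r' • F) * y)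
    (h : SL 2 ℝ) (hinf : ∀ k : ℕ, k ≠ 0 → h ^ k ≠ 1) (hy : y * (j h).1 = (j h).1 * y) :
    y * (((h.1 0 0 - h.1 1 1) / 2) • H + h.1 0 1 • E + h.1 1 0 • F) = (((h.1 0 0 - h.1 1 1) / 2) • H + h.1 0 1 • E + h.1 1 0 • F) * y := by
  have hyk : ∀ k : ℕ, y * (j (h ^ k)).1 = (j (h ^ k)).1 * y := by
    intro k
    rw [map_pow, Matrix.SpecialLinearGroup.coe_pow]
    exact (show Commute y (j h).1 from hy).pow_right k
  have hinj : Function.Injective (fun k : ℕ => h ^ k) := by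
    rw [injective_pow_iff_not_isOfFinOrder, isOfFinOrder_iff_pow_eq_one]
    rintro ⟨k, hk, hk1⟩
    exact hinf k hk.ne' hk1
  have hdet := sl2_det h
  set t := h.1 0 0 + h.1 1 1 with ht
  by_cases hcase : t ^ 2 = 4
  · have ht0 : t ≠ 0 := by rintro h0; rw [h0] at hcase; norm_num at hcase
    have hpow : ∀ k : ℕ, (h ^ (2 * k)).1 = (1 - 2 * (k:ℝ)) • 1 + (k * t) • h.1 := by
      intro k
      induction k with
      | zero => simp
      | succ k ih =>
        rw [mul_add, pow_add, Matrix.SpecialLinearGroup.coe_mul, ih, mul_one, pow_two, Matrix.SpecialLinearGroup.coe_mul, sl2_CH h, ← ht]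
        rw [add_mul, Matrix.smul_mul, one_mul, Matrix.smul_mul, mul_sub, Matrix.mul_smul, sl2_CH h, ← ht]
        push_cast
        ext i l
        simp only [Matrix.add_apply, Matrix.sub_apply, Matrix.smul_apply, smul_eq_mul, mul_one]
        linear_combination ((k:ℝ) * t * h.1 i l - k * (1 : Matrix (Fin 2) (Fin 2) ℝ) i l) * hcase
    have key := fam j hj y E F H hlie (1 + Polynomial.X * Polynomial.C (t * h.1 0 0 - 2)) (Polynomial.X * Polynomial.C (t * h.1 0 1)) (Polynomial.X * Polynomial.C (t * h.1 1 0)) 1 0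
      (by simp) (by simp) (by simp) (by simp) (by simp) infinite_nat (by
        rintro _ ⟨k, rfl⟩ h1 h2
        have h3 : (h ^ (2 * k)).1 0 0 ≠ 0 := by
          rw [hpow]; simp at h1 ⊢; intro h4; apply h1; linear_combination h4
        have h4 := hyk (2 * k)
        rw [← PhiJ_eq j _ h3, hpow] at h4
        convert h4 using 3 <;> simp <;> ring)
    have hsc : t • (((h.1 0 0 - h.1 1 1) / 2) • H + h.1 0 1 • E + h.1 1 0 • F) = (t * h.1 0 0 - 2) • H + (t * h.1 0 1) • E + (t * h.1 1 0) • F := by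
      simp only [smul_add, smul_smul]
      congr 3
      rw [ht] at hcase ⊢
      linear_combination (-1/2 : ℝ) * hcase
    simp only [Polynomial.derivative_add, Polynomial.derivative_one, Polynomial.derivative_mul, Polynomial.derivative_X, Polynomial.derivative_C, Polynomial.eval_add, Polynomial.eval_mul, Polynomial.eval_C, Polynomial.eval_X, Polynomial.eval_one, Polynomial.eval_zero, mul_zero, one_mul, zero_add, add_zero, zero_mul] at key
    rw [← hsc, Matrix.mul_smul, Matrix.smul_mul] at key
    exact smul_right_injective _ ht0 key
  · choose x z hxz using fun k => pow_xy h (k + 1)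
    have hcon : ∀ k, x k ^ 2 + t * x k * z k + z k ^ 2 = 1 := by
      intro k
      have h1 := sl2_det (h ^ (k+1))
      rw [hxz] at h1
      simp at h1
      rw [ht]
      linear_combination h1 - z k ^ 2 * hdet
    have hz : ∀ k, z k ≠ 0 := by
      intro k hk
      have h1 := hcon k
      rw [hk] at h1
      apply hinf ((k+1) * 2) (by omega)
      apply Subtype.ext
      rw [pow_mul, pow_two, Matrix.SpecialLinearGroup.coe_mul, hxz, hk]
      simp only [zero_smul, add_zero, Matrix.smul_mul, one_mul, smul_smul]
      rw [show x k * x k = 1 by linear_combination h1]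
      simp
    set m : ℕ → ℝ := fun k => (x k - 1) / z k with hm
    have hx : ∀ k, x k = 1 + z k * m k := by
      intro k; have := hz k; simp only [hm]; field_simp; ring
    have hrel : ∀ k, z k * (m k ^ 2 + t * m k + 1) = - (2 * m k + t) := by
      intro k
      have h1 := hcon k
      rw [hx k] at h1
      apply mul_left_cancel₀ (hz k)
      linear_combination h1
    have hdel : ∀ k, m k ^ 2 + t * m k + 1 ≠ 0 := by
      intro k hk
      have h1 := hrel k
      rw [hk, mul_zero] at h1
      apply hcase
      have h2 : m k = - t / 2 := by linarith
      rw [h2] at hk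
      linear_combination -4 * hk
    have hminj : Function.Injective m := by
      intro k l hkl
      have hzz : z k = z l := by
        have h1 := hrel k
        rw [hkl, ← hrel l] at h1
        exact mul_right_cancel₀ (hdel l) h1
      have hxx : x k = x l := by rw [hx k, hx l, hzz, hkl]
      have : h ^ (k+1) = h ^ (l+1) := Subtype.ext (by rw [hxz, hxz, hzz, hxx])
      have := hinj this
      omega
    have key := fam j hj y E F H hlie (1 - Polynomial.X ^ 2 - (2 * Polynomial.X + Polynomial.C t) * Polynomial.C (h.1 0 0)) (-((2 * Polynomial.X + Polynomial.C t) * Polynomial.C (h.1 0 1))) (-((2 * Polynomial.X + Polynomial.C t) * Polynomial.C (h.1 1 0)))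
      (Polynomial.X ^ 2 + Polynomial.C t * Polynomial.X + 1) (-t/2)
      (by simp; intro h0; apply hcase; linear_combination -4 * h0) (by simp; ring) (by simp; left; ring) (by simp; left; ring) (by simp; ring) (Set.infinite_range_of_injective hminj) (by
        rintro _ ⟨k, rfl⟩ h1 h2
        have hz' : z k = - (2 * m k + t) / (m k ^ 2 + t * m k + 1) := by
          rw [eq_div_iff (hdel k)]; exact hrel k
        have hx' : x k = (1 - m k ^ 2) / (m k ^ 2 + t * m k + 1) := by
          rw [eq_div_iff (hdel k), hx k]; linear_combination m k * hrel k
        have e00 : (h ^ (k+1)).1 0 0 = (1 - m k ^ 2 - (2 * m k + t) * h.1 0 0) / (m k ^ 2 + t * m k + 1) := by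
          rw [hxz, hx', hz']; simp; ring
        have e01 : (h ^ (k+1)).1 0 1 = (-((2 * m k + t) * h.1 0 1)) / (m k ^ 2 + t * m k + 1) := by
          rw [hxz, hx', hz']; simp; ring
        have e10 : (h ^ (k+1)).1 1 0 = (-((2 * m k + t) * h.1 1 0)) / (m k ^ 2 + t * m k + 1) := by
          rw [hxz, hx', hz']; simp; ring
        have h3 : (h ^ (k+1)).1 0 0 ≠ 0 := by
          rw [e00]
          refine div_ne_zero ?_ (hdel k)
          simpa using h1
        have h4 := hyk (k+1)
        rw [← PhiJ_eq j _ h3, e00, e01, e10] at h4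
        simpa using h4)
    have hsc : (-2 : ℝ) • (((h.1 0 0 - h.1 1 1) / 2) • H + h.1 0 1 • E + h.1 1 0 • F) = (t - 2 * h.1 0 0) • H + (-(2 * h.1 0 1)) • E + (-(2 * h.1 1 0)) • F := by
      simp only [smul_add, smul_smul]
      congr 3
      · congr 1; rw [ht]; ring
      · ring
      · ring
    have key2 : y * ((t - 2 * h.1 0 0) • H + (-(2 * h.1 0 1)) • E + (-(2 * h.1 1 0)) • F) = ((t - 2 * h.1 0 0) • H + (-(2 * h.1 0 1)) • E + (-(2 * h.1 1 0)) • F) * y := by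
      refine Eq.trans ?_ (key.trans ?_)
      · congr 4 <;> simp <;> ring
      · congr 4 <;> simp <;> ring
    rw [← hsc, Matrix.mul_smul, Matrix.smul_mul] at key2
    exact smul_right_injective _ (by norm_num) key2
end PartT5

section PartT6
variable {n : ℕ}

theorem span_comm (y E F H : Matrix (Fin n) (Fin n) ℝ) (a b : SL 2 ℝ) (hd : ((a * b).1 - (b * a).1).det ≠ 0)
    (ht : ∀ h : SL 2 ℝ, h = a ∨ h = b ∨ h = a * b →
     y * (((h.1 0 0 - h.1 1 1) / 2) • H + h.1 0 1 • E + h.1 1 0 • F) = (((h.1 0 0 - h.1 1 1) / 2) • H + h.1 0 1 • E + h.1 1 0 • F) * y) :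
    y * E = E * y ∧ y * F = F * y := by
  have hl : ∀ h : SL 2 ℝ, h = a ∨ h = b ∨ h = a * b → ∀ i k, ((h.1 0 0 - h.1 1 1) / 2) * (y * H - H * y) i k + h.1 0 1 * (y * E - E * y) i k + h.1 1 0 * (y * F - F * y) i k = 0 := by
    intro h hh i k
    have h1 := congrFun (congrFun (ht h hh) i) k
    simp only [mul_add, add_mul, Matrix.mul_smul, Matrix.smul_mul, Matrix.add_apply, Matrix.smul_apply, smul_eq_mul] at h1
    simp only [Matrix.sub_apply]
    linear_combination h1
  rw [Matrix.det_fin_two] at hd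
  simp only [Matrix.sub_apply, sl2_mul] at hd
  have h1 := hl a (Or.inl rfl)
  have h2 := hl b (Or.inr (Or.inl rfl))
  have h3 := hl (a * b) (Or.inr (Or.inr rfl))
  simp only [sl2_mul] at h3
  set a0 := a.1 0 0
  set a1 := a.1 0 1
  set a2 := a.1 1 0
  set a3 := a.1 1 1
  set b0 := b.1 0 0
  set b1 := b.1 0 1
  set b2 := b.1 1 0
  set b3 := b.1 1 1
  constructor
  · rw [← sub_eq_zero]
    ext i k
    refine (mul_eq_zero.1 ?_).resolve_left hd
    have e1 := h1 i k
    have e2 := h2 i k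
    have e3 := h3 i k
    set p1 := (a0 - a3) / 2 with hp1
    set p2 := (b0 - b3) / 2 with hp2
    set p3 := (a0 * b0 + a1 * b2 - (a2 * b1 + a3 * b3)) / 2 with hp3
    set r3 := a2 * b0 + a3 * b2 with hr3
    linear_combination 2 * ((p2 * r3 - p3 * b2) * e1 - (p1 * r3 - p3 * a2) * e2 + (p1 * b2 - p2 * a2) * e3)
  · rw [← sub_eq_zero]
    ext i k
    refine (mul_eq_zero.1 ?_).resolve_left hd
    have e1 := h1 i k
    have e2 := h2 i k
    have e3 := h3 i k
    set p1 := (a0 - a3) / 2 with hp1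
    set p2 := (b0 - b3) / 2 with hp2
    set p3 := (a0 * b0 + a1 * b2 - (a2 * b1 + a3 * b3)) / 2 with hp3
    set q3 := a0 * b1 + a1 * b3 with hq3
    linear_combination (-2) * ((p2 * q3 - p3 * b1) * e1 - (p1 * q3 - p3 * a1) * e2 + (p1 * b1 - p2 * a1) * e3)

theorem kxk (K X : Matrix (Fin 2) (Fin 2) ℝ) (hdet : K.det = 0) (htr : (K * X).trace = 0) : K * X * K = 0 := by
  rw [Matrix.det_fin_two] at hdet
  rw [Matrix.trace_fin_two, Matrix.mul_apply, Matrix.mul_apply, Fin.sum_univ_two, Fin.sum_univ_two] at htr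
  ext i k
  rw [Matrix.mul_apply, Fin.sum_univ_two, Matrix.mul_apply, Matrix.mul_apply, Fin.sum_univ_two, Fin.sum_univ_two]
  fin_cases i <;> fin_cases k <;> simp
  · linear_combination K 0 0 * htr - X 1 1 * hdet
  · linear_combination K 0 1 * htr + X 0 1 * hdet
  · linear_combination K 1 0 * htr + X 1 0 * hdet
  · linear_combination K 1 1 * htr - X 0 0 * hdet

theorem metab (a b : SL 2 ℝ) (hd : ((a * b).1 - (b * a).1).det = 0) : ⁅a, b⁆ * (a * ⁅a, b⁆ * a⁻¹) = (a * ⁅a, b⁆ * a⁻¹) * ⁅a, b⁆ := by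
  set c := ⁅a, b⁆ with hc
  set k : Matrix (Fin 2) (Fin 2) ℝ := c.1 - 1 with hk
  have hkd : k.det = 0 := by
    have : k = ((a * b).1 - (b * a).1) * (a⁻¹ * b⁻¹).1 := by
      rw [sub_mul, ← Matrix.SpecialLinearGroup.coe_mul, ← Matrix.SpecialLinearGroup.coe_mul, hk, hc, commutatorElement_def,
        show b * a * (a⁻¹ * b⁻¹) = 1 by group, Matrix.SpecialLinearGroup.coe_one, ← mul_assoc]
    rw [this, Matrix.det_mul, hd, zero_mul]
  have hktr : k.trace = 0 := by
    have h1 := sl2_det c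
    rw [Matrix.det_fin_two] at hkd
    rw [Matrix.trace_fin_two]
    simp [hk] at hkd ⊢
    linear_combination h1 - hkd
  have haa : a.1 * (a⁻¹).1 = 1 := by rw [← Matrix.SpecialLinearGroup.coe_mul, mul_inv_cancel, Matrix.SpecialLinearGroup.coe_one]
  have haa' : (a⁻¹).1 * a.1 = 1 := by rw [← Matrix.SpecialLinearGroup.coe_mul, inv_mul_cancel, Matrix.SpecialLinearGroup.coe_one]
  have hsum : a.1 = a.1.trace • 1 - (a⁻¹).1 := by
    rw [Matrix.SpecialLinearGroup.coe_inv, Matrix.adjugate_fin_two, Matrix.trace_fin_two]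
    ext i l
    fin_cases i <;> fin_cases l <;> simp
  have t1 : (k * (a⁻¹).1).trace = 0 := by
    rw [hk, sub_mul, ← Matrix.SpecialLinearGroup.coe_mul, Matrix.trace_sub, one_mul, hc, commutatorElement_def]
    rw [Matrix.SpecialLinearGroup.coe_mul, Matrix.trace_mul_comm, ← Matrix.SpecialLinearGroup.coe_mul, show a⁻¹ * (a * b * a⁻¹ * b⁻¹) = b * (a⁻¹ * b⁻¹) by group]
    rw [Matrix.SpecialLinearGroup.coe_mul, Matrix.trace_mul_comm, ← Matrix.SpecialLinearGroup.coe_mul, show a⁻¹ * b⁻¹ * b = a⁻¹ by group, sub_self]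
  have t2 : (k * a.1).trace = 0 := by
    rw [hsum, mul_sub, Matrix.trace_sub, t1, Matrix.mul_smul, mul_one, Matrix.trace_smul, hktr]; simp
  have k1 := kxk k _ hkd t1
  have k2 := kxk k _ hkd t2
  have hcm : c.1 = k + 1 := by rw [hk]; abel
  apply Subtype.ext
  simp only [Matrix.SpecialLinearGroup.coe_mul]
  have e : a.1 * c.1 * (a⁻¹).1 = a.1 * k * (a⁻¹).1 + 1 := by rw [hcm, mul_add, add_mul, mul_one, haa]
  rw [e, hcm]
  have e1 : k * (a.1 * k * (a⁻¹).1) = 0 := by rw [← mul_assoc, ← mul_assoc, k2, zero_mul]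
  have e2 : (a.1 * k * (a⁻¹).1) * k = 0 := by rw [mul_assoc, mul_assoc, ← mul_assoc k, k1, mul_zero]
  rw [add_mul k, mul_add k, add_mul, mul_add _ k, e1, e2]
  simp only [one_mul, mul_one]
  abel

theorem gen_comm (j : SL 2 ℝ →* SL n ℝ) (hj : Continuous j) (y : Matrix (Fin n) (Fin n) ℝ) (a b : SL 2 ℝ)
    (hd : ((a * b).1 - (b * a).1).det ≠ 0) (ha : ∀ k : ℕ, k ≠ 0 → a ^ k ≠ 1) (hb : ∀ k : ℕ, k ≠ 0 → b ^ k ≠ 1) (hab : ∀ k : ℕ, k ≠ 0 → (a * b) ^ k ≠ 1)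
    (hya : y * (j a).1 = (j a).1 * y) (hyb : y * (j b).1 = (j b).1 * y) (M : SL 2 ℝ) : y * (j M).1 = (j M).1 * y := by
  obtain ⟨E, F, H, hlie, hE, hF⟩ := lie_data j hj
  have hyab : y * (j (a * b)).1 = (j (a * b)).1 * y := by
    rw [map_mul, Matrix.SpecialLinearGroup.coe_mul, ← mul_assoc, hya, mul_assoc, hyb, mul_assoc]
  obtain ⟨h1, h2⟩ := span_comm y E F H a b hd (by
    rintro h (rfl | rfl | rfl)
    · exact tangent j hj y E F H hlie _ ha hya
    · exact tangent j hj y E F H hlie _ hb hyb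
    · exact tangent j hj y E F H hlie _ hab hyab)
  refine sl2_gen ⟨⟨⟨{M | y * (j M).1 = (j M).1 * y}, ?_⟩, ?_⟩, ?_⟩ (hE y h1) (hF y h2) M
  · intro A B hA hB
    simp only [Set.mem_setOf_eq] at hA hB ⊢
    rw [map_mul, Matrix.SpecialLinearGroup.coe_mul, ← mul_assoc, hA, mul_assoc, hB, mul_assoc]
  · simp
  · intro A hA
    simp only [Set.mem_setOf_eq] at hA ⊢
    have i1 : (j A).1 * (j A⁻¹).1 = 1 := by rw [← Matrix.SpecialLinearGroup.coe_mul, ← map_mul]; simp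
    have i2 : (j A⁻¹).1 * (j A).1 = 1 := by rw [← Matrix.SpecialLinearGroup.coe_mul, ← map_mul]; simp
    have hA : y * (j A).1 = (j A).1 * y := hA
    show y * (j A⁻¹).1 = (j A⁻¹).1 * y
    calc y * (j A⁻¹).1 = (j A⁻¹).1 * ((j A).1 * y) * (j A⁻¹).1 := by rw [← mul_assoc, i2, one_mul]
      _ = (j A⁻¹).1 * y * ((j A).1 * (j A⁻¹).1) := by rw [← hA]; simp only [mul_assoc]
      _ = _ := by rw [i1, mul_one]
end PartT6

section PartT7

theorem surf_lift {G : Type*} [Group G] {e : ℕ} (f : Fin (e+1) × Bool → G) (h : (List.ofFn fun i : Fin (e+1) => ⁅f (i, false), f (i, true)⁆).prod = 1) :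
    ∃ φ : SurfaceGroup (e+1) →* G, ∀ x, φ (PresentedGroup.of x) = f x := by
  refine ⟨PresentedGroup.toGroup (f := f) ?_, fun x => PresentedGroup.toGroup.of _⟩
  intro r hr
  rw [Set.mem_singleton_iff] at hr
  rw [hr, surfaceRelator, map_list_prod, List.map_ofFn, ← h]
  congr 2
  funext i
  simp [map_commutatorElement]

theorem surf_ab {e : ℕ} (z : Fin (e+1) × Bool → Multiplicative ℤ) : ∃ φ : SurfaceGroup (e+1) →* Multiplicative ℤ, ∀ x, φ (PresentedGroup.of x) = z x := by
  refine surf_lift z ?_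
  apply List.prod_eq_one
  intro x hx
  rw [List.mem_ofFn] at hx
  obtain ⟨i, rfl⟩ := hx
  exact commutatorElement_eq_one_iff_mul_comm.2 (mul_comm _ _)

theorem surf_inf {e : ℕ} (γ : SurfaceGroup (e+1)) (φ : SurfaceGroup (e+1) →* Multiplicative ℤ) (h : φ γ = Multiplicative.ofAdd 1) (k : ℕ) (hk : k ≠ 0) : γ ^ k ≠ 1 := by
  intro h1
  have h2 := congrArg φ h1
  rw [map_pow, h, map_one φ, ← ofAdd_nsmul] at h2
  have h3 : (k • (1 : ℤ)) = 0 := h2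
  simp at h3
  exact hk h3

theorem surf_perm {e : ℕ} (he : 2 ≤ e + 1) : ∃ φ : SurfaceGroup (e+1) →* Equiv.Perm (Fin 4), φ (PresentedGroup.of (0, false)) = finRotate 4 ∧ φ (PresentedGroup.of (0, true)) = Equiv.swap 0 1 := by
  obtain ⟨d, rfl⟩ : ∃ d, e = d + 1 := ⟨e - 1, by omega⟩
  obtain ⟨φ, hφ⟩ := surf_lift (e := d + 1) (fun p : Fin (d+1+1) × Bool => if p.1 = 0 then (if p.2 then Equiv.swap (0 : Fin 4) 1 else finRotate 4) else if p.1 = 1 then (if p.2 then finRotate 4 else Equiv.swap 0 1) else 1) (by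
    rw [List.ofFn_succ, List.ofFn_succ, List.prod_cons, List.prod_cons]
    rw [List.prod_eq_one]
    · simp [commutatorElement_def, mul_assoc]
    · intro x hx
      rw [List.mem_ofFn] at hx
      obtain ⟨i, rfl⟩ := hx
      have h1 : i.succ.succ ≠ (0 : Fin (d+2)) := Fin.succ_ne_zero _
      have h2 : i.succ.succ ≠ (1 : Fin (d+2)) := by
        rw [← Fin.succ_zero_eq_one]
        intro h
        exact Fin.succ_ne_zero _ (Fin.succ_injective _ h)
      simp [h1, h2])
  exact ⟨φ, by rw [hφ]; simp, by rw [hφ]; simp⟩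

theorem perm_noncomm : ⁅finRotate 4, Equiv.swap (0 : Fin 4) 1⁆ * (finRotate 4 * ⁅finRotate 4, Equiv.swap (0 : Fin 4) 1⁆ * (finRotate 4)⁻¹) ≠ (finRotate 4 * ⁅finRotate 4, Equiv.swap (0 : Fin 4) 1⁆ * (finRotate 4)⁻¹) * ⁅finRotate 4, Equiv.swap (0 : Fin 4) 1⁆ := by
  decide

theorem teich_comm {e n : ℕ} (he : 2 ≤ e + 1) (ρ : SurfaceGroup (e+1) →* SL 2 ℝ) (hρ : Function.Injective ρ) (j : SL 2 ℝ →* SL n ℝ) (hj : Continuous j)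
    (y : Matrix (Fin n) (Fin n) ℝ) (hya : y * (j (ρ (PresentedGroup.of (0, false)))).1 = (j (ρ (PresentedGroup.of (0, false)))).1 * y)
    (hyb : y * (j (ρ (PresentedGroup.of (0, true)))).1 = (j (ρ (PresentedGroup.of (0, true)))).1 * y) (M : SL 2 ℝ) : y * (j M).1 = (j M).1 * y := by
  obtain ⟨φ, hφ⟩ := surf_ab (e := e) (fun p => if p = (0, false) then Multiplicative.ofAdd 1 else 1)
  obtain ⟨ψ, hψ⟩ := surf_ab (e := e) (fun p => if p = (0, true) then Multiplicative.ofAdd 1 else 1)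
  have hinf : ∀ γ : SurfaceGroup (e+1), (∀ k : ℕ, k ≠ 0 → γ ^ k ≠ 1) → ∀ k : ℕ, k ≠ 0 → (ρ γ) ^ k ≠ 1 := by
    intro γ h k hk h1
    rw [← map_pow, ← map_one ρ] at h1
    exact h k hk (hρ h1)
  refine gen_comm j hj y _ _ ?_ (hinf _ (surf_inf _ φ (by rw [hφ]; simp))) (hinf _ (surf_inf _ ψ (by rw [hψ]; simp))) ?_ hya hyb M
  · intro hd
    have h1 := metab _ _ hd
    rw [← map_commutatorElement, ← map_inv, ← map_mul, ← map_mul, ← map_mul, ← map_mul] at h1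
    have h2 := hρ h1
    obtain ⟨σ, hσ1, hσ2⟩ := surf_perm he
    have h3 := congrArg σ h2
    simp only [map_mul, map_inv, map_commutatorElement, hσ1, hσ2] at h3
    exact perm_noncomm h3
  · rw [← map_mul]
    exact hinf _ (surf_inf _ φ (by rw [map_mul, hφ, hφ]; simp))

theorem teich_mem {e n : ℕ} (ρ : SurfaceGroup (e+1) →* SL n ℝ) : repTuple ρ ∈ RepVariety (e+1) n ℝ := by
  refine ⟨fun x => (ρ _).2, ?_⟩
  have h1 : (PresentedGroup.mk ({surfaceRelator (e+1)} : Set _)) (surfaceRelator (e+1)) = 1 :=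
    PresentedGroup.one_of_mem (Set.mem_singleton _)
  have h4 : ((ρ.comp (PresentedGroup.mk _)) (surfaceRelator (e+1))) = 1 := by
    rw [MonoidHom.comp_apply, h1, map_one]
  have h4 : (ρ.comp (PresentedGroup.mk ({surfaceRelator (e+1)} : Set _))) ((List.ofFn fun i : Fin (e+1) =>
    ⁅FreeGroup.of (i, false), FreeGroup.of (i, true)⁆).prod) = 1 := h4
  rw [map_list_prod, List.map_ofFn] at h4
  have h5 := congrArg (Matrix.SpecialLinearGroup.toGL) h4
  rw [map_list_prod, List.map_ofFn, map_one] at h5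
  have h6 := congrArg (Units.coeHom _) h5
  rw [map_list_prod, List.map_ofFn, map_one] at h6
  rw [← h6]
  congr 2
  funext i
  simp only [Function.comp_apply, map_commutatorElement, commutatorElement_def, map_mul, map_inv, Units.coeHom_apply, Units.val_mul, Matrix.coe_units_inv]
  rfl
end PartT7

section PartT8
variable {n : ℕ}

theorem continuous_ll : Continuous ll := by
  refine continuous_induced_rng.2 ?_
  refine continuous_matrix fun i j => ?_
  fin_cases i <;> fin_cases j <;> simp [ll] <;> fun_prop

theorem top_limit (N K : ℕ) (G : ℝ → Matrix (Fin n) (Fin n) ℝ) (B : ℕ → Matrix (Fin n) (Fin n) ℝ)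
    (hG : ∀ s > 0, s ^ N • G s = ∑ i ∈ Finset.range K, s ^ i • B i) (hB : ∃ i < K, B i ≠ 0) :
    ∃ (m : ℕ) (A : Matrix (Fin n) (Fin n) ℝ), A ≠ 0 ∧ Filter.Tendsto (fun s : ℝ => (s ^ N / s ^ m) • G s) Filter.atTop (nhds A) := by
  classical
  obtain ⟨i0, hi0, hBi0⟩ := hB
  set m := Nat.findGreatest (fun i => B i ≠ 0 ∧ i < K) K with hm
  have hspec : B m ≠ 0 ∧ m < K := Nat.findGreatest_spec (P := fun i => B i ≠ 0 ∧ i < K) hi0.le ⟨hBi0, hi0⟩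
  have hgt : ∀ i, m < i → i < K → B i = 0 := by
    intro i hi hiK
    by_contra h
    exact Nat.findGreatest_is_greatest hi hiK.le ⟨h, hiK⟩
  refine ⟨m, B m, hspec.1, ?_⟩
  have h1 : Filter.Tendsto (fun s : ℝ => ∑ i ∈ Finset.range K, (s ^ i / s ^ m) • B i) Filter.atTop (nhds (∑ i ∈ Finset.range K, if i = m then B m else 0)) := by
    refine tendsto_finsetSum _ fun i hi => ?_
    rw [Finset.mem_range] at hi
    rcases lt_trichotomy i m with h | h | h
    · rw [if_neg h.ne]
      have := (tendsto_pow_div_pow_atTop_zero (𝕜 := ℝ) h).smul_const (B i)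
      rwa [zero_smul] at this
    · subst h
      rw [if_pos rfl]
      refine tendsto_const_nhds.congr' ?_
      filter_upwards [Filter.eventually_gt_atTop 0] with s hs
      rw [div_self (pow_ne_zero _ hs.ne'), one_smul]
    · rw [if_neg h.ne', hgt i h hi]
      simp
  rw [Finset.sum_ite_eq' , if_pos (Finset.mem_range.2 hspec.2)] at h1
  refine h1.congr' ?_
  filter_upwards [Filter.eventually_gt_atTop 0] with s hs
  rw [div_eq_inv_mul, mul_smul, hG s hs, Finset.smul_sum]
  refine Finset.sum_congr rfl fun i _ => ?_
  rw [smul_smul, div_eq_inv_mul]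

theorem jmul (j : SL 2 ℝ →* SL n ℝ) (A B : SL 2 ℝ) : (j (A * B)).1 = (j A).1 * (j B).1 := by
  rw [map_mul, Matrix.SpecialLinearGroup.coe_mul]

theorem jone (j : SL 2 ℝ →* SL n ℝ) : (j 1).1 = 1 := by
  rw [map_one, Matrix.SpecialLinearGroup.coe_one]

open Polynomial in
theorem D_limit (hn : n ≠ 0) (j : SL 2 ℝ →* SL n ℝ) (hj : Continuous j) : ∃ (N m : ℕ) (A : Matrix (Fin n) (Fin n) ℝ), A ≠ 0 ∧
    Filter.Tendsto (fun s : ℝ => (s ^ N / s ^ m) • (j (uu s * ll (-1/s) * uu s * ww)).1) Filter.atTop (nhds A) := by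
  obtain ⟨N, Pc, Lc, hP, hL⟩ := curves j hj
  have h1 : RatM (Polynomial.X ^ N) (fun s : ℝ => (j (uu s * ll (-1/s) * uu s * ww)).1) := by
    have h := (((RatM.subst (N := N) Pc Polynomial.X 1).mul (RatM.subst (N := N) Lc (-1) Polynomial.X)).mul (RatM.subst (N := N) Pc Polynomial.X 1)).mul (RatM.const (j ww).1)
    have h2 : (1 : ℝ[X]) ^ N * Polynomial.X ^ N * 1 ^ N * 1 = Polynomial.X ^ N := by simp
    rw [h2] at h
    refine h.congr fun t ht => ?_
    simp only [← hP, ← hL, jmul, Polynomial.eval_neg, Polynomial.eval_one, Polynomial.eval_X, div_one]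
  obtain ⟨F, hF⟩ := h1
  obtain ⟨K, B, hB⟩ := polymat_sum F
  have hG : ∀ s > 0, s ^ N • (j (uu s * ll (-1/s) * uu s * ww)).1 = ∑ i ∈ Finset.range (K+1), s ^ i • B i := by
    intro s hs
    have := hF s (by simp [hs.ne'])
    rw [hB] at this
    simpa using this
  obtain ⟨m, A, hA, hlim⟩ := top_limit N (K+1) _ B hG (by
    by_contra! hcon
    have h2 := hG 1 one_pos
    rw [Finset.sum_eq_zero (fun i hi => by rw [hcon i (Finset.mem_range.1 hi), smul_zero]), one_pow, one_smul] at h2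
    have h3 := (j (uu 1 * ll (-1/1) * uu 1 * ww)).2
    have : Nonempty (Fin n) := ⟨⟨0, Nat.pos_of_ne_zero hn⟩⟩
    rw [h2, Matrix.det_zero] at h3
    exact zero_ne_one h3)
  exact ⟨N, m, A, hA, hlim⟩

theorem scalar_commutant (hn : n ≠ 0) (j : SL 2 ℝ →* SL n ℝ) (hj : IsIrreducibleEmbedding n j) (y : Matrix (Fin n) (Fin n) ℝ)
    (hy : ∀ M, y * (j M).1 = (j M).1 * y) : ∃ t : ℝ, y = t • 1 := by
  obtain ⟨hc, hirr⟩ := hj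
  obtain ⟨N, m, A, hA, hlim⟩ := D_limit hn j hc
  set f : ℝ → ℝ := fun s => s ^ N / s ^ m with hf
  have hf0 : ∀ s, 0 < s → f s ≠ 0 := fun s hs => div_ne_zero (pow_ne_zero _ hs.ne') (pow_ne_zero _ hs.ne')
  have hfm : ∀ s t, f (s * t) = f s * f t := by
    intro s t; simp only [hf, mul_pow]; rw [mul_div_mul_comm]
  set D : ℝ → Matrix (Fin n) (Fin n) ℝ := fun s => (j (uu s * ll (-1/s) * uu s * ww)).1 with hDdef
  have hD : ∀ s (hs : s ≠ 0), D s = (j (dd s hs)).1 := fun s hs => by rw [dd_eq]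
  have hyA : y * A = A * y := by
    refine tendsto_nhds_unique ((Filter.Tendsto.const_mul y hlim)) ((hlim.mul_const y).congr fun s => ?_)
    rw [Matrix.smul_mul, Matrix.mul_smul, hy]
  have hUA : ∀ q, (j (uu q)).1 * A = A := by
    intro q
    have h0 : Filter.Tendsto (fun s : ℝ => q / s ^ 2) Filter.atTop (nhds 0) :=
      tendsto_const_nhds.div_atTop (Filter.tendsto_pow_atTop two_ne_zero)
    have h1 : Filter.Tendsto (fun s : ℝ => (j (uu (q / s ^ 2))).1) Filter.atTop (nhds 1) := by
      have h2 := ((continuous_val j hc uu continuous_uu).tendsto 0).comp h0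
      simp only [uu_zero, jone] at h2
      exact h2
    have h3 := hlim.mul h1
    rw [mul_one] at h3
    refine tendsto_nhds_unique ((Filter.Tendsto.const_mul _ hlim)) (h3.congr' ?_)
    filter_upwards [Filter.eventually_gt_atTop 0] with s hs
    show (f s • D s) * _ = _ * (f s • D s)
    rw [hD s hs.ne', Matrix.smul_mul, Matrix.mul_smul, ← jmul, ← jmul, dd_uu, mul_div_cancel₀ _ (pow_ne_zero 2 hs.ne')]
  have hDA : ∀ t (ht : 0 < t), f t • ((j (dd t ht.ne')).1 * A) = A := by
    intro t ht
    have h1 : Filter.Tendsto (fun s : ℝ => t * s) Filter.atTop Filter.atTop := Filter.tendsto_id.const_mul_atTop ht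
    refine tendsto_nhds_unique ?_ (hlim.comp h1)
    refine ((Filter.Tendsto.const_mul ((j (dd t ht.ne')).1) hlim).const_smul (f t)).congr' ?_
    filter_upwards [Filter.eventually_gt_atTop 0] with s hs
    show f t • (_ * (f s • D s)) = f (t * s) • D (t * s)
    rw [hD s hs.ne', hD (t * s) (mul_pos ht hs).ne', dd_mul t s ht.ne' hs.ne', jmul, hfm, Matrix.mul_smul, smul_smul]
  obtain ⟨k, hk⟩ : ∃ k, A.col k ≠ 0 := by
    by_contra! h
    apply hA
    ext i k
    exact congrFun (h k) i
  set v := A.col k with hv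
  have hvA : v = A *ᵥ Pi.single k 1 := by rw [Matrix.mulVec_single_one]
  have hUv : ∀ q, (j (uu q)).1 *ᵥ v = v := by
    intro q; rw [hvA, Matrix.mulVec_mulVec, hUA]
  have hDv : ∀ t (ht : 0 < t), f t • ((j (dd t ht.ne')).1 *ᵥ v) = v := by
    intro t ht; rw [hvA, Matrix.mulVec_mulVec, ← Matrix.smul_mulVec, hDA t ht]
  have hAl : ∀ t, A *ᵥ ((j (ll t)).1 *ᵥ v) = v := by
    intro t
    have h0 : Filter.Tendsto (fun s : ℝ => t / s ^ 2) Filter.atTop (nhds 0) :=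
      tendsto_const_nhds.div_atTop (Filter.tendsto_pow_atTop two_ne_zero)
    have h2 : Filter.Tendsto (fun s : ℝ => (j (ll (t / s ^ 2))).1 *ᵥ v) Filter.atTop (nhds v) := by
      have h3 : Continuous (fun t => (j (ll t)).1 *ᵥ v) := (continuous_val j hc ll continuous_ll).matrix_mulVec continuous_const
      have h2 := (h3.tendsto 0).comp h0
      simp only [ll_zero, jone, Matrix.one_mulVec] at h2
      exact h2
    have h4 : Continuous (fun B : Matrix (Fin n) (Fin n) ℝ => B *ᵥ ((j (ll t)).1 *ᵥ v)) := continuous_id.matrix_mulVec continuous_const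
    refine tendsto_nhds_unique ((h4.tendsto A).comp hlim) (h2.congr' ?_)
    filter_upwards [Filter.eventually_gt_atTop 0] with s hs
    show _ = (f s • D s) *ᵥ ((j (ll t)).1 *ᵥ v)
    rw [hD s hs.ne', Matrix.smul_mulVec, Matrix.mulVec_mulVec, ← jmul, dd_ll, jmul, ← Matrix.mulVec_mulVec, ← Matrix.mulVec_smul, hDv s hs]
  -- the span
  set W : Submodule ℝ (Fin n → ℝ) := Submodule.span ℝ {x | ∃ t : ℝ, 0 ≤ t ∧ x = (j (ll t)).1 *ᵥ v} with hW
  have hstab : ∀ M : SL 2 ℝ, (∀ t : ℝ, 0 ≤ t → (j M).1 *ᵥ ((j (ll t)).1 *ᵥ v) ∈ W) → ∀ x ∈ W, (j M).1 *ᵥ x ∈ W := by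
    intro M h
    have : W ≤ W.comap (Matrix.mulVecLin (j M).1) := by
      rw [hW, Submodule.span_le]
      rintro _ ⟨t, ht, rfl⟩
      exact h t ht
    exact fun x hx => this hx
  have hinvst : ∀ M : SL 2 ℝ, (∀ x ∈ W, (j M).1 *ᵥ x ∈ W) → ∀ x ∈ W, (j M⁻¹).1 *ᵥ x ∈ W := by
    intro M h x hx
    have i1 : (j M⁻¹).1 * (j M).1 = 1 := by rw [← jmul, inv_mul_cancel, jone]
    have hinj : Function.Injective (Matrix.mulVecLin (j M).1) := by
      intro a b hab
      have := congrArg (fun z => (j M⁻¹).1 *ᵥ z) hab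
      simp only [Matrix.mulVecLin_apply, Matrix.mulVec_mulVec, i1, Matrix.one_mulVec] at this
      exact this
    have hle : W.map (Matrix.mulVecLin (j M).1) ≤ W := by
      rintro _ ⟨z, hz, rfl⟩
      exact h z hz
    have heq : W.map (Matrix.mulVecLin (j M).1) = W :=
      Submodule.eq_of_le_of_finrank_eq hle (LinearEquiv.finrank_eq (Submodule.equivMapOfInjective _ hinj W)).symm
    rw [← heq] at hx
    obtain ⟨z, hz, rfl⟩ := hx
    rw [Matrix.mulVecLin_apply, Matrix.mulVec_mulVec, i1, Matrix.one_mulVec]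
    exact hz
  have hll : ∀ t : ℝ, 0 ≤ t → ∀ x ∈ W, (j (ll t)).1 *ᵥ x ∈ W := by
    intro t ht
    refine hstab _ fun s hs => ?_
    rw [Matrix.mulVec_mulVec, ← jmul, ← ll_add]
    exact Submodule.subset_span ⟨_, add_nonneg ht hs, rfl⟩
  have huu : ∀ t : ℝ, 0 ≤ t → ∀ x ∈ W, (j (uu t)).1 *ᵥ x ∈ W := by
    intro t ht
    refine hstab _ fun s hs => ?_
    have hpos : 0 < 1 + t * s := by positivity
    rw [Matrix.mulVec_mulVec, ← jmul, uu_ll t s hpos.ne', jmul, jmul, ← Matrix.mulVec_mulVec, hUv, ← Matrix.mulVec_mulVec]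
    have h1 : (j (dd (1 + t * s) hpos.ne')).1 *ᵥ v = (f (1 + t * s))⁻¹ • v := by
      rw [eq_inv_smul_iff₀ (hf0 _ hpos), hDv _ hpos]
    rw [h1, Matrix.mulVec_smul]
    exact W.smul_mem _ (Submodule.subset_span ⟨_, by positivity, rfl⟩)
  have hall : ∀ M : SL 2 ℝ, ∀ x ∈ W, (j M).1 *ᵥ x ∈ W := by
    intro M
    refine sl2_gen ⟨⟨⟨{M | ∀ x ∈ W, (j M).1 *ᵥ x ∈ W}, ?_⟩, ?_⟩, ?_⟩ ?_ ?_ M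
    · intro A B hA hB x hx
      rw [jmul, ← Matrix.mulVec_mulVec]
      exact hA _ (hB x hx)
    · intro x hx
      rw [jone, Matrix.one_mulVec]; exact hx
    · intro A hA
      exact hinvst A hA
    · intro t
      show ∀ x ∈ W, (j (uu t)).1 *ᵥ x ∈ W
      rcases le_total 0 t with h | h
      · exact huu t h
      · rw [show uu t = (uu (-t))⁻¹ from eq_inv_of_mul_eq_one_left (by rw [← uu_add, add_neg_cancel, uu_zero])]
        exact hinvst _ (huu _ (by linarith))
    · intro t
      show ∀ x ∈ W, (j (ll t)).1 *ᵥ x ∈ W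
      rcases le_total 0 t with h | h
      · exact hll t h
      · rw [show ll t = (ll (-t))⁻¹ from eq_inv_of_mul_eq_one_left (by rw [← ll_add, add_neg_cancel, ll_zero])]
        exact hinvst _ (hll _ (by linarith))
  have hvW : v ∈ W := Submodule.subset_span ⟨0, le_rfl, by rw [ll_zero, jone, Matrix.one_mulVec]⟩
  have hWtop : W = ⊤ := by
    rcases hirr W hall with h | h
    · rw [h, Submodule.mem_bot] at hvW
      exact absurd hvW hk
    · exact h
  have hAr : W ≤ (Submodule.span ℝ {v}).comap (Matrix.mulVecLin A) := by
    rw [hW, Submodule.span_le]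
    rintro _ ⟨t, ht, rfl⟩
    show A *ᵥ ((j (ll t)).1 *ᵥ v) ∈ Submodule.span ℝ {v}
    rw [hAl]
    exact Submodule.mem_span_singleton_self v
  have hAv : A *ᵥ v = v := by
    have := hAl 0
    rwa [ll_zero, jone, Matrix.one_mulVec] at this
  have hyv : y *ᵥ v ∈ Submodule.span ℝ {v} := by
    have h1 : y *ᵥ v = A *ᵥ (y *ᵥ v) := by
      rw [Matrix.mulVec_mulVec, ← hyA, ← Matrix.mulVec_mulVec, hAv]
    rw [h1]
    exact hAr (by rw [hWtop]; trivial)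
  obtain ⟨μ, hμ⟩ := Submodule.mem_span_singleton.1 hyv
  refine ⟨μ, ?_⟩
  rcases hirr (LinearMap.ker (Matrix.mulVecLin (y - μ • 1))) (by
    intro M x hx
    rw [LinearMap.mem_ker, Matrix.mulVecLin_apply] at hx ⊢
    rw [Matrix.mulVec_mulVec, sub_mul, hy, Matrix.smul_mul, one_mul, show (j M).1 * y - μ • (j M).1 = (j M).1 * (y - μ • 1) by rw [mul_sub, Matrix.mul_smul, mul_one], ← Matrix.mulVec_mulVec, hx, Matrix.mulVec_zero]) with h | h
  · exfalso
    apply hk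
    have : v ∈ LinearMap.ker (Matrix.mulVecLin (y - μ • 1)) := by
      rw [LinearMap.mem_ker, Matrix.mulVecLin_apply, Matrix.sub_mulVec, Matrix.smul_mulVec, Matrix.one_mulVec, hμ, sub_self]
    rw [h] at this
    exact this
  · rw [← sub_eq_zero]
    rw [LinearMap.ker_eq_top] at h
    ext i k
    have := congrFun (congrArg (fun (L : (Fin n → ℝ) →ₗ[ℝ] (Fin n → ℝ)) => L (Pi.single k 1)) h) i
    simpa [Matrix.mulVecLin_apply, Matrix.mulVec_single_one, Matrix.one_apply, Pi.single_apply] using this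
end PartT8

/-- The Hitchin component is Zariski-dense in `Hom(Γ_g, SL_n(ℝ))`: every real polynomial
in the `2g·n²` coordinates vanishing on `HIT_n` vanishes on all of `Hom(Γ_g, SL_n(ℝ))`. -/
theorem Hitchin_zariski_dense_real (g n : ℕ) (hg : 2 ≤ g) (hn : 2 ≤ n)
    (T : (Fin g × Bool) → Matrix (Fin n) (Fin n) ℝ) (hT : IsTeichmuller g n T)
    (P : MvPolynomial ((Fin g × Bool) × Fin n × Fin n) ℝ)
    (hP : ∀ A ∈ HIT g n T, MvPolynomial.eval (fun p => A p.1 p.2.1 p.2.2) P = 0) :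
    ∀ B ∈ RepVariety g n ℝ, MvPolynomial.eval (fun p => B p.1 p.2.1 p.2.2) P = 0 := by
  obtain ⟨e, rfl⟩ : ∃ e, g = e + 1 := ⟨g - 1, by omega⟩
  obtain ⟨c, rfl⟩ : ∃ c, n = c + 1 := ⟨n - 1, by omega⟩
  obtain ⟨ρ, j, hρ, hj, rfl⟩ := hT
  intro B hB
  refine main_of_T hg _ (teich_mem (j.comp ρ)) ?_ P hP B hB
  intro y hya hyb
  exact scalar_commutant (Nat.succ_ne_zero c) j hj y (teich_comm hg ρ hρ.1 j hj.1 y hya hyb)
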